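/- Let k be a field and n, m, l non-negative integers with n ≥ m + l + 2. There is a one-to-one correspondence between: pairs (Λ, Q) with Λ a finite-dimensional k-algebra and Q an (n, m, l)-quasi-precluster tilting right Λ-module; and relative n-Auslander–Gorenstein pairs (A, Q) with Q a self-orthogonal left A-module of projective dimension l and injective dimension m. The bijection sends (Λ, Q) to (End_Λ(Q), Q) and (A, Q) to (End_A(Q)^op, Q). -/

import Mathlib

universe u
open MulOpposite

noncomputable section
namespace Paper

section RingDefs
variable (B : Type u) [Ring B]

/-- `X` belongs to `add Q`: it is a direct summand of a finite direct sum of copies of `Q`. -/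
def InAdd (Q X : ModuleCat.{u} B) : Prop :=
  ∃ (n : ℕ) (s : X →ₗ[B] (Fin n → Q)) (r : (Fin n → Q) →ₗ[B] X), r ∘ₗ s = LinearMap.id

/-- A superfluous (small) submodule. -/
def Superfluous {P : ModuleCat.{u} B} (N : Submodule B P) : Prop :=
  ∀ K : Submodule B P, K ⊔ N = ⊤ → K = ⊤

/-- An essential (large) submodule. -/
def Essential {P : ModuleCat.{u} B} (N : Submodule B P) : Prop :=
  ∀ K : Submodule B P, K ⊓ N = ⊥ → K = ⊥

/-- `p : P → X` is a projective cover. -/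
def IsProjCover {P X : ModuleCat.{u} B} (p : P →ₗ[B] X) : Prop :=
  Module.Projective B P ∧ Function.Surjective p ∧ Superfluous B (LinearMap.ker p)

/-- `ι : X → I` is an injective envelope. -/
def IsInjEnvelope {X I : ModuleCat.{u} B} (ι : X →ₗ[B] I) : Prop :=
  Module.Injective B I ∧ Function.Injective ι ∧ Essential B (LinearMap.range ι)

/-- The zero module. -/
def zeroMod : ModuleCat.{u} B := ModuleCat.of B PUnit

/-- An exact sequence `0 → P_m → ⋯ → P_1 → P_0 → X → 0` whose terms satisfy the
predicate `T` and which remains exact under `Hom(test, −)`. -/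
def ResLE (test : ModuleCat.{u} B) (T : ModuleCat.{u} B → Prop)
    (X : ModuleCat.{u} B) (m : ℕ) : Prop :=
  ∃ (P : ℕ → ModuleCat.{u} B) (d : ∀ j, P (j+1) →ₗ[B] P j) (aug : P 0 →ₗ[B] X),
    (∀ j, j ≤ m → T (P j)) ∧ (∀ j, m < j → Subsingleton (P j)) ∧
    Function.Surjective aug ∧ Function.Exact (d 0) aug ∧
    (∀ j, Function.Exact (d (j+1)) (d j)) ∧
    (∀ f : test →ₗ[B] X, ∃ h : test →ₗ[B] P 0, aug ∘ₗ h = f) ∧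
    (∀ f : test →ₗ[B] P 0, aug ∘ₗ f = 0 → ∃ h : test →ₗ[B] P 1, d 0 ∘ₗ h = f) ∧
    (∀ j, ∀ f : test →ₗ[B] P (j+1), d j ∘ₗ f = 0 →
      ∃ h : test →ₗ[B] P (j+2), d (j+1) ∘ₗ h = f)

/-- An exact sequence `0 → X → I_0 → ⋯ → I_m → 0` whose terms satisfy the predicate `T`
and which remains exact under `Hom(−, test)`. -/
def CoresLE (test : ModuleCat.{u} B) (T : ModuleCat.{u} B → Prop)
    (X : ModuleCat.{u} B) (m : ℕ) : Prop :=
  ∃ (M : ℕ → ModuleCat.{u} B) (ι : X →ₗ[B] M 0) (d : ∀ j, M j →ₗ[B] M (j+1)),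
    (∀ j, j ≤ m → T (M j)) ∧ (∀ j, m < j → Subsingleton (M j)) ∧
    Function.Injective ι ∧ Function.Exact ι (d 0) ∧
    (∀ j, Function.Exact (d j) (d (j+1))) ∧
    (∀ f : X →ₗ[B] test, ∃ h : M 0 →ₗ[B] test, h ∘ₗ ι = f) ∧
    (∀ f : M 0 →ₗ[B] test, f ∘ₗ ι = 0 → ∃ h : M 1 →ₗ[B] test, h ∘ₗ d 0 = f) ∧
    (∀ j, ∀ f : M (j+1) →ₗ[B] test, f ∘ₗ d j = 0 →
      ∃ h : M (j+2) →ₗ[B] test, h ∘ₗ d (j+1) = f)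

/-- Projective dimension at most `n`. -/
def pdLE (X : ModuleCat.{u} B) (n : ℕ) : Prop :=
  ResLE B (zeroMod B) (fun P => Module.Projective B P) X n

/-- Injective dimension at most `n`. -/
def idLE (X : ModuleCat.{u} B) (n : ℕ) : Prop :=
  CoresLE B (zeroMod B) (fun I => Module.Injective B I) X n

/-- Projective dimension equal to `n`. -/
def pdEq (X : ModuleCat.{u} B) (n : ℕ) : Prop :=
  pdLE B X n ∧ ∀ j, pdLE B X j → n ≤ j

/-- Injective dimension equal to `n`. -/
def idEq (X : ModuleCat.{u} B) (n : ℕ) : Prop :=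
  idLE B X n ∧ ∀ j, idLE B X j → n ≤ j

/-- Projective dimension as an element of `ℕ∞`. -/
def pdDim (X : ModuleCat.{u} B) : ℕ∞ :=
  sInf {c : ℕ∞ | ∃ n : ℕ, c = n ∧ pdLE B X n}

/-- Injective dimension as an element of `ℕ∞`. -/
def idDim (X : ModuleCat.{u} B) : ℕ∞ :=
  sInf {c : ℕ∞ | ∃ n : ℕ, c = n ∧ idLE B X n}

/-- Relative dominant dimension of `X` with respect to `Q` is at least `n`:
there is an exact sequence `0 → X → Q_1 → ⋯ → Q_n` with `Q_i ∈ add Q`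
remaining exact under `Hom(−, Q)`. -/
def domdimGE (Q X : ModuleCat.{u} B) (n : ℕ) : Prop :=
  n = 0 ∨ ∃ (M : ℕ → ModuleCat.{u} B) (ι : X →ₗ[B] M 0) (d : ∀ j, M j →ₗ[B] M (j+1)),
    (∀ j, j + 1 ≤ n → InAdd B Q (M j)) ∧
    Function.Injective ι ∧ (2 ≤ n → Function.Exact ι (d 0)) ∧
    (∀ j, j + 3 ≤ n → Function.Exact (d j) (d (j+1))) ∧
    (∀ f : X →ₗ[B] Q, ∃ h : M 0 →ₗ[B] Q, h ∘ₗ ι = f) ∧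
    (2 ≤ n → ∀ f : M 0 →ₗ[B] Q, f ∘ₗ ι = 0 → ∃ h : M 1 →ₗ[B] Q, h ∘ₗ d 0 = f) ∧
    (∀ j, j + 3 ≤ n → ∀ f : M (j+1) →ₗ[B] Q, f ∘ₗ d j = 0 →
      ∃ h : M (j+2) →ₗ[B] Q, h ∘ₗ d (j+1) = f)

/-- Relative codominant dimension of `X` with respect to `Q` is at least `n`. -/
def codomdimGE (Q X : ModuleCat.{u} B) (n : ℕ) : Prop :=
  n = 0 ∨ ∃ (M : ℕ → ModuleCat.{u} B) (aug : M 0 →ₗ[B] X) (d : ∀ j, M (j+1) →ₗ[B] M j),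
    (∀ j, j + 1 ≤ n → InAdd B Q (M j)) ∧
    Function.Surjective aug ∧ (2 ≤ n → Function.Exact (d 0) aug) ∧
    (∀ j, j + 3 ≤ n → Function.Exact (d (j+1)) (d j)) ∧
    (∀ f : Q →ₗ[B] X, ∃ h : Q →ₗ[B] M 0, aug ∘ₗ h = f) ∧
    (2 ≤ n → ∀ f : Q →ₗ[B] M 0, aug ∘ₗ f = 0 → ∃ h : Q →ₗ[B] M 1, d 0 ∘ₗ h = f) ∧
    (∀ j, j + 3 ≤ n → ∀ f : Q →ₗ[B] M (j+1), d j ∘ₗ f = 0 →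
      ∃ h : Q →ₗ[B] M (j+2), d (j+1) ∘ₗ h = f)

/-- Relative dominant dimension with respect to `Q`, as an element of `ℕ∞`. -/
def relDomDim (Q X : ModuleCat.{u} B) : ℕ∞ :=
  sSup {c : ℕ∞ | ∃ n : ℕ, c = n ∧ domdimGE B Q X n}

/-- Relative codominant dimension with respect to `Q`, as an element of `ℕ∞`. -/
def relCodomDim (Q X : ModuleCat.{u} B) : ℕ∞ :=
  sSup {c : ℕ∞ | ∃ n : ℕ, c = n ∧ codomdimGE B Q X n}

/-- A projective resolution. -/
structure ProjRes (X : ModuleCat.{u} B) where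
  P : ℕ → ModuleCat.{u} B
  d : ∀ j, P (j+1) →ₗ[B] P j
  aug : P 0 →ₗ[B] X
  proj : ∀ j, Module.Projective B (P j)
  augSurj : Function.Surjective aug
  exact0 : Function.Exact (d 0) aug
  exact : ∀ j, Function.Exact (d (j+1)) (d j)

/-- Vanishing of `Ext^i(X, Y)`, expressed via projective resolutions. -/
def ExtVanish (X Y : ModuleCat.{u} B) : ℕ → Prop
  | 0 => Subsingleton (X →ₗ[B] Y)
  | (i+1) => ∀ R : ProjRes B X, ∀ f : R.P (i+1) →ₗ[B] Y,
      f ∘ₗ R.d (i+1) = 0 → ∃ g : R.P i →ₗ[B] Y, f = g ∘ₗ R.d i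

/-- `Q` is self-orthogonal: `Ext^i(Q, Q) = 0` for all `i > 0`. -/
def SelfOrth (Q : ModuleCat.{u} B) : Prop := ∀ i, 1 ≤ i → ExtVanish B Q Q i

/-- `Z` is a (first, minimal) syzygy of `X`. -/
def IsSyzygyOf (X Z : ModuleCat.{u} B) : Prop :=
  ∃ (P : ModuleCat.{u} B) (p : P →ₗ[B] X), IsProjCover B p ∧
    Nonempty (Z ≃ₗ[B] LinearMap.ker p)

/-- `Z` is an `n`-th syzygy `Ω^n X`. -/
def IsOmegaOf : ℕ → ModuleCat.{u} B → ModuleCat.{u} B → Prop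
  | 0, X, Z => Nonempty (Z ≃ₗ[B] X)
  | (n+1), X, Z => ∃ Y, IsSyzygyOf B X Y ∧ IsOmegaOf n Y Z

/-- `Z` is a (first, minimal) cosyzygy of `X`. -/
def IsCosyzygyOf (X Z : ModuleCat.{u} B) : Prop :=
  ∃ (I : ModuleCat.{u} B) (ι : X →ₗ[B] I), IsInjEnvelope B ι ∧
    Nonempty (Z ≃ₗ[B] (I ⧸ LinearMap.range ι))

/-- `Z` is an `n`-th cosyzygy `Ω^{-n} X`. -/
def IsOmegaInvOf : ℕ → ModuleCat.{u} B → ModuleCat.{u} B → Prop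
  | 0, X, Z => Nonempty (Z ≃ₗ[B] X)
  | (n+1), X, Z => ∃ Y, IsCosyzygyOf B X Y ∧ IsOmegaInvOf n Y Z

/-- Precomposition with `g`, as a map of right `B`-modules `Hom(P₀,B) → Hom(P₁,B)`. -/
def lprecomp {P1 P0 : ModuleCat.{u} B} (g : P1 →ₗ[B] P0) :
    (P0 →ₗ[B] B) →ₗ[Bᵐᵒᵖ] (P1 →ₗ[B] B) where
  toFun h := h ∘ₗ g
  map_add' _ _ := rfl
  map_smul' _ _ := rfl

/-- `T` is a transpose `Tr X` (computed from a minimal projective presentation). -/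
def IsTransposeOf (X : ModuleCat.{u} B) (T : ModuleCat.{u} Bᵐᵒᵖ) : Prop :=
  ∃ (P1 P0 : ModuleCat.{u} B) (g : P1 →ₗ[B] P0) (p : P0 →ₗ[B] X),
    IsProjCover B p ∧ Module.Projective B P1 ∧ Function.Exact g p ∧
    Superfluous B (LinearMap.ker g) ∧
    Nonempty (T ≃ₗ[Bᵐᵒᵖ] ((P1 →ₗ[B] B) ⧸ LinearMap.range (lprecomp B g)))

/-- The canonical ring homomorphism `B →+* Bᵐᵒᵖᵐᵒᵖ`. -/
def opOpHom : B →+* Bᵐᵒᵖᵐᵒᵖ where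
  toFun b := op (op b)
  map_one' := rfl
  map_mul' _ _ := rfl
  map_zero' := rfl
  map_add' _ _ := rfl


/-- An `F_Mo`-projective resolution: terms in `add(B ⊕ Mo)`, exact, and remaining
exact under `Hom(Mo, −)`. -/
structure FProjRes (Mo X : ModuleCat.{u} B) where
  P : ℕ → ModuleCat.{u} B
  d : ∀ j, P (j+1) →ₗ[B] P j
  aug : P 0 →ₗ[B] X
  mem : ∀ j, InAdd B (ModuleCat.of B (B × Mo)) (P j)
  augSurj : Function.Surjective aug
  exact0 : Function.Exact (d 0) aug
  exact : ∀ j, Function.Exact (d (j+1)) (d j)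
  lift0 : ∀ f : Mo →ₗ[B] X, ∃ h : Mo →ₗ[B] P 0, aug ∘ₗ h = f
  lift1 : ∀ f : Mo →ₗ[B] P 0, aug ∘ₗ f = 0 → ∃ h : Mo →ₗ[B] P 1, d 0 ∘ₗ h = f
  lift : ∀ j, ∀ f : Mo →ₗ[B] P (j+1), d j ∘ₗ f = 0 →
    ∃ h : Mo →ₗ[B] P (j+2), d (j+1) ∘ₗ h = f

/-- Vanishing of the relative extension group `Ext^i_{F_Mo}(X, Y)`, computed via
`F_Mo`-projective resolutions. -/
def FExtVanish (Mo X Y : ModuleCat.{u} B) : ℕ → Prop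
  | 0 => True
  | (i+1) => ∀ R : FProjRes B Mo X, ∀ f : R.P (i+1) →ₗ[B] Y,
      f ∘ₗ R.d (i+1) = 0 → ∃ g : R.P i →ₗ[B] Y, f = g ∘ₗ R.d i

end RingDefs

section Duality
variable (k : Type u) [Field k] (B : Type u) [Ring B] [Algebra k B]

noncomputable instance kmod (X : ModuleCat.{u} B) : Module k X :=
  Module.compHom X (algebraMap k B)

instance kmodSMulComm (X : ModuleCat.{u} B) : SMulCommClass B k X :=
  ⟨fun b c x => by
    show b • ((algebraMap k B c) • x) = (algebraMap k B c) • (b • x)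
    rw [← mul_smul, ← mul_smul, Algebra.commutes]⟩

instance kmodTower (X : ModuleCat.{u} B) : IsScalarTower k B X :=
  ⟨fun c b x => by
    show (c • b) • x = (algebraMap k B c) • (b • x)
    rw [Algebra.smul_def, mul_smul]⟩

noncomputable instance dualModL (X : ModuleCat.{u} B) : Module Bᵐᵒᵖ (X →ₗ[k] k) where
  smul b φ := φ ∘ₗ (DistribMulAction.toLinearMap k X b.unop)
  one_smul φ := by
    ext x
    show φ ((1 : Bᵐᵒᵖ).unop • x) = φ x
    rw [unop_one, one_smul]
  mul_smul b c φ := by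
    ext x
    show φ ((b * c).unop • x) = φ (c.unop • b.unop • x)
    rw [unop_mul, mul_smul]
  smul_zero b := rfl
  smul_add b φ ψ := rfl
  add_smul b c φ := by
    ext x
    show φ ((b + c).unop • x) = φ (b.unop • x) + φ (c.unop • x)
    rw [unop_add, add_smul, map_add]
  zero_smul φ := by
    ext x
    show φ ((0 : Bᵐᵒᵖ).unop • x) = 0
    rw [unop_zero, zero_smul, map_zero]

/-- The standard duality `D = Hom_k(−, k)`, sending a left `B`-module to a right
`B`-module. -/
def Dop (X : ModuleCat.{u} B) : ModuleCat.{u} Bᵐᵒᵖ :=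
  ModuleCat.of Bᵐᵒᵖ (X →ₗ[k] k)

noncomputable instance dualModR (Y : ModuleCat.{u} Bᵐᵒᵖ) : Module B (Y →ₗ[k] k) where
  smul b φ := φ ∘ₗ (DistribMulAction.toLinearMap k Y (op b))
  one_smul φ := by
    ext x
    show φ ((op (1:B)) • x) = φ x
    rw [op_one, one_smul]
  mul_smul b c φ := by
    ext x
    show φ ((op (b * c)) • x) = φ ((op c) • (op b) • x)
    rw [op_mul, mul_smul]
  smul_zero b := rfl
  smul_add b φ ψ := rfl
  add_smul b c φ := by
    ext x
    show φ ((op (b + c)) • x) = φ ((op b) • x) + φ ((op c) • x)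
    rw [op_add, add_smul, map_add]
  zero_smul φ := by
    ext x
    show φ ((op (0 : B)) • x) = 0
    rw [op_zero, zero_smul, map_zero]

/-- The standard duality `D = Hom_k(−, k)`, sending a right `B`-module to a left
`B`-module. -/
def Dunop (Y : ModuleCat.{u} Bᵐᵒᵖ) : ModuleCat.{u} B :=
  ModuleCat.of B (Y →ₗ[k] k)

/-- `D(B_B)`, the standard injective cogenerator of `B`-Mod. -/
def Dcogen : ModuleCat.{u} B := Dunop k B (ModuleCat.of Bᵐᵒᵖ B)

/-- `T ≅ τ X = D Tr X`, the Auslander–Reiten translate. -/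
def IsTauOf (X T : ModuleCat.{u} B) : Prop :=
  ∃ Tr : ModuleCat.{u} Bᵐᵒᵖ, IsTransposeOf B X Tr ∧ Nonempty (T ≃ₗ[B] Dunop k B Tr)

/-- `T ≅ τ_n X = τ Ω^{n-1} X`. -/
def IsTauN (n : ℕ) (X T : ModuleCat.{u} B) : Prop :=
  ∃ Z, IsOmegaOf B (n-1) X Z ∧ IsTauOf k B Z T

/-- `T ≅ τ⁻ X = Tr D X`, the inverse Auslander–Reiten translate. -/
def IsTauInvOf (X T : ModuleCat.{u} B) : Prop :=
  ∃ Tr2 : ModuleCat.{u} Bᵐᵒᵖᵐᵒᵖ, IsTransposeOf Bᵐᵒᵖ (Dop k B X) Tr2 ∧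
    Nonempty (T ≃ₗ[B] ((ModuleCat.restrictScalars (opOpHom B)).obj Tr2))

/-- `T ≅ τ⁻_n X = τ⁻ Ω^{-(n-1)} X`. -/
def IsTauInvN (n : ℕ) (X T : ModuleCat.{u} B) : Prop :=
  ∃ Z, IsOmegaInvOf B (n-1) X Z ∧ IsTauInvOf k B Z T

/-- The Nakayama functor `ν = D Hom_B(−, B)` (on objects). -/
def nu (X : ModuleCat.{u} B) : ModuleCat.{u} B :=
  Dunop k B (ModuleCat.of Bᵐᵒᵖ (X →ₗ[B] B))

/-- The inverse Nakayama functor `ν⁻ = Hom_B(D(−), B)` (on objects). -/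
def nuInv (X : ModuleCat.{u} B) : ModuleCat.{u} B :=
  (ModuleCat.restrictScalars (opOpHom B)).obj
    (ModuleCat.of Bᵐᵒᵖᵐᵒᵖ ((Dop k B X) →ₗ[Bᵐᵒᵖ] Bᵐᵒᵖ))

/-- Relative `add Q`-dimension of `X` is at most `m`. -/
def RelAddDimLE (Q X : ModuleCat.{u} B) (m : ℕ) : Prop :=
  ResLE B Q (InAdd B Q) X m

/-- Relative `add Q`-codimension of `X` is at most `m`. -/
def RelAddCodimLE (Q X : ModuleCat.{u} B) (m : ℕ) : Prop :=
  CoresLE B Q (InAdd B Q) X m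

/-- `Q` is an `l`-quasi-generator (without minimality of `l`). -/
def QuasiGenLE (Q : ModuleCat.{u} B) (l : ℕ) : Prop :=
  CoresLE B Q (InAdd B Q) (ModuleCat.of B B) l

/-- `Q` is an `l`-quasi-generator: `l` is minimal. -/
def IsQuasiGen (Q : ModuleCat.{u} B) (l : ℕ) : Prop :=
  QuasiGenLE B Q l ∧ ∀ j, QuasiGenLE B Q j → l ≤ j

/-- `Q` is an `m`-quasi-cogenerator (without minimality of `m`). -/
def QuasiCogenLE (Q : ModuleCat.{u} B) (m : ℕ) : Prop :=
  ResLE B Q (InAdd B Q) (Dcogen k B) m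

/-- `Q` is an `m`-quasi-cogenerator: `m` is minimal. -/
def IsQuasiCogen (Q : ModuleCat.{u} B) (m : ℕ) : Prop :=
  QuasiCogenLE k B Q m ∧ ∀ j, QuasiCogenLE k B Q j → m ≤ j

/-- `(B, Q)` is a relative `n`-Auslander–Gorenstein pair. -/
def IsRelAGPair (Q : ModuleCat.{u} B) (n : ℕ) : Prop :=
  idLE B (ModuleCat.of B B) n ∧ idLE Bᵐᵒᵖ (ModuleCat.of Bᵐᵒᵖ Bᵐᵒᵖ) n ∧
  SelfOrth B Q ∧ domdimGE B Q (ModuleCat.of B B) n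

/-- `Q` is an `(n, m, l)`-quasi-precluster tilting module. -/
def IsQPCT (Q : ModuleCat.{u} B) (n m l : ℕ) : Prop :=
  (∀ i, 1 ≤ i → i ≤ n - 2 → ExtVanish B Q Q i) ∧
  IsQuasiGen B Q l ∧
  IsQuasiCogen k B Q m ∧
  (∃ T, IsTauN k B (n - m - 1) Q T ∧ RelAddDimLE B Q T m) ∧
  (∃ T, IsTauInvN k B (n - l - 1) Q T ∧ RelAddCodimLE B Q T l)

/-- Precomposition with `g`, as a `k`-linear map between Hom spaces. -/
def pcompk {X Y Z : ModuleCat.{u} B} (g : X →ₗ[B] Y) :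
    (Y →ₗ[B] Z) →ₗ[k] (X →ₗ[B] Z) where
  toFun h := h ∘ₗ g
  map_add' _ _ := rfl
  map_smul' _ _ := rfl


/-- `I` is an injective object for the exact structure `F_Mo`: it lies in
`add(DB ⊕ τ Mo)`. -/
def IsFInj (Mo I : ModuleCat.{u} B) : Prop :=
  ∃ T, IsTauOf k B Mo T ∧ InAdd B (ModuleCat.of B ((Dcogen k B) × T)) I

/-- `T` is an `F_Mo`-cotilting object: finite relative injective dimension, no relative
self-extensions, and the relative injectives `DB ⊕ τ Mo` admit a finite `F_Mo`-exact
resolution by objects of `add T`. -/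
def FCotilting (Mo T : ModuleCat.{u} B) : Prop :=
  (∃ r, CoresLE B Mo (IsFInj k B Mo) T r) ∧
  (∀ i, 1 ≤ i → FExtVanish B Mo T T i) ∧
  (∃ τM, IsTauOf k B Mo τM ∧
    ∃ r, ResLE B Mo (InAdd B T) (ModuleCat.of B ((Dcogen k B) × τM)) r)

end Duality

section EndStuff
variable (A : Type u) [Ring A] (Q : ModuleCat.{u} A)

/-- The canonical ring homomorphism `A → End_{End_A(Q)}(Q)`. -/
def toEndE : A →+* Module.End (Module.End A Q) Q where
  toFun a :=
    { toFun := fun q => a • q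
      map_add' := fun x y => smul_add a x y
      map_smul' := fun e q => (e.map_smul a q).symm }
  map_one' := by ext q; exact one_smul A q
  map_mul' x y := by ext q; exact mul_smul x y q
  map_zero' := by ext q; exact zero_smul A q
  map_add' x y := by ext q; exact add_smul x y q

/-- `Hom_A(Q, X)` as a left module over `End_A(Q)ᵐᵒᵖ` (i.e. a left `Λ`-module) by
precomposition. -/
noncomputable instance homPrecompMod (X : ModuleCat.{u} A) :
    Module (Module.End A Q)ᵐᵒᵖ (Q →ₗ[A] X) where
  smul e f := f ∘ₗ e.unop
  one_smul f := by ext q; rfl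
  mul_smul e e' f := by ext q; rfl
  smul_zero e := rfl
  smul_add e f g := rfl
  add_smul e e' f := by ext q; exact map_add f _ _
  zero_smul f := by ext q; exact map_zero f

/-- The actions of `A` and of `End_A(Q)` on `Q` commute. -/
instance endSMulComm : SMulCommClass (Module.End A Q) A Q :=
  ⟨fun e a q => e.map_smul a q⟩

instance endSMulComm' : SMulCommClass A (Module.End A Q) Q :=
  ⟨fun a e q => (e.map_smul a q).symm⟩

end EndStuff

end Paper
end

open MulOpposite
noncomputable section
namespace QP
open CategoryTheory Abelian

section ext
variable (A : Type) [Ring A]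

/-- Vanishing of Mathlib's Ext. -/
def EV (X Y : Type) [AddCommGroup X] [Module A X] [AddCommGroup Y] [Module A Y] (i : ℕ) : Prop :=
  Subsingleton (Ext (ModuleCat.of A X) (ModuleCat.of A Y) i)

/-- unbundled version of `InAdd`. -/
def Add (Q X : Type) [AddCommGroup Q] [Module A Q] [AddCommGroup X] [Module A X] : Prop :=
  ∃ (n : ℕ) (s : X →ₗ[A] (Fin n → Q)) (r : (Fin n → Q) →ₗ[A] X), r ∘ₗ s = LinearMap.id

variable {A}
variable {X Y K P Z : Type} [AddCommGroup X] [Module A X] [AddCommGroup Y] [Module A Y]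
  [AddCommGroup K] [Module A K] [AddCommGroup P] [Module A P] [AddCommGroup Z] [Module A Z]

lemma sesExact {f : K →ₗ[A] P} {g : P →ₗ[A] X} (hf : Function.Injective f)
    (hg : Function.Surjective g) (h : Function.Exact f g) :
    (ShortComplex.mk (ModuleCat.ofHom f) (ModuleCat.ofHom g)
      (by ext x; exact h.apply_apply_eq_zero x)).ShortExact := by
  have : Mono (ModuleCat.ofHom f) := (ModuleCat.mono_iff_injective _).2 hf
  have : Epi (ModuleCat.ofHom g) := (ModuleCat.epi_iff_surjective _).2 hg
  refine ShortComplex.ShortExact.mk' ?_ ‹_› this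
  rw [ShortComplex.moduleCat_exact_iff]
  intro x hx
  exact (h x).1 hx

section contra
variable {f : K →ₗ[A] P} {g : P →ₗ[A] X} (hf : Function.Injective f)
    (hg : Function.Surjective g) (h : Function.Exact f g)
include hf hg h

lemma EV.up {i : ℕ} (h1 : EV A P Y (i+1)) (h2 : EV A K Y i) : EV A X Y (i+1) := by
  refine ⟨fun a b => ?_⟩
  rw [← sub_eq_zero]
  obtain ⟨x, hx⟩ := Ext.contravariant_sequence_exact₃ (sesExact hf hg h) _ (a - b)
    (h1.elim _ _) (n₀ := i) (add_comm _ _)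
  rw [← hx, h2.elim x 0]; simp

lemma EV.down {i : ℕ} (h1 : EV A P Y i) (h2 : EV A X Y (i+1)) : EV A K Y i := by
  refine ⟨fun a b => ?_⟩
  rw [← sub_eq_zero]
  obtain ⟨x, hx⟩ := Ext.contravariant_sequence_exact₁ (sesExact hf hg h) _ (a - b)
    (add_comm _ _) (h2.elim _ _)
  rw [← hx, h1.elim x 0]; simp

lemma EV.one_of_extend (h1 : EV A P Y 1) (h2 : ∀ u : K →ₗ[A] Y, ∃ v : P →ₗ[A] Y, v ∘ₗ f = u) :
    EV A X Y 1 := by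
  refine ⟨fun a b => ?_⟩
  rw [← sub_eq_zero]
  obtain ⟨x, hx⟩ := Ext.contravariant_sequence_exact₃ (sesExact hf hg h) _ (a - b)
    (h1.elim _ _) (n₀ := 0) (add_comm _ _)
  obtain ⟨u, rfl⟩ := (Ext.mk₀_bijective _ _).2 x
  obtain ⟨v, hv⟩ := h2 u.hom
  have : u = ModuleCat.ofHom f ≫ ModuleCat.ofHom v := by
    ext x; exact (LinearMap.congr_fun hv x).symm
  rw [← hx, this, ← Ext.mk₀_comp_mk₀, (sesExact hf hg h).extClass_comp_assoc]

lemma EV.extend (h1 : EV A X Y 1) (u : K →ₗ[A] Y) : ∃ v : P →ₗ[A] Y, v ∘ₗ f = u := by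
  obtain ⟨x, hx⟩ := Ext.contravariant_sequence_exact₁ (sesExact hf hg h) (ModuleCat.of A Y)
    (Ext.mk₀ (ModuleCat.ofHom u)) (add_comm _ _) (h1.elim _ _)
  obtain ⟨v, rfl⟩ := (Ext.mk₀_bijective _ _).2 x
  dsimp at hx
  erw [Ext.mk₀_comp_mk₀] at hx
  have := (Ext.mk₀_bijective _ _).1 hx
  refine ⟨v.hom, ?_⟩
  ext x
  exact congrArg (fun t => t.hom x) this

end contra

section co
variable {f : K →ₗ[A] P} {g : P →ₗ[A] X} (hf : Function.Injective f)
    (hg : Function.Surjective g) (h : Function.Exact f g)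
include hf hg h

lemma EV.coup {i : ℕ} (h1 : EV A Y P (i+1)) (h2 : EV A Y X i) : EV A Y K (i+1) := by
  refine ⟨fun a b => ?_⟩
  rw [← sub_eq_zero]
  obtain ⟨x, hx⟩ := Ext.covariant_sequence_exact₁ _ (sesExact hf hg h) (a - b)
    (h1.elim _ _) (n₀ := i) rfl
  rw [← hx, h2.elim x 0]; simp

lemma EV.codown {i : ℕ} (h1 : EV A Y P i) (h2 : EV A Y K (i+1)) : EV A Y X i := by
  refine ⟨fun a b => ?_⟩
  rw [← sub_eq_zero]
  obtain ⟨x, hx⟩ := Ext.covariant_sequence_exact₃ _ (sesExact hf hg h) (a - b)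
    rfl (h2.elim _ _)
  rw [← hx, h1.elim x 0]; simp

lemma EV.one_of_lift (h1 : EV A Y P 1) (h2 : ∀ u : Y →ₗ[A] X, ∃ v : Y →ₗ[A] P, g ∘ₗ v = u) :
    EV A Y K 1 := by
  refine ⟨fun a b => ?_⟩
  rw [← sub_eq_zero]
  obtain ⟨x, hx⟩ := Ext.covariant_sequence_exact₁ _ (sesExact hf hg h) (a - b)
    (h1.elim _ _) (n₀ := 0) rfl
  obtain ⟨u, rfl⟩ := (Ext.mk₀_bijective _ _).2 x
  obtain ⟨v, hv⟩ := h2 u.hom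
  have : u = ModuleCat.ofHom v ≫ ModuleCat.ofHom g := by
    ext x; exact (LinearMap.congr_fun hv x).symm
  rw [← hx, this, ← Ext.mk₀_comp_mk₀]
  rw [Ext.comp_assoc_of_second_deg_zero]
  have := (sesExact hf hg h).comp_extClass
  dsimp at this
  rw [this]; simp

lemma EV.lift (h1 : EV A Y K 1) (u : Y →ₗ[A] X) : ∃ v : Y →ₗ[A] P, g ∘ₗ v = u := by
  obtain ⟨x, hx⟩ := Ext.covariant_sequence_exact₃ (ModuleCat.of A Y) (sesExact hf hg h) 
    (Ext.mk₀ (ModuleCat.ofHom u)) rfl (h1.elim _ _)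
  obtain ⟨v, rfl⟩ := (Ext.mk₀_bijective _ _).2 x
  dsimp at hx
  erw [Ext.mk₀_comp_mk₀] at hx
  have := (Ext.mk₀_bijective _ _).1 hx
  refine ⟨v.hom, ?_⟩
  ext x
  exact congrArg (fun t => t.hom x) this

end co

lemma EV.of_proj [Module.Projective A X] (i : ℕ) : EV A X Y (i+1) := by
  have := (IsProjective.iff_projective (R := A) X).1 inferInstance
  exact Ext.subsingleton_of_projective _ _ i

lemma EV.of_inj [Module.Injective A Y] (i : ℕ) : EV A X Y (i+1) := by
  have : Injective (ModuleCat.of A Y) := Module.injective_object_of_injective_module A Y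
  exact Ext.subsingleton_of_injective _ _ i

lemma EV.retract {i : ℕ} {s : X →ₗ[A] Z} {r : Z →ₗ[A] X} (h : r ∘ₗ s = LinearMap.id)
    (hZ : EV A Z Y i) : EV A X Y i := by
  refine ⟨fun a b => ?_⟩
  have key : ∀ a : Ext (ModuleCat.of A X) (ModuleCat.of A Y) i,
      a = (Ext.mk₀ (ModuleCat.ofHom s)).comp ((Ext.mk₀ (ModuleCat.ofHom r)).comp a (zero_add _))
        (zero_add _) := by
    intro a
    rw [Ext.mk₀_comp_mk₀_assoc, ← ModuleCat.ofHom_comp, h]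
    exact (Ext.mk₀_id_comp a).symm
  rw [key a, key b, hZ.elim ((Ext.mk₀ (ModuleCat.ofHom r)).comp a (zero_add _)) ((Ext.mk₀ (ModuleCat.ofHom r)).comp b (zero_add _))]

lemma EV.coretract {i : ℕ} {s : X →ₗ[A] Z} {r : Z →ₗ[A] X} (h : r ∘ₗ s = LinearMap.id)
    (hZ : EV A Y Z i) : EV A Y X i := by
  refine ⟨fun a b => ?_⟩
  have key : ∀ a : Ext (ModuleCat.of A Y) (ModuleCat.of A X) i,
      a = (a.comp (Ext.mk₀ (ModuleCat.ofHom s)) (add_zero _)).comp (Ext.mk₀ (ModuleCat.ofHom r)) 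
        (add_zero _) := by
    intro a
    rw [Ext.comp_assoc_of_second_deg_zero, Ext.mk₀_comp_mk₀, ← ModuleCat.ofHom_comp, h]
    exact (Ext.comp_mk₀_id a).symm
  rw [key a, key b, hZ.elim (a.comp (Ext.mk₀ (ModuleCat.ofHom s)) (add_zero _)) (b.comp (Ext.mk₀ (ModuleCat.ofHom s)) (add_zero _))]

lemma EV.equiv {i : ℕ} (e : X ≃ₗ[A] Z) (hZ : EV A Z Y i) : EV A X Y i :=
  hZ.retract (s := e.toLinearMap) (r := e.symm.toLinearMap) (by ext; simp)

lemma EV.coequiv {i : ℕ} (e : X ≃ₗ[A] Z) (hZ : EV A Y Z i) : EV A Y X i :=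
  hZ.coretract (s := e.toLinearMap) (r := e.symm.toLinearMap) (by ext; simp)

lemma EV.pi {i : ℕ} (h : EV A Z Y i) (n : ℕ) : EV A (Fin n → Z) Y i := by
  refine ⟨fun a b => ?_⟩
  let t : Fin n → (ModuleCat.of A (Fin n → Z) ⟶ ModuleCat.of A (Fin n → Z)) := fun j =>
    ModuleCat.ofHom (LinearMap.proj j) ≫ ModuleCat.ofHom (LinearMap.single A (fun _ => Z) j)
  have ht : ∑ j, t j = 𝟙 _ := by
    ext x
    rw [ModuleCat.hom_sum]
    simp [t]
  have key : ∀ a : Ext (ModuleCat.of A (Fin n → Z)) (ModuleCat.of A Y) i, a = 0 := by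
    intro a
    rw [← Ext.mk₀_id_comp a, ← ht, Ext.mk₀_sum, Ext.sum_comp]
    refine Finset.sum_eq_zero fun j _ => ?_
    rw [← Ext.mk₀_comp_mk₀_assoc]
    rw [h.elim ((Ext.mk₀ (ModuleCat.ofHom (LinearMap.single A (fun _ => Z) j))).comp a (zero_add _)) 0]
    simp
  rw [key a, key b]

lemma EV.add {i : ℕ} (h : EV A Z Y i) (hX : Add A Z X) : EV A X Y i := by
  obtain ⟨n, s, r, hrs⟩ := hX
  exact (h.pi n).retract hrs

end ext
end QP
end

noncomputable section
namespace QP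
open CategoryTheory Abelian Paper

section res
variable {A : Type} [Ring A]

lemma resLE_zero_iff (test : ModuleCat.{0} A) (T : ModuleCat.{0} A → Prop) (X : ModuleCat.{0} A) :
    ResLE A test T X 0 ↔ ∃ P : ModuleCat.{0} A, T P ∧ Nonempty (P ≃ₗ[A] X) := by
  constructor
  · rintro ⟨P, d, aug, h1, h2, h3, h4, h5, h6, h7, h8⟩
    refine ⟨P 0, h1 0 le_rfl, ⟨LinearEquiv.ofBijective aug ⟨?_, h3⟩⟩⟩
    rw [injective_iff_map_eq_zero]
    intro x hx
    obtain ⟨y, rfl⟩ := (h4 x).1 hx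
    have := h2 1 (by omega)
    rw [Subsingleton.elim y 0, map_zero]
  · rintro ⟨P, hP, ⟨e⟩⟩
    have hs : ∀ (j : ℕ) (x : (match j with | 0 => P | _ + 1 => ModuleCat.of A PUnit : ModuleCat.{0} A)),
      0 < j → x = 0 := by
      intro j x hj
      match j with
      | j+1 => exact Subsingleton.elim (α := PUnit) _ _
    refine ⟨fun j => match j with | 0 => P | _ + 1 => ModuleCat.of A PUnit, fun j => 0, e.toLinearMap,
      ?_, ?_, e.surjective, ?_, ?_, ?_, ?_, ?_⟩
    · intro j hj
      obtain rfl : j = 0 := by omega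
      exact hP
    · intro j hj
      exact ⟨fun a b => (hs j a hj).trans (hs j b hj).symm⟩
    · intro x
      constructor
      · intro hx
        exact ⟨0, ((LinearEquiv.map_eq_zero_iff e).1 hx).symm⟩
      · rintro ⟨y, rfl⟩
        exact map_zero _
    · intro j x
      exact ⟨fun _ => ⟨0, (hs (j+1) x (Nat.succ_pos j)).symm⟩, fun _ => rfl⟩
    · intro f
      exact ⟨e.symm.toLinearMap ∘ₗ f, by ext; simp⟩
    · intro f hf
      refine ⟨0, ?_⟩
      ext x
      exact ((LinearEquiv.map_eq_zero_iff e).1 (LinearMap.congr_fun hf x)).symm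
    · intro j f hf
      refine ⟨0, ?_⟩
      ext x

lemma resLE_succ_iff (test : ModuleCat.{0} A) (T : ModuleCat.{0} A → Prop) (X : ModuleCat.{0} A) (n : ℕ) :
    ResLE A test T X (n+1) ↔ ∃ (K P : ModuleCat.{0} A) (f : K →ₗ[A] P) (p : P →ₗ[A] X), T P ∧
      Function.Injective f ∧ Function.Surjective p ∧ Function.Exact f p ∧
      (∀ u : test →ₗ[A] X, ∃ h : test →ₗ[A] P, p ∘ₗ h = u) ∧ ResLE A test T K n := by
  constructor
  · rintro ⟨P, d, aug, h1, h2, h3, h4, h5, h6, h7, h8⟩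
    have hd0 : ∀ x, d 0 x ∈ LinearMap.ker aug := fun x => h4.apply_apply_eq_zero x
    refine ⟨ModuleCat.of A (LinearMap.ker aug), P 0, (LinearMap.ker aug).subtype, aug, h1 0 (by omega),
      Subtype.val_injective, h3, fun x => by simp, h6, ?_⟩
    refine ⟨fun j => P (j+1), fun j => d (j+1), (d 0).codRestrict _ hd0, fun j hj => h1 _ (by omega),
      fun j hj => h2 _ (by omega), ?_, ?_, fun j => h5 _, ?_, ?_, fun j => h8 _⟩
    · rintro ⟨x, hx⟩
      obtain ⟨y, rfl⟩ := (h4 x).1 hx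
      exact ⟨y, rfl⟩
    · intro x
      rw [← h5 0 x]
      exact ⟨fun h => congrArg Subtype.val h, fun h => Subtype.ext h⟩
    · intro f
      obtain ⟨h, hh⟩ := h7 ((LinearMap.ker aug).subtype ∘ₗ f) (by ext x; exact (f x).2)
      refine ⟨h, ?_⟩
      ext x
      exact LinearMap.congr_fun hh x
    · intro f hf
      refine h8 0 f ?_
      ext x
      exact congrArg Subtype.val (LinearMap.congr_fun hf x)
  · rintro ⟨K, P0, f, p, hT, hf, hp, hfp, hl, P, d, aug, h1, h2, h3, h4, h5, h6, h7, h8⟩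
    let P' : ℕ → ModuleCat.{0} A := fun j => match j with | 0 => P0 | j + 1 => P j
    let d' : ∀ j, P' (j+1) →ₗ[A] P' j := fun j => match j with | 0 => f ∘ₗ aug | j + 1 => d j
    refine ⟨P', d', p, ?_, ?_, hp, ?_, ?_, hl, ?_, ?_⟩
    · intro j hj
      match j with
      | 0 => exact hT
      | j+1 => exact h1 j (by omega)
    · intro j hj
      match j with
      | j+1 => exact h2 j (by omega)
    · intro x
      rw [hfp x]
      constructor
      · rintro ⟨y, rfl⟩
        obtain ⟨z, rfl⟩ := h3 y
        exact ⟨z, rfl⟩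
      · rintro ⟨z, rfl⟩
        exact ⟨aug z, rfl⟩
    · intro j
      match j with
      | 0 =>
        intro x
        refine Iff.trans ?_ (h4 x)
        exact map_eq_zero_iff f hf
      | j+1 => exact h5 j
    · intro u hu
      have : ∀ x, ∃ y, f y = u x := fun x => (hfp _).1 (LinearMap.congr_fun hu x)
      let e := LinearEquiv.ofInjective f hf
      let v : test →ₗ[A] K := e.symm.toLinearMap ∘ₗ u.codRestrict (LinearMap.range f) this
      have hv : ∀ x, f (v x) = u x := fun x => by
        have := e.apply_symm_apply (u.codRestrict (LinearMap.range f) this x)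
        exact congrArg Subtype.val this
      obtain ⟨h, hh⟩ := h6 v
      refine ⟨h, ?_⟩
      ext x
      exact (congrArg f (LinearMap.congr_fun hh x)).trans (hv x)
    · intro j u hu
      match j with
      | 0 =>
        refine h7 u ?_
        ext x
        exact hf ((LinearMap.congr_fun hu x).trans (map_zero f).symm)
      | j+1 => exact h8 j u hu

lemma coresLE_zero_iff (test : ModuleCat.{0} A) (T : ModuleCat.{0} A → Prop) (X : ModuleCat.{0} A) :
    CoresLE A test T X 0 ↔ ∃ P : ModuleCat.{0} A, T P ∧ Nonempty (X ≃ₗ[A] P) := by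
  constructor
  · rintro ⟨P, aug, d, h1, h2, h3, h4, h5, h6, h7, h8⟩
    refine ⟨P 0, h1 0 le_rfl, ⟨LinearEquiv.ofBijective aug ⟨h3, ?_⟩⟩⟩
    intro x
    have := h2 1 (by omega)
    exact (h4 x).1 (Subsingleton.elim _ _)
  · rintro ⟨P, hP, ⟨e⟩⟩
    have hs : ∀ (j : ℕ) (x : (match j with | 0 => P | _ + 1 => ModuleCat.of A PUnit : ModuleCat.{0} A)),
      0 < j → x = 0 := by
      intro j x hj
      match j with
      | j+1 => exact Subsingleton.elim (α := PUnit) _ _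
    refine ⟨fun j => match j with | 0 => P | _ + 1 => ModuleCat.of A PUnit, e.toLinearMap, fun j => 0,
      ?_, ?_, e.injective, ?_, ?_, ?_, ?_, ?_⟩
    · intro j hj
      obtain rfl : j = 0 := by omega
      exact hP
    · intro j hj
      exact ⟨fun a b => (hs j a hj).trans (hs j b hj).symm⟩
    · intro x
      exact ⟨fun hx => e.surjective x, fun _ => rfl⟩
    · intro j x
      exact ⟨fun _ => ⟨0, (hs (j+1) x (Nat.succ_pos j)).symm⟩, fun _ => rfl⟩
    · intro f
      exact ⟨f ∘ₗ e.symm.toLinearMap, by ext; simp⟩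
    · intro f hf
      refine ⟨0, ?_⟩
      ext x
      obtain ⟨y, rfl⟩ := e.surjective x
      exact (LinearMap.congr_fun hf y).symm
    · intro j f hf
      refine ⟨0, ?_⟩
      ext x
      exact ((congrArg f (hs (j+1) x (Nat.succ_pos j))).trans (map_zero f)).symm

lemma coresLE_succ_iff (test : ModuleCat.{0} A) (T : ModuleCat.{0} A → Prop) (X : ModuleCat.{0} A) (n : ℕ) :
    CoresLE A test T X (n+1) ↔ ∃ (K P : ModuleCat.{0} A) (f : X →ₗ[A] P) (p : P →ₗ[A] K), T P ∧
      Function.Injective f ∧ Function.Surjective p ∧ Function.Exact f p ∧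
      (∀ u : X →ₗ[A] test, ∃ h : P →ₗ[A] test, h ∘ₗ f = u) ∧ CoresLE A test T K n := by
  constructor
  · rintro ⟨P, aug, d, h1, h2, h3, h4, h5, h6, h7, h8⟩
    have hd0 : LinearMap.range aug ≤ LinearMap.ker (d 0) := by
      rintro _ ⟨x, rfl⟩
      exact h4.apply_apply_eq_zero x
    refine ⟨ModuleCat.of A (P 0 ⧸ LinearMap.range aug), P 0, aug, (LinearMap.range aug).mkQ, h1 0 (by omega),
      h3, Submodule.mkQ_surjective _, fun x => by simp, h6, ?_⟩
    refine ⟨fun j => P (j+1), (LinearMap.range aug).liftQ (d 0) hd0, fun j => d (j+1), fun j hj => h1 _ (by omega),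
      fun j hj => h2 _ (by omega), ?_, ?_, fun j => h5 _, ?_, ?_, fun j => h8 _⟩
    · rw [injective_iff_map_eq_zero]
      intro x hx
      obtain ⟨y, rfl⟩ := Submodule.mkQ_surjective _ x
      rw [Submodule.mkQ_apply, Submodule.Quotient.mk_eq_zero]
      exact (h4 y).1 hx
    · intro x
      rw [h5 0 x]
      constructor
      · rintro ⟨y, rfl⟩
        exact ⟨Submodule.Quotient.mk y, rfl⟩
      · rintro ⟨y, rfl⟩
        obtain ⟨y, rfl⟩ := Submodule.mkQ_surjective _ y
        exact ⟨y, rfl⟩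
    · intro f
      obtain ⟨h, hh⟩ := h7 (f ∘ₗ (LinearMap.range aug).mkQ) (by
        ext x
        have : (LinearMap.range aug).mkQ (aug x) = 0 := by simp
        exact (congrArg f this).trans (map_zero f))
      refine ⟨h, ?_⟩
      ext x
      exact LinearMap.congr_fun hh x
    · intro f hf
      refine h8 0 f ?_
      ext x
      exact LinearMap.congr_fun hf (Submodule.Quotient.mk x)
  · rintro ⟨K, P0, f, p, hT, hf, hp, hfp, hl, P, aug, d, h1, h2, h3, h4, h5, h6, h7, h8⟩
    let P' : ℕ → ModuleCat.{0} A := fun j => match j with | 0 => P0 | j + 1 => P j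
    let d' : ∀ j, P' j →ₗ[A] P' (j+1) := fun j => match j with | 0 => aug ∘ₗ p | j + 1 => d j
    refine ⟨P', f, d', ?_, ?_, hf, ?_, ?_, hl, ?_, ?_⟩
    · intro j hj
      match j with
      | 0 => exact hT
      | j+1 => exact h1 j (by omega)
    · intro j hj
      match j with
      | j+1 => exact h2 j (by omega)
    · intro x
      rw [← hfp x]
      exact map_eq_zero_iff aug h3
    · intro j
      match j with
      | 0 =>
        intro x
        refine (h4 x).trans ?_
        constructor
        · rintro ⟨y, rfl⟩
          obtain ⟨z, rfl⟩ := hp y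
          exact ⟨z, rfl⟩
        · rintro ⟨z, rfl⟩
          exact ⟨p z, rfl⟩
      | j+1 => exact h5 j
    · intro u hu
      have hk : LinearMap.ker p ≤ LinearMap.ker u := by
        intro x hx
        obtain ⟨y, rfl⟩ := (hfp x).1 hx
        exact LinearMap.congr_fun hu y
      let v : K →ₗ[A] test := (LinearMap.ker p).liftQ u hk ∘ₗ (p.quotKerEquivOfSurjective hp).symm.toLinearMap
      have hv : ∀ x, v (p x) = u x := fun x => by
        have : (p.quotKerEquivOfSurjective hp).symm (p x) = Submodule.Quotient.mk x := by
          rw [LinearEquiv.symm_apply_eq]; rfl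
        show (LinearMap.ker p).liftQ u hk ((p.quotKerEquivOfSurjective hp).symm (p x)) = _
        rw [this]; rfl
      obtain ⟨h, hh⟩ := h6 v
      refine ⟨h, ?_⟩
      ext x
      exact (LinearMap.congr_fun hh (p x)).trans (hv x)
    · intro j u hu
      match j with
      | 0 =>
        refine h7 u ?_
        ext x
        obtain ⟨y, rfl⟩ := hp x
        exact LinearMap.congr_fun hu y
      | j+1 => exact h8 j u hu

end res
end QP
end

noncomputable section
namespace QP
open CategoryTheory Abelian Paper

section pd
variable {A : Type} [Ring A]

/-- Computing Ext-vanishing from an acyclic (partial) resolution. -/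
lemma ext_iff {Y : Type} [AddCommGroup Y] [Module A Y] (i : ℕ) :
    ∀ (X : Type) [AddCommGroup X] [Module A X] (P : ℕ → ModuleCat.{0} A)
      (d : ∀ j, P (j+1) →ₗ[A] P j) (aug : P 0 →ₗ[A] X),
      (∀ j ≤ i, ∀ t, EV A (P j) Y (t+1)) → Function.Surjective aug → Function.Exact (d 0) aug →
      (∀ j ≤ i, Function.Exact (d (j+1)) (d j)) →
      (EV A X Y (i+1) ↔ ∀ f : P (i+1) →ₗ[A] Y, f ∘ₗ d (i+1) = 0 → ∃ g : P i →ₗ[A] Y, f = g ∘ₗ d i) := by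
  induction i with
  | zero =>
    intro X _ _ P d aug hac hs h0 hex
    have hinj : Function.Injective (LinearMap.ker aug).subtype := Subtype.val_injective
    have hE : Function.Exact (LinearMap.ker aug).subtype aug := fun x => by simp
    have hd0 : ∀ x, d 0 x ∈ LinearMap.ker aug := fun x => h0.apply_apply_eq_zero x
    let d0 : P 1 →ₗ[A] LinearMap.ker aug := (d 0).codRestrict _ hd0
    have hd0s : Function.Surjective d0 := by
      rintro ⟨x, hx⟩
      obtain ⟨y, rfl⟩ := (h0 x).1 hx
      exact ⟨y, rfl⟩
    constructor
    · intro h f hf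
      have hk : LinearMap.ker d0 ≤ LinearMap.ker f := by
        intro x hx
        obtain ⟨y, rfl⟩ := (hex 0 le_rfl x).1 (congrArg Subtype.val hx)
        exact LinearMap.congr_fun hf y
      let v : LinearMap.ker aug →ₗ[A] Y := (LinearMap.ker d0).liftQ f hk ∘ₗ
        (d0.quotKerEquivOfSurjective hd0s).symm.toLinearMap
      have hv : ∀ x, v (d0 x) = f x := fun x => by
        have : (d0.quotKerEquivOfSurjective hd0s).symm (d0 x) = Submodule.Quotient.mk x := by
          rw [LinearEquiv.symm_apply_eq]; rfl
        show (LinearMap.ker d0).liftQ f hk ((d0.quotKerEquivOfSurjective hd0s).symm (d0 x)) = _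
        rw [this]; rfl
      obtain ⟨g, hg⟩ := EV.extend hinj hs hE h v
      refine ⟨g, ?_⟩
      ext x
      rw [← hv x, ← hg]
      rfl
    · intro h
      refine EV.one_of_extend hinj hs hE (hac 0 le_rfl 0) fun u => ?_
      obtain ⟨g, hg⟩ := h (u ∘ₗ d0) (by
        ext x
        have : d0 (d 1 x) = 0 := Subtype.ext ((hex 0 le_rfl).apply_apply_eq_zero x)
        show u (d0 (d 1 x)) = 0
        rw [this, map_zero])
      refine ⟨g, ?_⟩
      ext x
      obtain ⟨y, rfl⟩ := hd0s x
      exact (LinearMap.congr_fun hg y).symm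
  | succ i ih =>
    intro X _ _ P d aug hac hs h0 hex
    have hinj : Function.Injective (LinearMap.ker aug).subtype := Subtype.val_injective
    have hE : Function.Exact (LinearMap.ker aug).subtype aug := fun x => by simp
    have hd0 : ∀ x, d 0 x ∈ LinearMap.ker aug := fun x => h0.apply_apply_eq_zero x
    let d0 : P 1 →ₗ[A] LinearMap.ker aug := (d 0).codRestrict _ hd0
    have hd0s : Function.Surjective d0 := by
      rintro ⟨x, hx⟩
      obtain ⟨y, rfl⟩ := (h0 x).1 hx
      exact ⟨y, rfl⟩
    refine Iff.trans ?_ (ih (LinearMap.ker aug) (fun j => P (j+1)) (fun j => d (j+1)) d0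
      (fun j hj => hac _ (by omega)) hd0s ?_ (fun j hj => hex _ (by omega)))
    · exact ⟨fun h => EV.down hinj hs hE (hac 0 (by omega) i) h,
        fun h => EV.up hinj hs hE (hac 0 (by omega) (i+1)) h⟩
    · intro x
      rw [← hex 0 (by omega) x]
      exact ⟨fun h => congrArg Subtype.val h, fun h => Subtype.ext h⟩

/-- Existence of projective resolutions. -/
lemma projRes_exists (X : ModuleCat.{0} A) : Nonempty (ProjRes A X) := by
  let F : ModuleCat.{0} A → ModuleCat.{0} A := fun X => ModuleCat.of A (X →₀ A)
  let p : ∀ X : ModuleCat.{0} A, F X →ₗ[A] X := fun X => Finsupp.linearCombination A (id : X → X)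
  have hp : ∀ X, Function.Surjective (p X) := fun X => Finsupp.linearCombination_id_surjective A X
  let Z : ℕ → ModuleCat.{0} A := fun j => Nat.rec (motive := fun _ => ModuleCat.{0} A) X
    (fun _ Y => ModuleCat.of A (LinearMap.ker (p Y))) j
  let q : ∀ Y : ModuleCat.{0} A, F (ModuleCat.of A (LinearMap.ker (p Y))) →ₗ[A] F Y := fun Y =>
    (LinearMap.ker (p Y)).subtype ∘ₗ p (ModuleCat.of A (LinearMap.ker (p Y)))
  let d : ∀ j, F (Z (j+1)) →ₗ[A] F (Z j) := fun j => q (Z j)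
  have hex : ∀ j, Function.Exact (d j) (p (Z j)) := by
    intro j x
    constructor
    · intro hx
      obtain ⟨y, hy⟩ := hp (Z (j+1)) ⟨x, hx⟩
      exact ⟨y, congrArg Subtype.val hy⟩
    · rintro ⟨y, rfl⟩
      exact (p (Z (j+1)) y).2
  refine ⟨⟨fun j => F (Z j), d, p X, fun j => ?_, hp X, hex 0, fun j x => ?_⟩⟩
  · show Module.Projective A (Z j →₀ A)
    infer_instance
  · rw [← hex (j+1) x]
    exact ⟨fun h => Subtype.ext h, fun h => congrArg Subtype.val h⟩

lemma extVanish_iff (X Y : ModuleCat.{0} A) (i : ℕ) : ExtVanish A X Y (i+1) ↔ EV A X Y (i+1) := by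
  have key : ∀ R : ProjRes A X, (EV A X Y (i+1) ↔ ∀ f : R.P (i+1) →ₗ[A] Y, f ∘ₗ R.d (i+1) = 0 →
      ∃ g : R.P i →ₗ[A] Y, f = g ∘ₗ R.d i) := fun R =>
    ext_iff i X R.P R.d R.aug (fun j _ t => by
      have := R.proj j
      exact EV.of_proj t) R.augSurj R.exact0 (fun j _ => R.exact j)
  constructor
  · intro h
    obtain ⟨R⟩ := projRes_exists X
    exact (key R).2 (h R)
  · intro h R
    exact (key R).1 h

lemma selfOrth_iff (X : ModuleCat.{0} A) : SelfOrth A X ↔ ∀ i, EV A X X (i+1) := by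
  constructor
  · intro h i
    exact (extVanish_iff X X i).1 (h _ (by omega))
  · intro h i hi
    obtain ⟨j, rfl⟩ : ∃ j, i = j + 1 := ⟨i - 1, by omega⟩
    exact (extVanish_iff X X j).2 (h j)

lemma pd_EV {X : ModuleCat.{0} A} {n : ℕ} (h : pdLE A X n) (Y : Type) [AddCommGroup Y] [Module A Y]
    (t : ℕ) : EV A X Y (n + t + 1) := by
  induction n generalizing X t with
  | zero =>
    obtain ⟨P, hP, ⟨e⟩⟩ := (resLE_zero_iff _ _ _).1 h
    have : Module.Projective A P := hP
    exact EV.equiv e.symm (EV.of_proj _)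
  | succ n ih =>
    obtain ⟨K, P, f, p, hP, hf, hp, hfp, -, hK⟩ := (resLE_succ_iff _ _ _ _).1 h
    have : Module.Projective A P := hP
    have h1 : EV A X Y (n + t + 1 + 1) := EV.up hf hp hfp (EV.of_proj _) (ih hK t)
    rwa [show n + 1 + t + 1 = n + t + 1 + 1 by omega]

lemma id_EV {X : ModuleCat.{0} A} {n : ℕ} (h : idLE A X n) (Y : Type) [AddCommGroup Y] [Module A Y]
    (t : ℕ) : EV A Y X (n + t + 1) := by
  induction n generalizing X t with
  | zero =>
    obtain ⟨P, hP, ⟨e⟩⟩ := (coresLE_zero_iff _ _ _).1 h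
    have : Module.Injective A P := hP
    exact EV.coequiv e (EV.of_inj _)
  | succ n ih =>
    obtain ⟨K, P, f, p, hP, hf, hp, hfp, -, hK⟩ := (coresLE_succ_iff _ _ _ _).1 h
    have : Module.Injective A P := hP
    have h1 : EV A Y X (n + t + 1 + 1) := EV.coup hf hp hfp (EV.of_inj _) (ih hK t)
    rwa [show n + 1 + t + 1 = n + t + 1 + 1 by omega]

/-- projective resolution of length `n` with finitely generated terms. -/
def pdF (A : Type) [Ring A] (X : ModuleCat.{0} A) (n : ℕ) : Prop :=
  ResLE A (zeroMod A) (fun P => Module.Projective A P ∧ Module.Finite A P) X n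

lemma resLE_mono {test : ModuleCat.{0} A} {T T' : ModuleCat.{0} A → Prop} (hT : ∀ P, T P → T' P)
    {X : ModuleCat.{0} A} {n : ℕ} (h : ResLE A test T X n) : ResLE A test T' X n := by
  obtain ⟨P, d, aug, h1, h2⟩ := h
  exact ⟨P, d, aug, fun j hj => hT _ (h1 j hj), h2⟩

lemma zero_lift {P X : ModuleCat.{0} A} (p : P →ₗ[A] X) (u : zeroMod A →ₗ[A] X) :
    ∃ h : zeroMod A →ₗ[A] P, p ∘ₗ h = u := by
  refine ⟨0, ?_⟩
  ext x
  have : x = 0 := Subsingleton.elim (α := PUnit) _ _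
  subst this
  exact ((map_zero u).trans (map_zero _).symm).symm

lemma zero_ext {P X : ModuleCat.{0} A} (p : X →ₗ[A] P) (u : X →ₗ[A] zeroMod A) :
    ∃ h : P →ₗ[A] zeroMod A, h ∘ₗ p = u := by
  refine ⟨0, ?_⟩
  ext x
  exact Subsingleton.elim (α := PUnit) _ _

lemma exists_cover [IsNoetherianRing A] (X : Type) [AddCommGroup X] [Module A X] [Module.Finite A X] :
    ∃ (r : ℕ) (p : (Fin r → A) →ₗ[A] X), Function.Surjective p ∧ Module.Finite A (LinearMap.ker p) := by
  obtain ⟨r, p, hp⟩ := Module.Finite.exists_fin' A X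
  exact ⟨r, p, hp, inferInstance⟩

lemma pdF_of_EV [IsNoetherianRing A] {X : ModuleCat.{0} A} [hX : Module.Finite A X] {n : ℕ}
    (h : ∀ Y : ModuleCat.{0} A, Module.Finite A Y → EV A X Y (n+1)) : pdF A X n := by
  induction n generalizing X with
  | zero =>
    refine (resLE_zero_iff _ _ _).2 ⟨X, ⟨?_, hX⟩, ⟨LinearEquiv.refl _ _⟩⟩
    obtain ⟨r, p, hp, hK⟩ := exists_cover (A := A) X
    obtain ⟨s, hs⟩ := EV.lift (f := (LinearMap.ker p).subtype) (g := p) Subtype.val_injective hp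
      (fun x => by simp) (h (ModuleCat.of A (LinearMap.ker p)) hK) LinearMap.id
    exact Module.Projective.of_split s p hs
  | succ n ih =>
    obtain ⟨r, p, hp, hK⟩ := exists_cover (A := A) X
    have hE : Function.Exact (LinearMap.ker p).subtype p := fun x => by simp
    refine (resLE_succ_iff _ _ _ _).2 ⟨ModuleCat.of A (LinearMap.ker p), ModuleCat.of A (Fin r → A),
      (LinearMap.ker p).subtype, p, ?_, Subtype.val_injective, hp, hE, fun u => zero_lift _ u, ?_⟩
    · exact ⟨inferInstanceAs (Module.Projective A (Fin r → A)), inferInstanceAs (Module.Finite A (Fin r → A))⟩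
    · exact ih (X := ModuleCat.of A (LinearMap.ker p)) (hX := hK) fun Y hY =>
        EV.down (Subtype.val_injective) hp hE (EV.of_proj n) (h Y hY)

lemma pdF.pdLE {X : ModuleCat.{0} A} {n : ℕ} (h : pdF A X n) : pdLE A X n :=
  resLE_mono (fun _ h => h.1) h

lemma pdF_iff [IsNoetherianRing A] {X : ModuleCat.{0} A} [hX : Module.Finite A X] {n : ℕ} :
    pdLE A X n ↔ pdF A X n :=
  ⟨fun h => pdF_of_EV fun Y _ => pd_EV h Y 0, pdF.pdLE⟩

lemma id_of_EV [IsNoetherianRing A]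
    (hI : ∀ X : ModuleCat.{0} A, Module.Finite A X → ∃ (I : ModuleCat.{0} A) (f : X →ₗ[A] I),
      Module.Injective A I ∧ Module.Finite A I ∧ Function.Injective f)
    {X : ModuleCat.{0} A} [hX : Module.Finite A X] {n : ℕ}
    (h : ∀ Y : ModuleCat.{0} A, Module.Finite A Y → EV A Y X (n+1)) : idLE A X n := by
  induction n generalizing X with
  | zero =>
    refine (coresLE_zero_iff _ _ _).2 ⟨X, ?_, ⟨LinearEquiv.refl _ _⟩⟩
    obtain ⟨I, f, hII, hIf, hf⟩ := hI X hX
    obtain ⟨s, hs⟩ := EV.extend (f := f) (g := (LinearMap.range f).mkQ) hf (Submodule.mkQ_surjective _)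
      (fun x => by simp) (h (ModuleCat.of A (I ⧸ LinearMap.range f))
        (inferInstanceAs (Module.Finite A (I ⧸ LinearMap.range f)))) LinearMap.id
    constructor
    intro U V _ _ _ _ u hu g
    obtain ⟨w, hw⟩ := hII.out u hu (f ∘ₗ g)
    refine ⟨s ∘ₗ w, fun x => ?_⟩
    show s (w (u x)) = g x
    rw [hw]
    exact LinearMap.congr_fun hs (g x)
  | succ n ih =>
    obtain ⟨I, f, hII, hIf, hf⟩ := hI X hX
    have hE : Function.Exact f (LinearMap.range f).mkQ := fun x => by simp
    refine (coresLE_succ_iff _ _ _ _).2 ⟨ModuleCat.of A (I ⧸ LinearMap.range f), I, f, 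
      (LinearMap.range f).mkQ, hII, hf, Submodule.mkQ_surjective _, hE, fun u => zero_ext _ u, ?_⟩
    exact ih (X := ModuleCat.of A (I ⧸ LinearMap.range f))
      (hX := inferInstanceAs (Module.Finite A (I ⧸ LinearMap.range f))) fun Y hY =>
        EV.codown hf (Submodule.mkQ_surjective _) hE (EV.of_inj n) (h Y hY)

end pd
end QP
end

set_option linter.unusedSectionVars false
noncomputable section
namespace QP
open CategoryTheory Abelian Paper

section refl
variable (A B Q : Type) [Ring A] [Ring B] [AddCommGroup Q] [Module A Q] [Module B Q]
  [SMulCommClass A B Q] [SMulCommClass B A Q]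

/-- evaluation into the double dual -/
def evm (X : Type) [AddCommGroup X] [Module A X] : X →ₗ[A] ((X →ₗ[A] Q) →ₗ[B] Q) where
  toFun x :=
    { toFun := fun f => f x
      map_add' := fun _ _ => rfl
      map_smul' := fun _ _ => rfl }
  map_add' x y := by ext f; exact map_add f x y
  map_smul' a x := by ext f; exact map_smul f a x

/-- reflexive modules -/
def Refl (X : Type) [AddCommGroup X] [Module A X] : Prop := Function.Bijective (evm A B Q X)

/-- dual of a map -/
def dm {X Y : Type} [AddCommGroup X] [Module A X] [AddCommGroup Y] [Module A Y] (f : X →ₗ[A] Y) :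
    (Y →ₗ[A] Q) →ₗ[B] (X →ₗ[A] Q) where
  toFun h := h ∘ₗ f
  map_add' _ _ := rfl
  map_smul' _ _ := rfl

/-- dual of an equivalence -/
def dme {X Y : Type} [AddCommGroup X] [Module A X] [AddCommGroup Y] [Module A Y] (f : X ≃ₗ[A] Y) :
    (Y →ₗ[A] Q) ≃ₗ[B] (X →ₗ[A] Q) :=
  LinearEquiv.ofLinearMap (dm A B Q f.toLinearMap) (dm A B Q f.symm.toLinearMap)
    (by ext h x; simp [dm]) (by ext h x; simp [dm])

variable {A B Q}
variable {X Y K P M : Type} [AddCommGroup X] [Module A X] [AddCommGroup Y] [Module A Y]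
  [AddCommGroup K] [Module A K] [AddCommGroup P] [Module A P] [AddCommGroup M] [Module A M]

lemma dm_inj {p : P →ₗ[A] X} (hp : Function.Surjective p) : Function.Injective (dm A B Q p) := by
  intro u v huv
  ext x
  obtain ⟨y, rfl⟩ := hp x
  exact LinearMap.congr_fun huv y

lemma dm_exact {f : K →ₗ[A] P} {p : P →ₗ[A] X} (hp : Function.Surjective p) (hfp : Function.Exact f p) :
    Function.Exact (dm A B Q p) (dm A B Q f) := by
    intro u
    constructor
    · intro hu
      have hk : LinearMap.ker p ≤ LinearMap.ker u := by
        intro x hx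
        obtain ⟨y, rfl⟩ := (hfp x).1 hx
        exact LinearMap.congr_fun hu y
      refine ⟨(LinearMap.ker p).liftQ u hk ∘ₗ (p.quotKerEquivOfSurjective hp).symm.toLinearMap, ?_⟩
      ext x
      have : (p.quotKerEquivOfSurjective hp).symm (p x) = Submodule.Quotient.mk x := by
        rw [LinearEquiv.symm_apply_eq]; rfl
      show (LinearMap.ker p).liftQ u hk ((p.quotKerEquivOfSurjective hp).symm (p x)) = _
      rw [this]; rfl
    · rintro ⟨v, rfl⟩
      ext x
      show v (p (f x)) = 0
      rw [hfp.apply_apply_eq_zero, map_zero]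

lemma Refl.retract {s : X →ₗ[A] M} {r : M →ₗ[A] X} (h : r ∘ₗ s = LinearMap.id)
    (hM : Refl A B Q M) : Refl A B Q X := by
  have hrs : ∀ x, r (s x) = x := fun x => LinearMap.congr_fun h x
  constructor
  · intro x y hxy
    have : s x = s y := hM.1 (by
      ext f
      exact LinearMap.congr_fun hxy (f ∘ₗ s))
    rw [← hrs x, this, hrs]
  · intro Φ
    obtain ⟨m, hm⟩ := hM.2 (Φ ∘ₗ dm A B Q s)
    refine ⟨r m, ?_⟩
    ext f
    have h1 : f (r m) = Φ ((f ∘ₗ r) ∘ₗ s) := LinearMap.congr_fun hm (f ∘ₗ r)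
    show f (r m) = Φ f
    rw [h1, LinearMap.comp_assoc, h, LinearMap.comp_id]

lemma Refl.equiv (e : X ≃ₗ[A] M) (hM : Refl A B Q M) : Refl A B Q X :=
  Refl.retract (s := e.toLinearMap) (r := e.symm.toLinearMap) (by ext; simp) hM

lemma Refl.pi (hM : Refl A B Q M) (n : ℕ) : Refl A B Q (Fin n → M) := by
  constructor
  · intro x y hxy
    ext i
    apply hM.1
    ext f
    exact LinearMap.congr_fun hxy (f ∘ₗ LinearMap.proj i)
  · intro Φ
    choose m hm using fun i : Fin n => hM.2 (Φ ∘ₗ dm A B Q (LinearMap.proj (R := A) (φ := fun _ => M) i))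
    refine ⟨m, ?_⟩
    ext f
    have h1 : ∀ i, f (Pi.single i (m i)) = Φ ((f ∘ₗ LinearMap.single A (fun _ => M) i) ∘ₗ LinearMap.proj i) :=
      fun i => LinearMap.congr_fun (hm i) (f ∘ₗ LinearMap.single A (fun _ => M) i)
    show f m = Φ f
    have h2 : f = ∑ i, (f ∘ₗ LinearMap.single A (fun _ => M) i) ∘ₗ LinearMap.proj i := by
      ext i x
      simp [Pi.single_apply, apply_ite]
    conv_rhs => rw [h2]
    rw [map_sum, ← Finset.sum_congr rfl (fun i _ => h1 i), ← map_sum, Finset.univ_sum_single]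

lemma Refl.add (hM : Refl A B Q M) (h : Add A M X) : Refl A B Q X := by
  obtain ⟨n, s, r, hsr⟩ := h
  exact Refl.retract hsr (hM.pi n)

/-- kernel lemma -/
lemma Refl.ker {f : K →ₗ[A] P} {p : P →ₗ[A] X} (hf : Function.Injective f) (h : Function.Exact f p)
    (hP : Refl A B Q P) (hX : Function.Injective (evm A B Q X))
    (hs : ∀ u : K →ₗ[A] Q, ∃ v : P →ₗ[A] Q, v ∘ₗ f = u) : Refl A B Q K := by
  constructor
  · intro x y hxy
    apply hf
    apply hP.1
    ext g
    exact LinearMap.congr_fun hxy (g ∘ₗ f)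
  · intro Φ
    obtain ⟨y, hy⟩ := hP.2 (Φ ∘ₗ dm A B Q f)
    have hy' : ∀ g : P →ₗ[A] Q, g y = Φ (g ∘ₗ f) := fun g => LinearMap.congr_fun hy g
    have h1 : p y = 0 := hX (by
      ext g
      have := hy' (g ∘ₗ p)
      rw [LinearMap.comp_assoc, show p ∘ₗ f = 0 from by ext x; exact h.apply_apply_eq_zero x,
        LinearMap.comp_zero, map_zero] at this
      rw [map_zero]
      exact this)
    obtain ⟨x, rfl⟩ := (h y).1 h1
    refine ⟨x, ?_⟩
    ext u
    obtain ⟨v, rfl⟩ := hs u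
    exact hy' v

lemma Refl.dual (hX : Refl A B Q X) : Refl B A Q (X →ₗ[A] Q) := by
  constructor
  · intro f g h
    ext x
    exact LinearMap.congr_fun h (evm A B Q X x)
  · intro Φ
    refine ⟨Φ ∘ₗ evm A B Q X, ?_⟩
    ext ψ
    obtain ⟨x, rfl⟩ := hX.2 ψ
    rfl

variable (A B Q) in
/-- `A` is the endomorphism ring of `Q` over `B`. -/
def DC : Prop := (∀ φ : Q →ₗ[B] Q, ∃ a : A, ∀ q, φ q = a • q) ∧ (∀ a : A, (∀ q : Q, a • q = 0) → a = 0)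

lemma DC.refl (h : DC A B Q) : Refl A B Q A := by
  constructor
  · intro x y hxy
    refine sub_eq_zero.1 (h.2 _ fun q => ?_)
    have := LinearMap.congr_fun hxy (LinearMap.toSpanSingleton A Q q)
    have h1 : x • q = y • q := by simpa [evm] using this
    rw [sub_smul, h1, sub_self]
  · intro Φ
    let L : Q →ₗ[B] (A →ₗ[A] Q) :=
      { toFun := fun q => LinearMap.toSpanSingleton A Q q
        map_add' := fun x y => by ext; simp
        map_smul' := fun b x => by ext; simp }
    obtain ⟨a, ha⟩ := h.1 (Φ ∘ₗ L)
    refine ⟨a, ?_⟩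
    ext f
    have h1 : f = L (f 1) := by ext; simp [L]
    show f a = Φ f
    rw [h1]
    refine Eq.trans ?_ (ha (f 1)).symm
    simp [L]

lemma DC.of_refl (h : Refl A B Q A) : DC A B Q := by
  constructor
  · intro φ
    let L : (A →ₗ[A] Q) →ₗ[B] Q :=
      { toFun := fun f => f 1
        map_add' := fun x y => rfl
        map_smul' := fun b x => rfl }
    obtain ⟨a, ha⟩ := h.2 (φ ∘ₗ L)
    refine ⟨a, fun q => ?_⟩
    have := LinearMap.congr_fun ha (LinearMap.toSpanSingleton A Q q)
    have h1 : a • q = φ ((1:A) • q) := this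
    rw [h1, one_smul]
  · intro a ha
    apply h.1
    rw [map_zero]
    ext f
    show f a = 0
    rw [← mul_one a, ← smul_eq_mul, map_smul, ha]

lemma DC.reflQ (h : DC A B Q) : Refl B A Q Q := by
  constructor
  · intro x y hxy
    exact LinearMap.congr_fun hxy LinearMap.id
  · intro Φ
    refine ⟨Φ LinearMap.id, ?_⟩
    ext φ
    obtain ⟨a, ha⟩ := h.1 φ
    have : φ = a • LinearMap.id := by ext q; exact ha q
    show φ (Φ LinearMap.id) = Φ φ
    conv_rhs => rw [this, map_smul]
    exact ha _

lemma fgproj_add [Module.Projective A P] [Module.Finite A P] : Add A A P := by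
  obtain ⟨n, p, hp⟩ := Module.Finite.exists_fin' A P
  obtain ⟨s, hs⟩ := Module.projective_lifting_property p LinearMap.id hp
  exact ⟨n, s, p, hs⟩

lemma Add.proj (h : Add A A P) : Module.Projective A P := by
  obtain ⟨n, s, r, hsr⟩ := h
  exact Module.Projective.of_split s r hsr

lemma Add.finite [Module.Finite A M] (h : Add A M P) : Module.Finite A P := by
  obtain ⟨n, s, r, hsr⟩ := h
  exact Module.Finite.of_surjective r (fun x => ⟨s x, LinearMap.congr_fun hsr x⟩)

lemma Add.equiv (e : X ≃ₗ[A] Y) (h : Add A M Y) : Add A M X := by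
  obtain ⟨n, s, r, hsr⟩ := h
  refine ⟨n, s ∘ₗ e.toLinearMap, e.symm.toLinearMap ∘ₗ r, ?_⟩
  ext x
  have := LinearMap.congr_fun hsr (e x)
  have h2 : r (s (e x)) = e x := this
  show e.symm (r (s (e x))) = x
  rw [h2, e.symm_apply_apply]

lemma Add.test_equiv (e : K ≃ₗ[A] M) (h : Add A M X) : Add A K X := by
  obtain ⟨n, s, r, hsr⟩ := h
  refine ⟨n, (LinearEquiv.piCongrRight fun _ => e.symm).toLinearMap ∘ₗ s,
    r ∘ₗ (LinearEquiv.piCongrRight fun _ => e).toLinearMap, ?_⟩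
  ext x
  have h2 : r (s x) = x := LinearMap.congr_fun hsr x
  refine Eq.trans ?_ h2
  show r _ = r _
  congr 1
  ext i
  simp

/-- dualising add -/
lemma Add.dual (h : Add A M X) : Add B (M →ₗ[A] Q) (X →ₗ[A] Q) := by
  obtain ⟨n, s, r, hsr⟩ := h
  refine ⟨n, LinearMap.pi (fun i => dm A B Q (r ∘ₗ LinearMap.single A (fun _ => M) i)),
    ∑ i, dm A B Q (LinearMap.proj i ∘ₗ s) ∘ₗ LinearMap.proj i, ?_⟩
  ext f x
  have h2 : r (s x) = x := LinearMap.congr_fun hsr x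
  have : (∑ i, f (r (Pi.single i (s x i)))) = f x := by
    rw [← map_sum, ← map_sum, Finset.univ_sum_single, h2]
  simpa [LinearMap.sum_apply, dm] using this

lemma DC.projDual (h : DC A B Q) {Y : Type} [AddCommGroup Y] [Module B Y] (hY : Add B Q Y) :
    Add A A (Y →ₗ[B] Q) := by
  have h1 : Add A (Q →ₗ[B] Q) (Y →ₗ[B] Q) := hY.dual
  let L : A →ₗ[A] (Q →ₗ[B] Q) := LinearMap.toSpanSingleton A _ LinearMap.id
  have hL : Function.Bijective L := by
    constructor
    · rw [← LinearMap.ker_eq_bot, LinearMap.ker_eq_bot']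
      intro a ha
      exact h.2 a fun q => LinearMap.congr_fun ha q
    · intro φ
      obtain ⟨a, ha⟩ := h.1 φ
      exact ⟨a, by ext q; exact (ha q).symm⟩
  exact h1.test_equiv (LinearEquiv.ofBijective L hL)

/-- `A^* ≅ Q` -/
def starA : (A →ₗ[A] Q) ≃ₗ[B] Q where
  toFun f := f 1
  map_add' _ _ := rfl
  map_smul' _ _ := rfl
  invFun q := LinearMap.toSpanSingleton A Q q
  left_inv f := by ext; simp
  right_inv q := by simp

lemma dualProj (h : Add A A P) : Add B Q (P →ₗ[A] Q) := by
  have h1 : Add B (A →ₗ[A] Q) (P →ₗ[A] Q) := h.dual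
  exact h1.test_equiv starA.symm

end refl

section CL
variable {A B Q : Type} [Ring A] [Ring B] [AddCommGroup Q] [Module A Q] [Module B Q]
  [SMulCommClass A B Q] [SMulCommClass B A Q]

lemma resLE_equiv {A : Type} [Ring A] {test : ModuleCat.{0} A} {T : ModuleCat.{0} A → Prop}
    {X Y : ModuleCat.{0} A} (e : X ≃ₗ[A] Y) {n : ℕ} (h : ResLE A test T X n) : ResLE A test T Y n := by
  cases n with
  | zero =>
    obtain ⟨P, hP, ⟨f⟩⟩ := (resLE_zero_iff _ _ _).1 h
    exact (resLE_zero_iff _ _ _).2 ⟨P, hP, ⟨f.trans e⟩⟩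
  | succ n =>
    obtain ⟨K, P, f, p, hP, hf, hp, hfp, hl, hK⟩ := (resLE_succ_iff _ _ _ _).1 h
    refine (resLE_succ_iff _ _ _ _).2 ⟨K, P, f, e.toLinearMap ∘ₗ p, hP, hf, e.surjective.comp hp, ?_, ?_, hK⟩
    · intro x
      rw [← hfp x]
      exact ⟨fun h => e.injective (h.trans (map_zero e).symm), fun h => by simp [h]⟩
    · intro u
      obtain ⟨h, hh⟩ := hl (e.symm.toLinearMap ∘ₗ u)
      refine ⟨h, ?_⟩
      rw [LinearMap.comp_assoc, hh]
      ext; simp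

lemma coresLE_equiv {A : Type} [Ring A] {test : ModuleCat.{0} A} {T : ModuleCat.{0} A → Prop}
    {X Y : ModuleCat.{0} A} (e : X ≃ₗ[A] Y) {n : ℕ} (h : CoresLE A test T X n) : CoresLE A test T Y n := by
  cases n with
  | zero =>
    obtain ⟨P, hP, ⟨f⟩⟩ := (coresLE_zero_iff _ _ _).1 h
    exact (coresLE_zero_iff _ _ _).2 ⟨P, hP, ⟨e.symm.trans f⟩⟩
  | succ n =>
    obtain ⟨K, P, f, p, hP, hf, hp, hfp, hl, hK⟩ := (coresLE_succ_iff _ _ _ _).1 h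
    refine (coresLE_succ_iff _ _ _ _).2 ⟨K, P, f ∘ₗ e.symm.toLinearMap, p, hP, hf.comp e.symm.injective, hp, ?_, ?_, hK⟩
    · intro x
      rw [hfp x]
      exact ⟨fun ⟨y, hy⟩ => ⟨e y, by simpa using hy⟩, fun ⟨y, hy⟩ => ⟨e.symm y, hy⟩⟩
    · intro u
      obtain ⟨h, hh⟩ := hl (u ∘ₗ e.toLinearMap)
      refine ⟨h, ?_⟩
      rw [← LinearMap.comp_assoc, hh]
      ext; simp

/-- Lemma CL(a) -/
lemma CLa (hA : DC A B Q) {l : ℕ} : ∀ {Y : ModuleCat.{0} B},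
    CoresLE B (ModuleCat.of B Q) (InAdd B (ModuleCat.of B Q)) Y l →
    pdLE A (ModuleCat.of A (Y →ₗ[B] Q)) l ∧ (∀ i, EV A (Y →ₗ[B] Q) Q (i+1)) ∧ Refl B A Q Y := by
  induction l with
  | zero =>
    intro Y h
    obtain ⟨P, hP, ⟨e⟩⟩ := (coresLE_zero_iff _ _ _).1 h
    have hY : Add B Q Y := Add.equiv e hP
    have hp := hA.projDual hY
    have := hp.proj
    exact ⟨(resLE_zero_iff _ _ _).2 ⟨_, this, ⟨LinearEquiv.refl _ _⟩⟩, fun i => EV.of_proj i,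
      hA.reflQ.add hY⟩
  | succ l ih =>
    intro Y h
    obtain ⟨K, P, f, p, hP, hf, hp, hfp, hl, hK⟩ := (coresLE_succ_iff _ _ _ _).1 h
    obtain ⟨h1, h2, h3⟩ := ih hK
    have hPr : Add A A (P →ₗ[B] Q) := hA.projDual hP
    have hPp := hPr.proj
    have hinj : Function.Injective (dm B A Q p) := fun u v huv => by
      ext x
      obtain ⟨y, rfl⟩ := hp x
      exact LinearMap.congr_fun huv y
    have hsur : Function.Surjective (dm B A Q f) := fun u => hl u
    have hex : Function.Exact (dm B A Q p) (dm B A Q f) := dm_exact hp hfp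
    refine ⟨?_, ?_, ?_⟩
    · exact (resLE_succ_iff _ _ _ _).2 ⟨ModuleCat.of A (K →ₗ[B] Q), ModuleCat.of A (P →ₗ[B] Q),
        dm B A Q p, dm B A Q f, hPp, hinj, hsur, hex, fun u => zero_lift _ u, h1⟩
    · intro i
      cases i with
      | succ i => exact EV.up hinj hsur hex (EV.of_proj _) (h2 i)
      | zero =>
        refine EV.one_of_extend hinj hsur hex (EV.of_proj _) fun u => ?_
        obtain ⟨x, rfl⟩ := h3.2 u
        obtain ⟨y, rfl⟩ := hp x
        exact ⟨evm B A Q P y, by ext; rfl⟩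
    · exact Refl.ker hf hfp (hA.reflQ.add hP) h3.1 hl

/-- Lemma CL(b) -/
lemma CLb (hA : DC A B Q) {l : ℕ} : ∀ {X : ModuleCat.{0} A},
    pdF A X l → (∀ i, EV A X Q (i+1)) → Refl A B Q X →
    CoresLE B (ModuleCat.of B Q) (InAdd B (ModuleCat.of B Q)) (ModuleCat.of B (X →ₗ[A] Q)) l := by
  induction l with
  | zero =>
    intro X h hE hR
    obtain ⟨P, ⟨hP, hPf⟩, ⟨e⟩⟩ := (resLE_zero_iff _ _ _).1 h
    have hX : Add A A X := Add.equiv e.symm fgproj_add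
    exact (coresLE_zero_iff _ _ _).2 ⟨ModuleCat.of B (X →ₗ[A] Q), dualProj hX, ⟨LinearEquiv.refl _ _⟩⟩
  | succ l ih =>
    intro X h hE hR
    obtain ⟨K, P, f, p, ⟨hP, hPf⟩, hf, hp, hfp, -, hK⟩ := (resLE_succ_iff _ _ _ _).1 h
    have hKE : ∀ i, EV A K Q (i+1) := fun i => EV.down hf hp hfp (EV.of_proj i) (hE (i+1))
    have hs := EV.extend hf hp hfp (hE 0)
    have hKR : Refl A B Q K := Refl.ker hf hfp (hA.refl.add fgproj_add) hR.1 hs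
    refine (coresLE_succ_iff _ _ _ _).2 ⟨ModuleCat.of B (K →ₗ[A] Q), ModuleCat.of B (P →ₗ[A] Q),
      dm A B Q p, dm A B Q f, dualProj fgproj_add, ?_, hs, ?_, ?_, ih hK hKE hKR⟩
    · intro u v huv
      ext x
      obtain ⟨y, rfl⟩ := hp x
      exact LinearMap.congr_fun huv y
    · exact dm_exact hp hfp
    · intro u
      obtain ⟨x, rfl⟩ := hR.2 u
      obtain ⟨y, rfl⟩ := hp x
      exact ⟨evm A B Q P y, by ext; rfl⟩

end CL
end QP
end

set_option linter.unusedSectionVars false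
noncomputable section
namespace QP
open CategoryTheory Abelian Paper

section fres
variable {A : Type} [Ring A] [IsNoetherianRing A]

lemma exists_cover' (X : ModuleCat.{0} A) (h : Module.Finite A X) :
    ∃ (P : ModuleCat.{0} A) (p : P →ₗ[A] X), Module.Projective A P ∧ Module.Finite A P ∧
      Function.Surjective p := by
  obtain ⟨r, p, hp, -⟩ := exists_cover (A := A) X
  exact ⟨ModuleCat.of A (Fin r → A), p, inferInstanceAs (Module.Projective A (Fin r → A)),
    inferInstanceAs (Module.Finite A (Fin r → A)), hp⟩

lemma fres_exists (X : ModuleCat.{0} A) (hX : Module.Finite A X) :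
    ∃ R : ProjRes A X, ∀ j, Module.Finite A (R.P j) := by
  choose F p hP hF hp using exists_cover' (A := A)
  let S := {X : ModuleCat.{0} A // Module.Finite A X}
  have hk : ∀ Y : S, Module.Finite A (LinearMap.ker (p Y.1 Y.2)) := fun Y => by
    have := hF Y.1 Y.2
    infer_instance
  let Ω : S → S := fun Y => ⟨ModuleCat.of A (LinearMap.ker (p Y.1 Y.2)), hk Y⟩
  let F' : S → ModuleCat.{0} A := fun Y => F Y.1 Y.2
  let p' : ∀ Y : S, F' Y →ₗ[A] Y.1 := fun Y => p Y.1 Y.2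
  let Z : ℕ → S := fun j => Nat.rec (motive := fun _ => S) ⟨X, hX⟩ (fun _ Y => Ω Y) j
  let q : ∀ Y : S, F' (Ω Y) →ₗ[A] F' Y := fun Y =>
    (LinearMap.ker (p' Y)).subtype ∘ₗ p' (Ω Y)
  have hex : ∀ Y, Function.Exact (q Y) (p' Y) := by
    intro Y x
    constructor
    · intro hx
      obtain ⟨y, hy⟩ := hp (Ω Y).1 (Ω Y).2 ⟨x, hx⟩
      exact ⟨y, congrArg Subtype.val hy⟩
    · rintro ⟨y, rfl⟩
      exact (p' (Ω Y) y).2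
  refine ⟨⟨fun j => F' (Z j), fun j => q (Z j), p' ⟨X, hX⟩, fun j => hP _ _, hp _ _, hex _, fun j x => ?_⟩, fun j => hF _ _⟩
  rw [← hex (Z (j+1)) x]
  exact ⟨fun h => Subtype.ext h, fun h => congrArg Subtype.val h⟩
end fres

section QG
variable {A B Q : Type} [Ring A] [Ring B] [AddCommGroup Q] [Module A Q] [Module B Q]
  [SMulCommClass A B Q] [SMulCommClass B A Q]

lemma qg1 (hA : DC A B Q) {l : ℕ} (h : QuasiGenLE B (ModuleCat.of B Q) l) :
    pdLE A (ModuleCat.of A Q) l ∧ (∀ i, EV A Q Q (i+1)) ∧ DC B A Q := by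
  obtain ⟨h1, h2, h3⟩ := CLa hA h
  let e : (B →ₗ[B] Q) ≃ₗ[A] Q := starA
  exact ⟨resLE_equiv (X := ModuleCat.of A (B →ₗ[B] Q)) (Y := ModuleCat.of A Q) e h1,
    fun i => EV.equiv e.symm (h2 i), DC.of_refl h3⟩

/-- `A ≅ End_B Q` as modules -/
def DC.eqv (h : DC A B Q) : A ≃ₗ[A] (Q →ₗ[B] Q) :=
  LinearEquiv.ofBijective (LinearMap.toSpanSingleton A (Q →ₗ[B] Q) LinearMap.id) (by
    constructor
    · rw [← LinearMap.ker_eq_bot, LinearMap.ker_eq_bot']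
      intro a ha
      exact h.2 a fun q => LinearMap.congr_fun ha q
    · intro φ
      obtain ⟨a, ha⟩ := h.1 φ
      exact ⟨a, by ext q; exact (ha q).symm⟩)

lemma qg2 [IsNoetherianRing A] [hf : Module.Finite A Q] (hA : DC A B Q) (hB : DC B A Q) {l : ℕ}
    (h1 : pdLE A (ModuleCat.of A Q) l) (h2 : ∀ i, EV A Q Q (i+1)) :
    QuasiGenLE B (ModuleCat.of B Q) l := by
  have := CLb (X := ModuleCat.of A Q) hA ((pdF_iff (hX := hf)).1 h1) h2 hB.reflQ
  exact coresLE_equiv (X := ModuleCat.of B (Q →ₗ[A] Q)) (Y := ModuleCat.of B B) hB.eqv.symm this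

lemma domdim1 (hB : DC B A Q) {N : ℕ}
    (h : domdimGE A (ModuleCat.of A Q) (ModuleCat.of A A) (N+2)) :
    DC A B Q ∧ ∀ i, i < N → EV B Q Q (i+1) := by
  rcases h with h | ⟨M, ι, d, hM, hι, hex0, hex, he0, he1, he⟩
  · omega
  have hex0 := hex0 (by omega)
  have he1 := he1 (by omega)
  have hM' : ∀ j, j + 1 ≤ N + 2 → Add A Q (M j) := hM
  have hR : ∀ j, j + 1 ≤ N + 2 → Refl A B Q (M j) := fun j hj => hB.reflQ.add (hM' j hj)
  refine ⟨DC.of_refl (Refl.ker (K := A) hι hex0 (hR 0 (by omega)) (hR 1 (by omega)).1 he0), ?_⟩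
  intro i hi
  let e : (A →ₗ[A] Q) ≃ₗ[B] Q := starA
  refine EV.equiv e.symm ?_
  refine (ext_iff i (A →ₗ[A] Q) (fun j => ModuleCat.of B (M j →ₗ[A] Q)) (fun j => dm A B Q (d j))
    (dm A B Q ι) ?_ he0 ?_ ?_).2 ?_
  · intro j hj t
    have := (hB.projDual (hM' j (by omega))).proj
    exact EV.of_proj (X := (M j →ₗ[A] Q)) t
  · intro f
    constructor
    · intro hf
      exact he1 f hf
    · rintro ⟨g, rfl⟩
      ext
      show g (d 0 (ι 1)) = 0
      rw [hex0.apply_apply_eq_zero, map_zero]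
  · intro j hj f
    constructor
    · intro hf
      exact he j (by omega) f hf
    · rintro ⟨g, rfl⟩
      ext x
      show g (d (j+1) (d j x)) = 0
      rw [(hex j (by omega)).apply_apply_eq_zero, map_zero]
  · intro f hf
    obtain ⟨x, rfl⟩ := (hR (i+1) (by omega)).2 f
    have hx : d (i+1) x = 0 := (hR (i+2) (by omega)).1 (by
      rw [map_zero]
      ext g
      exact LinearMap.congr_fun hf g)
    obtain ⟨y, rfl⟩ := (hex i (by omega) x).1 hx
    exact ⟨evm A B Q _ y, by ext g; rfl⟩

lemma domdim2 [IsNoetherianRing B] [hf : Module.Finite B Q] (hA : DC A B Q) (hB : DC B A Q) {N : ℕ}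
    (h : ∀ i, i < N → EV B Q Q (i+1)) :
    domdimGE A (ModuleCat.of A Q) (ModuleCat.of A A) (N+2) := by
  obtain ⟨R, hR⟩ := fres_exists (A := B) (ModuleCat.of B Q) hf
  have hAdd : ∀ j, Add B B (R.P j) := fun j => by
    have := R.proj j
    have := hR j
    exact fgproj_add
  have hRf : ∀ j, Refl B A Q (R.P j) := fun j => hB.refl.add (hAdd j)
  let aug : R.P 0 →ₗ[B] Q := R.aug
  have haug : Function.Surjective aug := R.augSurj
  let ι : A →ₗ[A] (R.P 0 →ₗ[B] Q) := LinearMap.toSpanSingleton A _ aug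
  have hι : ∀ a x, ι a x = a • aug x := fun a x => rfl
  refine Or.inr ⟨fun j => ModuleCat.of A (R.P j →ₗ[B] Q), ι, fun j => dm B A Q (R.d j),
    fun j _ => dualProj (hAdd j), ?_, fun _ => ?_, ?_, ?_, fun _ => ?_, ?_⟩
  · intro a b hab
    refine sub_eq_zero.1 (hA.2 _ fun q => ?_)
    obtain ⟨x, rfl⟩ := haug q
    have : a • aug x = b • aug x := LinearMap.congr_fun hab x
    rw [sub_smul, this, sub_self]
  · intro f
    constructor
    · intro hf
      obtain ⟨φ, rfl⟩ := (dm_exact (A := B) (B := A) (Q := Q) (f := R.d 0) haug R.exact0 f).1 hf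
      obtain ⟨a, ha⟩ := hA.1 φ
      exact ⟨a, by ext x; exact (ha (aug x)).symm⟩
    · rintro ⟨a, rfl⟩
      ext x
      show a • aug (R.d 0 x) = 0
      rw [show aug (R.d 0 x) = 0 from R.exact0.apply_apply_eq_zero x, smul_zero]
  · intro j hj f
    constructor
    · intro hf
      have := (ext_iff j Q R.P R.d aug (fun j _ t => by
        have := R.proj j
        exact EV.of_proj t) haug R.exact0 (fun j _ => R.exact j)).1 (h j (by omega)) f hf
      obtain ⟨g, hg⟩ := this
      exact ⟨g, hg.symm⟩
    · rintro ⟨g, rfl⟩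
      ext x
      show g (R.d j (R.d (j+1) x)) = 0
      rw [(R.exact j).apply_apply_eq_zero, map_zero]
  · intro f
    obtain ⟨y, hy⟩ := haug (f (1:A))
    refine ⟨evm B A Q _ y, ?_⟩
    refine LinearMap.ext_ring ?_
    show (1:A) • aug y = f (1:A)
    rw [one_smul, hy]
  · intro f hf
    obtain ⟨y, rfl⟩ := (hRf 0).2 f
    have : aug y = 0 := by
      have h1 : (1:A) • aug y = 0 := LinearMap.congr_fun hf (1:A)
      rwa [one_smul] at h1
    obtain ⟨z, rfl⟩ := (R.exact0 y).1 this
    exact ⟨evm B A Q _ z, by ext g; rfl⟩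
  · intro j hj f hf
    obtain ⟨y, rfl⟩ := (hRf (j+1)).2 f
    have : R.d j y = 0 := (hRf j).1 (by
      rw [map_zero]
      ext g
      exact LinearMap.congr_fun hf g)
    obtain ⟨z, rfl⟩ := (R.exact j y).1 this
    exact ⟨evm B A Q _ z, by ext g; rfl⟩

end QG
end QP
end

set_option linter.unusedSectionVars false
noncomputable section
namespace QP
open CategoryTheory Abelian Paper

/-- `A'` is the opposite algebra of `A`. -/
class IsOp (k A' : Type) (A : outParam Type) [Field k] [Ring A] [Ring A'] [Algebra k A] [Algebra k A'] where
  o : A' ≃ₐ[k] Aᵐᵒᵖ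

/-- `A'` and `A` are opposite to each other, in a compatible way. -/
class OpCompat (k A A' : Type) [Field k] [Ring A] [Ring A'] [Algebra k A] [Algebra k A']
    [IsOp k A A'] [IsOp k A' A] : Prop where
  h1 : ∀ a : A, (IsOp.o (k := k) (A' := A') (A := A) (IsOp.o (k := k) (A' := A) (A := A') a).unop).unop = a
  h2 : ∀ a : A', (IsOp.o (k := k) (A' := A) (A := A') (IsOp.o (k := k) (A' := A') (A := A) a).unop).unop = a

instance OpCompat.symm (k A A' : Type) [Field k] [Ring A] [Ring A'] [Algebra k A] [Algebra k A']
    [IsOp k A A'] [IsOp k A' A] [h : OpCompat k A A'] : OpCompat k A' A := ⟨h.h2, h.h1⟩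

/-- vector space dual, as a type synonym. -/
def DD (k : Type) [Field k] (X : Type) [AddCommGroup X] [Module k X] : Type := X →ₗ[k] k

section DDdef
variable (k : Type) [Field k] (X : Type) [AddCommGroup X] [Module k X]
instance : AddCommGroup (DD k X) := inferInstanceAs (AddCommGroup (X →ₗ[k] k))
instance : Module k (DD k X) := inferInstanceAs (Module k (X →ₗ[k] k))
instance : FunLike (DD k X) X k := inferInstanceAs (FunLike (X →ₗ[k] k) X k)
instance : LinearMapClass (DD k X) k X k := inferInstanceAs (LinearMapClass (X →ₗ[k] k) k X k)
instance [FiniteDimensional k X] : FiniteDimensional k (DD k X) :=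
  inferInstanceAs (FiniteDimensional k (Module.Dual k X))

variable {k X}
@[ext] lemma DD.ext {f g : DD k X} (h : ∀ x, f x = g x) : f = g := LinearMap.ext h
@[simp] lemma DD.add_apply (f g : DD k X) (x : X) : (f + g) x = f x + g x := rfl
@[simp] lemma DD.zero_apply (x : X) : (0 : DD k X) x = 0 := rfl
@[simp] lemma DD.ksmul_apply (c : k) (f : DD k X) (x : X) : (c • f) x = c * f x := rfl

lemma DD.sep {x : X} (h : ∀ f : DD k X, f x = 0) : x = 0 :=
  (Module.forall_dual_apply_eq_zero_iff k x).1 h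

variable {A A' : Type} [Ring A] [Ring A'] [Algebra k A] [Algebra k A'] [IsOp k A' A]
  [Module A X] [IsScalarTower k A X]

variable (k) in
/-- the action of an element of `A'` as an element of `A`. -/
def ou (a : A') : A := (IsOp.o (k := k) (A' := A') (A := A) a).unop

lemma ou_add (a b : A') : ou k (a + b) = ou k a + ou k b := by simp [ou]
lemma ou_mul (a b : A') : ou k (a * b) = ou k b * ou k a := by simp [ou]
lemma ou_one : ou k (1 : A') = 1 := by simp [ou]
lemma ou_zero : ou k (0 : A') = 0 := by simp [ou]
lemma ou_alg (c : k) : ou k (algebraMap k A' c) = algebraMap k A c := by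
  simp only [ou, AlgEquiv.commutes]; rfl
lemma ou_surj (a : A) : ∃ b : A', ou k b = a :=
  ⟨(IsOp.o (k := k) (A' := A') (A := A)).symm (op a), by simp [ou]⟩
lemma ou_inj {a b : A'} (h : ou k a = ou k b) : a = b :=
  (IsOp.o (k := k) (A' := A') (A := A)).injective (unop_injective h)

lemma ou_ou [IsOp k A A'] [h : OpCompat k A A'] (a : A) : ou k (ou k a : A') = a := h.h1 a

instance DD.mod : Module A' (DD k X) where
  smul a φ := ({ toFun := fun x => φ (ou k a • x)
                 map_add' := fun x y => by rw [smul_add, map_add]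
                 map_smul' := fun c x => by
                  rw [smul_algebra_smul_comm]; exact map_smul φ c _ } : X →ₗ[k] k)
  one_smul φ := by
    ext x
    show φ (ou k (1 : A') • x) = φ x
    rw [ou_one, one_smul]
  mul_smul a b φ := by
    ext x
    show φ (ou k (a * b) • x) = φ (ou k b • ou k a • x)
    rw [ou_mul, mul_smul]
  smul_zero a := rfl
  smul_add a φ ψ := rfl
  add_smul a b φ := by
    ext x
    show φ (ou k (a + b) • x) = φ (ou k a • x) + φ (ou k b • x)
    rw [ou_add, add_smul, map_add]
  zero_smul φ := by
    ext x
    show φ (ou k (0 : A') • x) = 0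
    rw [ou_zero, zero_smul, map_zero]

lemma DD.smul_apply (a : A') (φ : DD k X) (x : X) : (a • φ) x = φ (ou k a • x) := rfl

instance DD.tower : IsScalarTower k A' (DD k X) := ⟨fun c a φ => by
  ext x
  rw [DD.smul_apply, DD.ksmul_apply, DD.smul_apply, Algebra.smul_def, ou_mul, mul_smul, ou_alg,
    algebraMap_smul, smul_algebra_smul_comm]
  exact map_smul φ c _⟩

instance DD.comm {B B' : Type} [Ring B] [Ring B'] [Algebra k B] [Algebra k B'] [IsOp k B' B]
    [Module B X] [IsScalarTower k B X] [SMulCommClass B A X] : SMulCommClass A' B' (DD k X) :=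
  ⟨fun a b φ => by
    ext x
    show φ (ou k b • ou k a • x) = φ (ou k a • ou k b • x)
    rw [smul_comm]⟩

variable {Y K P : Type} [AddCommGroup Y] [Module k Y] [Module A Y] [IsScalarTower k A Y]
  [AddCommGroup K] [Module k K] [Module A K] [IsScalarTower k A K]
  [AddCommGroup P] [Module k P] [Module A P] [IsScalarTower k A P]

variable (k A') in
def Dm (f : X →ₗ[A] Y) : DD k Y →ₗ[A'] DD k X where
  toFun φ := (φ : Y →ₗ[k] k) ∘ₗ f.restrictScalars k
  map_add' _ _ := rfl
  map_smul' a φ := by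
    ext x
    show φ (ou k a • f x) = φ (f (ou k a • x))
    rw [map_smul f]

@[simp] lemma Dm_apply (f : X →ₗ[A] Y) (φ : DD k Y) (x : X) : Dm k A' f φ x = φ (f x) := rfl

lemma Dm_surj {f : X →ₗ[A] Y} (hf : Function.Injective f) : Function.Surjective (Dm k A' f) :=
  LinearMap.dualMap_surjective_of_injective (f := f.restrictScalars k) hf

lemma Dm_inj {f : X →ₗ[A] Y} (hf : Function.Surjective f) : Function.Injective (Dm k A' f) := by
  intro u v huv
  ext x
  obtain ⟨y, rfl⟩ := hf x
  exact DFunLike.congr_fun huv y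

lemma Dm_exact {f : K →ₗ[A] P} {g : P →ₗ[A] X} (h : Function.Exact f g) :
    Function.Exact (Dm k A' g) (Dm k A' f) := by
  intro φ
  constructor
  · intro hφ
    let φ' : Module.Dual k P := φ
    have h1 : φ' ∈ (LinearMap.ker (g.restrictScalars k)).dualAnnihilator := by
      rw [Submodule.mem_dualAnnihilator]
      intro x hx
      obtain ⟨y, rfl⟩ := (h x).1 hx
      exact DFunLike.congr_fun hφ y
    rw [← LinearMap.range_dualMap_eq_dualAnnihilator_ker] at h1
    exact h1
  · rintro ⟨ψ, rfl⟩
    ext x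
    simp [h.apply_apply_eq_zero]

variable (k A') in
def Dme (f : X ≃ₗ[A] Y) : DD k Y ≃ₗ[A'] DD k X :=
  LinearEquiv.ofLinearMap (Dm k A' f.toLinearMap) (Dm k A' f.symm.toLinearMap)
    (by ext h x; simp) (by ext h x; simp)

/-- dual of finite sums: dual basis of add -/
lemma Add.DD (h : Add A Y X) : Add A' (DD k Y) (DD k X) := by
  obtain ⟨n, s, r, hsr⟩ := h
  refine ⟨n, LinearMap.pi (fun i => Dm k A' (r ∘ₗ LinearMap.single A (fun _ => Y) i)),
    ∑ i, Dm k A' (LinearMap.proj i ∘ₗ s) ∘ₗ LinearMap.proj i, ?_⟩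
  ext f x
  have h2 : r (s x) = x := LinearMap.congr_fun hsr x
  have : (∑ i, f (r (Pi.single i (s x i)))) = f x := by
    rw [← map_sum, ← map_sum, Finset.univ_sum_single, h2]
  have key : ∀ (F : Fin n → QP.DD k X) (x : X), (∑ i, F i) x = ∑ i, F i x := fun F x =>
    LinearMap.sum_apply (R := k) (M := X) (M₂ := k) Finset.univ F x
  simpa [LinearMap.sum_apply, key] using this

section two
variable [IsOp k A A'] [OpCompat k A A']

def evD : X →ₗ[A] DD k (DD k X) where
  toFun x := ({ toFun := fun φ => φ x
                map_add' := fun _ _ => rfl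
                map_smul' := fun _ _ => rfl } : DD k X →ₗ[k] k)
  map_add' x y := by ext φ; exact map_add φ x y
  map_smul' a x := by
    ext φ
    show φ (a • x) = φ (ou k (ou k a : A') • x)
    rw [ou_ou]

@[simp] lemma evD_apply (x : X) (φ : DD k X) :
    (evD (A := A) (A' := A') x : DD k (DD k X)) φ = φ x := rfl

lemma evD_bij [FiniteDimensional k X] : Function.Bijective (evD (k := k) (A := A) (A' := A') (X := X)) :=
  Module.bijective_dual_eval k X

variable (k X A A') in
def DDe [FiniteDimensional k X] : X ≃ₗ[A] DD k (DD k X) := LinearEquiv.ofBijective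
  (evD (k := k) (A := A) (A' := A') (X := X)) evD_bij

variable {Z : Type} [AddCommGroup Z] [Module k Z] [Module A' Z] [IsScalarTower k A' Z]

def swp (u : X →ₗ[A] DD k Z) : Z →ₗ[A'] DD k X where
  toFun z := ({ toFun := fun x => u x z
                map_add' := fun x y => by rw [map_add]; rfl
                map_smul' := fun c x => by
                  have := map_smul (u.restrictScalars k) c x
                  exact DFunLike.congr_fun this z } : X →ₗ[k] k)
  map_add' x y := by ext z; exact map_add (u z) x y
  map_smul' a z := by
    ext x
    show u x (a • z) = u (ou k a • x) z
    rw [map_smul u, DD.smul_apply, ou_ou]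

@[simp] lemma swp_apply (u : X →ₗ[A] DD k Z) (z : Z) (x : X) : swp u z x = u x z := rfl

end two
end DDdef

section inj
variable {k A A' : Type} [Field k] [Ring A] [Ring A'] [Algebra k A] [Algebra k A'] [IsOp k A' A]
  [IsOp k A A'] [OpCompat k A A']

lemma DD_injective (P : Type) [AddCommGroup P] [Module k P] [Module A' P] [IsScalarTower k A' P]
    [Module.Projective A' P] : Module.Injective A (DD k P) := by
  constructor
  intro X Y _ _ _ _ u hu g
  let _ : Module k X := Module.compHom X (algebraMap k A)
  let _ : Module k Y := Module.compHom Y (algebraMap k A)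
  have : IsScalarTower k A X := ⟨fun c a x => by
    rw [Algebra.smul_def, mul_smul]; rfl⟩
  have : IsScalarTower k A Y := ⟨fun c a x => by
    rw [Algebra.smul_def, mul_smul]; rfl⟩
  obtain ⟨w, hw⟩ := Module.projective_lifting_property (Dm k A' u) (swp g) (Dm_surj hu)
  refine ⟨swp w, fun x => ?_⟩
  ext p
  have := DFunLike.congr_fun (LinearMap.congr_fun hw p) x
  exact this

variable [FiniteDimensional k A'] 

lemma DD_projective (I : Type) [AddCommGroup I] [Module k I] [Module A I] [IsScalarTower k A I]
    [FiniteDimensional k I] [hI : Module.Injective A I] : Module.Projective A' (DD k I) := by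
  have : Module.Finite A' (DD k I) := Module.Finite.of_restrictScalars_finite k A' (DD k I)
  obtain ⟨r, p, hp⟩ := Module.Finite.exists_fin' A' (DD k I)
  have hj : Function.Injective (swp p) := by
    rw [← LinearMap.ker_eq_bot, LinearMap.ker_eq_bot']
    intro x hx
    refine DD.sep (k := k) fun φ => ?_
    obtain ⟨f, rfl⟩ := hp φ
    exact DFunLike.congr_fun hx f
  obtain ⟨w, hw⟩ := hI.out (swp p) hj LinearMap.id
  let e := DDe k (Fin r → A') A' A
  refine Module.Projective.of_split (e.symm.toLinearMap ∘ₗ Dm k A' w) p ?_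
  ext φ x
  show p (e.symm (Dm k A' w φ)) x = φ x
  obtain ⟨f, hf⟩ := e.surjective (Dm k A' w φ)
  rw [← hf, e.symm_apply_apply]
  have h1 : (Dm k A' w φ) (swp p x) = p f x := by rw [← hf]; rfl
  rw [← h1, Dm_apply, hw]; rfl

lemma exists_inj (X : Type) [AddCommGroup X] [Module k X] [Module A X] [IsScalarTower k A X]
    [FiniteDimensional k X] : ∃ (r : ℕ) (f : X →ₗ[A] DD k (Fin r → A')), Function.Injective f := by
  have : Module.Finite A' (DD k X) := Module.Finite.of_restrictScalars_finite k A' (DD k X)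
  obtain ⟨r, p, hp⟩ := Module.Finite.exists_fin' A' (DD k X)
  refine ⟨r, swp p, ?_⟩
  rw [← LinearMap.ker_eq_bot, LinearMap.ker_eq_bot']
  intro x hx
  refine DD.sep (k := k) fun φ => ?_
  obtain ⟨f, rfl⟩ := hp φ
  exact DFunLike.congr_fun hx f

lemma EV_dual (i : ℕ) (X Y : Type) [AddCommGroup X] [Module k X] [Module A X] [IsScalarTower k A X]
    [FiniteDimensional k X] [AddCommGroup Y] [Module k Y] [Module A Y] [IsScalarTower k A Y]
    (h : EV A Y X (i+1)) : EV A' (DD k X) (DD k Y) (i+1) := by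
  induction i generalizing X with
  | zero =>
    obtain ⟨r, f, hf⟩ := exists_inj (k := k) (A := A) (A' := A') X
    have hE : Function.Exact f (LinearMap.range f).mkQ := fun x => by simp
    have hs := Submodule.mkQ_surjective (LinearMap.range f)
    have := DD_injective (k := k) (A := A) (Fin r → A')
    have := DD_projective (k := k) (A' := A') (A := A) (DD k (Fin r → A'))
    refine EV.one_of_extend (Dm_inj (k := k) (A' := A') hs) (Dm_surj hf) (Dm_exact hE) (EV.of_proj _) ?_
    intro u
    let e := DDe k ((DD k (Fin r → A')) ⧸ LinearMap.range f) A A'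
    obtain ⟨v, hv⟩ := EV.lift hf hs hE h (e.symm.toLinearMap ∘ₗ swp u)
    refine ⟨Dm k A' v, ?_⟩
    ext φ y
    have h1 := LinearMap.congr_fun hv y
    show φ ((LinearMap.range f).mkQ (v y)) = u φ y
    have h2 : (LinearMap.range f).mkQ (v y) = e.symm (swp u y) := h1
    rw [h2]
    have h3 : e (e.symm (swp u y)) φ = u φ y := by rw [e.apply_symm_apply]; rfl
    exact h3
  | succ i ih =>
    obtain ⟨r, f, hf⟩ := exists_inj (k := k) (A := A) (A' := A') X
    have hE : Function.Exact f (LinearMap.range f).mkQ := fun x => by simp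
    have hs := Submodule.mkQ_surjective (LinearMap.range f)
    have := DD_injective (k := k) (A := A) (Fin r → A')
    have := DD_projective (k := k) (A' := A') (A := A) (DD k (Fin r → A'))
    have h1 := EV.codown hf hs hE (EV.of_inj i) h
    exact EV.up (Dm_inj (k := k) (A' := A') hs) (Dm_surj hf) (Dm_exact hE) (EV.of_proj _) (ih _ h1)
end inj
end QP
end

set_option linter.unusedSectionVars false
noncomputable section
namespace QP
open CategoryTheory Abelian Paper

section inj
variable {k A A' : Type} [Field k] [Ring A] [Ring A'] [Algebra k A] [Algebra k A'] [IsOp k A' A]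
  [IsOp k A A'] [OpCompat k A A'] [FiniteDimensional k A] [FiniteDimensional k A']
  {X : Type} [AddCommGroup X] [Module k X] [Module A X] [IsScalarTower k A X] [FiniteDimensional k X]

lemma noeth (k A : Type) [Field k] [Ring A] [Algebra k A] [FiniteDimensional k A] : IsNoetherianRing A :=
  IsNoetherianRing.of_finite k A

lemma fd_of_fg (k : Type) {A : Type} [Field k] [Ring A] [Algebra k A] [FiniteDimensional k A] (X : Type)
    [AddCommGroup X] [Module k X] [Module A X] [IsScalarTower k A X] [Module.Finite A X] :
    FiniteDimensional k X := Module.Finite.trans A X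

lemma fg_of_fd (k : Type) {A : Type} [Field k] [Ring A] [Algebra k A] (X : Type)
    [AddCommGroup X] [Module k X] [Module A X] [IsScalarTower k A X] [FiniteDimensional k X] :
    Module.Finite A X := Module.Finite.of_restrictScalars_finite k A X

lemma id_pd (n : ℕ) : idLE A (ModuleCat.of A X) n ↔ pdLE A' (ModuleCat.of A' (DD k X)) n := by
  have := noeth k A
  have := noeth k A'
  have hX : Module.Finite A X := fg_of_fd k X
  have hX' : Module.Finite A' (DD k X) := fg_of_fd k _
  constructor
  · intro h
    refine (pdF_of_EV (X := ModuleCat.of A' (DD k X)) (hX := hX') fun Y hY => ?_).pdLE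
    have := fd_of_fg k (A := A') Y
    refine EV.coequiv (DDe k Y A' A) ?_
    exact EV_dual n X (DD k Y) (id_EV h (DD k Y) 0)
  · intro h
    refine id_of_EV (fun Y hY => ?_) (X := ModuleCat.of A X) (hX := hX) fun Y hY => ?_
    · have := fd_of_fg k (A := A) Y
      obtain ⟨r, f, hf⟩ := exists_inj (k := k) (A := A) (A' := A') Y
      exact ⟨ModuleCat.of A (DD k (Fin r → A')), f, DD_injective (k := k) (A := A) (Fin r → A'),
        fg_of_fd k (DD k (Fin r → A')), hf⟩
    · have := fd_of_fg k (A := A) Y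
      refine EV.coequiv (DDe k X A A') (EV.equiv (DDe k Y A A') ?_)
      exact EV_dual n (DD k Y) (DD k X) (pd_EV h (DD k Y) 0)

lemma DC_dual {B B' Q : Type} [Ring B] [Ring B'] [Algebra k B] [Algebra k B'] [IsOp k B' B]
    [IsOp k B B'] [OpCompat k B B'] [AddCommGroup Q] [Module k Q] [Module A Q] [IsScalarTower k A Q]
    [FiniteDimensional k Q] [Module B Q] [IsScalarTower k B Q] [SMulCommClass A B Q]
    [SMulCommClass B A Q] (h : DC A B Q) : DC A' B' (DD k Q) := by
  constructor
  · intro φ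
    let e := DDe k Q B B'
    obtain ⟨a, ha⟩ := h.1 (e.symm.toLinearMap ∘ₗ Dm k B φ ∘ₗ e.toLinearMap)
    obtain ⟨b, rfl⟩ := ou_surj (k := k) (A' := A') a
    refine ⟨b, fun f => ?_⟩
    ext q
    have h1 : e.symm (Dm k B φ (e q)) = ou k b • q := ha q
    rw [LinearEquiv.symm_apply_eq] at h1
    exact DFunLike.congr_fun h1 f
  · intro a ha
    apply ou_inj (k := k)
    rw [ou_zero]
    refine h.2 _ fun q => DD.sep (k := k) fun φ => ?_
    exact DFunLike.congr_fun (ha φ) q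

end inj

section res
variable {k A A' : Type} [Field k] [Ring A] [Ring A'] [Algebra k A] [Algebra k A'] [IsOp k A' A]
  [IsOp k A A'] [OpCompat k A A'] 
  {Q : Type} [AddCommGroup Q] [Module k Q] [Module A Q] [IsScalarTower k A Q] [FiniteDimensional k Q]

lemma Add.fd {X : Type} [AddCommGroup X] [Module k X] [Module A X] [IsScalarTower k A X]
    (h : Add A Q X) : FiniteDimensional k X := by
  obtain ⟨n, s, r, hsr⟩ := h
  exact Module.Finite.of_surjective (r.restrictScalars k) (fun x => ⟨s x, LinearMap.congr_fun hsr x⟩)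

lemma fd_inj {X Y : Type} [AddCommGroup X] [Module k X] [Module A X] [IsScalarTower k A X]
    [AddCommGroup Y] [Module k Y] [Module A Y] [IsScalarTower k A Y] [FiniteDimensional k Y]
    (f : X →ₗ[A] Y) (hf : Function.Injective f) : FiniteDimensional k X :=
  Module.Finite.of_injective (f.restrictScalars k) hf

lemma fd_surj {X Y : Type} [AddCommGroup X] [Module k X] [Module A X] [IsScalarTower k A X]
    [AddCommGroup Y] [Module k Y] [Module A Y] [IsScalarTower k A Y] [FiniteDimensional k Y]
    (f : Y →ₗ[A] X) (hf : Function.Surjective f) : FiniteDimensional k X :=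
  Module.Finite.of_surjective (f.restrictScalars k) hf

lemma resD (m : ℕ) (Y : Type) [AddCommGroup Y] [Module k Y] [Module A Y] [IsScalarTower k A Y]
    [FiniteDimensional k Y]
    (h : ResLE A (ModuleCat.of A Q) (InAdd A (ModuleCat.of A Q)) (ModuleCat.of A Y) m) :
    CoresLE A' (ModuleCat.of A' (DD k Q)) (InAdd A' (ModuleCat.of A' (DD k Q)))
      (ModuleCat.of A' (DD k Y)) m := by
  induction m generalizing Y with
  | zero =>
    obtain ⟨P, hP, ⟨e⟩⟩ := (resLE_zero_iff _ _ _).1 h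
    have hY : Add A Q Y := Add.equiv e.symm hP
    exact (coresLE_zero_iff _ _ _).2 ⟨ModuleCat.of A' (DD k Y), hY.DD, ⟨LinearEquiv.refl _ _⟩⟩
  | succ m ih =>
    obtain ⟨K, P, f, p, hP, hf, hp, hfp, hl, hK⟩ := (resLE_succ_iff _ _ _ _).1 h
    have hP' : Add A Q P := hP
    have : FiniteDimensional k P := hP'.fd
    have : FiniteDimensional k K := fd_inj f hf
    let p' : P →ₗ[A] Y := p
    refine (coresLE_succ_iff _ _ _ _).2 ⟨ModuleCat.of A' (DD k K), ModuleCat.of A' (DD k P),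
      Dm k A' p', Dm k A' f, hP'.DD, Dm_inj hp, Dm_surj hf, Dm_exact hfp, fun u => ?_, ih K hK⟩
    let u' : DD k Y →ₗ[A'] DD k Q := u
    let e := DDe k Y A A'
    obtain ⟨v, hv⟩ := hl (e.symm.toLinearMap ∘ₗ swp u')
    let v' : Q →ₗ[A] P := v
    refine ⟨Dm k A' v', ?_⟩
    refine LinearMap.ext fun φ => DD.ext fun q => ?_
    have h1 : p' (v' q) = e.symm (swp u' q) := LinearMap.congr_fun hv q
    show φ (p' (v' q)) = u' φ q
    rw [h1]
    have h3 : e (e.symm (swp u' q)) φ = u' φ q := by rw [e.apply_symm_apply]; rfl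
    exact h3

lemma coresD (m : ℕ) (Y : Type) [AddCommGroup Y] [Module k Y] [Module A Y] [IsScalarTower k A Y]
    (h : CoresLE A (ModuleCat.of A Q) (InAdd A (ModuleCat.of A Q)) (ModuleCat.of A Y) m) :
    ResLE A' (ModuleCat.of A' (DD k Q)) (InAdd A' (ModuleCat.of A' (DD k Q)))
      (ModuleCat.of A' (DD k Y)) m := by
  induction m generalizing Y with
  | zero =>
    obtain ⟨P, hP, ⟨e⟩⟩ := (coresLE_zero_iff _ _ _).1 h
    have hY : Add A Q Y := Add.equiv e hP
    exact (resLE_zero_iff _ _ _).2 ⟨ModuleCat.of A' (DD k Y), hY.DD, ⟨LinearEquiv.refl _ _⟩⟩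
  | succ m ih =>
    obtain ⟨K, P, f, p, hP, hf, hp, hfp, hl, hK⟩ := (coresLE_succ_iff _ _ _ _).1 h
    have hP' : Add A Q P := hP
    let f' : Y →ₗ[A] P := f
    refine (resLE_succ_iff _ _ _ _).2 ⟨ModuleCat.of A' (DD k K), ModuleCat.of A' (DD k P),
      Dm k A' p, Dm k A' f', hP'.DD, Dm_inj hp, Dm_surj hf, Dm_exact hfp, fun u => ?_, ih K hK⟩
    let u' : DD k Q →ₗ[A'] DD k Y := u
    let e := DDe k Q A A'
    obtain ⟨v, hv⟩ := hl (e.symm.toLinearMap ∘ₗ swp u')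
    let v' : P →ₗ[A] Q := v
    refine ⟨Dm k A' v', ?_⟩
    refine LinearMap.ext fun φ => DD.ext fun q => ?_
    have h1 : v' (f' q) = e.symm (swp u' q) := LinearMap.congr_fun hv q
    show φ (v' (f' q)) = u' φ q
    rw [h1]
    have h3 : e (e.symm (swp u' q)) φ = u' φ q := by rw [e.apply_symm_apply]; rfl
    exact h3

lemma resLE_test {A : Type} [Ring A] {Q Q' : Type} [AddCommGroup Q] [Module A Q] [AddCommGroup Q']
    [Module A Q'] (e : Q ≃ₗ[A] Q') {X : ModuleCat.{0} A} {m : ℕ}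
    (h : ResLE A (ModuleCat.of A Q) (InAdd A (ModuleCat.of A Q)) X m) :
    ResLE A (ModuleCat.of A Q') (InAdd A (ModuleCat.of A Q')) X m := by
  induction m generalizing X with
  | zero =>
    obtain ⟨P, hP, he⟩ := (resLE_zero_iff _ _ _).1 h
    exact (resLE_zero_iff _ _ _).2 ⟨P, Add.test_equiv e.symm hP, he⟩
  | succ m ih =>
    obtain ⟨K, P, f, p, hP, hf, hp, hfp, hl, hK⟩ := (resLE_succ_iff _ _ _ _).1 h
    refine (resLE_succ_iff _ _ _ _).2 ⟨K, P, f, p, Add.test_equiv e.symm hP, hf, hp, hfp, fun u => ?_, ih hK⟩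
    let u' : Q' →ₗ[A] X := u
    obtain ⟨v, hv⟩ := hl (u' ∘ₗ e.toLinearMap)
    let v' : Q →ₗ[A] P := v
    refine ⟨v' ∘ₗ e.symm.toLinearMap, LinearMap.ext fun x => ?_⟩
    have : p (v' (e.symm x)) = u' (e (e.symm x)) := LinearMap.congr_fun hv (e.symm x)
    rw [e.apply_symm_apply] at this
    exact this

lemma coresLE_test {A : Type} [Ring A] {Q Q' : Type} [AddCommGroup Q] [Module A Q] [AddCommGroup Q']
    [Module A Q'] (e : Q ≃ₗ[A] Q') {X : ModuleCat.{0} A} {m : ℕ}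
    (h : CoresLE A (ModuleCat.of A Q) (InAdd A (ModuleCat.of A Q)) X m) :
    CoresLE A (ModuleCat.of A Q') (InAdd A (ModuleCat.of A Q')) X m := by
  induction m generalizing X with
  | zero =>
    obtain ⟨P, hP, he⟩ := (coresLE_zero_iff _ _ _).1 h
    exact (coresLE_zero_iff _ _ _).2 ⟨P, Add.test_equiv e.symm hP, he⟩
  | succ m ih =>
    obtain ⟨K, P, f, p, hP, hf, hp, hfp, hl, hK⟩ := (coresLE_succ_iff _ _ _ _).1 h
    refine (coresLE_succ_iff _ _ _ _).2 ⟨K, P, f, p, Add.test_equiv e.symm hP, hf, hp, hfp, fun u => ?_, ih hK⟩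
    let u' : X →ₗ[A] Q' := u
    obtain ⟨v, hv⟩ := hl (e.symm.toLinearMap ∘ₗ u')
    let v' : P →ₗ[A] Q := v
    refine ⟨e.toLinearMap ∘ₗ v', LinearMap.ext fun x => ?_⟩
    have : v' (f x) = e.symm (u' x) := LinearMap.congr_fun hv x
    show e (v' (f x)) = u' x
    rw [this, e.apply_symm_apply]

end res
end QP
end

set_option linter.unusedSectionVars false
noncomputable section
namespace QP
open CategoryTheory Abelian Paper

section FT
variable {A B Q : Type} [Ring A] [Ring B] [AddCommGroup Q] [Module A Q] [Module B Q]
  [SMulCommClass A B Q] [SMulCommClass B A Q]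
  {G0 G1 T : Type} [AddCommGroup G0] [Module B G0] [AddCommGroup G1] [Module B G1]
  [AddCommGroup T] [Module B T]
  {V : Type} [AddCommGroup V] [Module A V]
  {h : G0 →ₗ[B] G1} {c : G1 →ₗ[B] T} {δ : (G0 →ₗ[B] Q) →ₗ[A] V}
  (hG0 : Add B B G0) (hG1 : Add B B G1) (hc : Function.Surjective c) (hhc : Function.Exact h c)
  (hδ : Function.Surjective δ) (hex : Function.Exact (dm B A Q h) δ)

include hc hhc in
lemma ft_ses1 : Function.Exact (dm B A Q c) (dm B A Q h).rangeRestrict := by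
  intro x
  rw [← dm_exact hc hhc x]
  exact ⟨fun h => congrArg Subtype.val h, fun h => Subtype.ext h⟩

include hex in
lemma ft_ses2 : Function.Exact (LinearMap.range (dm B A Q h)).subtype δ := by
  intro x
  rw [hex x]
  simp

include hG0 hG1 hc hhc hδ hex

lemma ft_ev {Y : Type} [AddCommGroup Y] [Module A Y] (i : ℕ) (hY : ∀ s, EV A Q Y (i+s+1)) :
    (EV A (T →ₗ[B] Q) Y (i+1) ↔ EV A (LinearMap.range (dm B A Q h)) Y (i+2)) ∧
    (EV A (LinearMap.range (dm B A Q h)) Y (i+1) ↔ EV A V Y (i+2)) := by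
  have a0 : ∀ s, EV A (G0 →ₗ[B] Q) Y (i+s+1) := fun s => (hY s).add (dualProj hG0)
  have a1 : ∀ s, EV A (G1 →ₗ[B] Q) Y (i+s+1) := fun s => (hY s).add (dualProj hG1)
  refine ⟨⟨fun hT => ?_, fun hV => ?_⟩, ⟨fun hT => ?_, fun hV => ?_⟩⟩
  · exact EV.up (dm_inj hc) (LinearMap.surjective_rangeRestrict _) (ft_ses1 hc hhc) (a1 1) hT
  · exact EV.down (dm_inj hc) (LinearMap.surjective_rangeRestrict _) (ft_ses1 hc hhc) (a1 0) hV
  · exact EV.up (Submodule.subtype_injective _) hδ (ft_ses2 hex) (a0 1) hT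
  · exact EV.down (Submodule.subtype_injective _) hδ (ft_ses2 hex) (a0 0) hV

lemma ft_ev' {Y : Type} [AddCommGroup Y] [Module A Y] (i : ℕ) (hY : ∀ s, EV A Q Y (i+s+1)) :
    EV A (T →ₗ[B] Q) Y (i+1) ↔ EV A V Y (i+3) :=
  (ft_ev hG0 hG1 hc hhc hδ hex i hY).1.trans
    (ft_ev hG0 hG1 hc hhc hδ hex (i+1) (fun s => by
      have := hY (s+1)
      rwa [show i + (s+1) + 1 = i + 1 + s + 1 by omega] at this)).2

lemma ft_refl (hB : DC B A Q) (hQ : ∀ s, EV A Q Q (s+1)) (h1 : EV A V Q 1) (h2 : EV A V Q 2) :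
    Refl B A Q T := by
  have hI : EV A (LinearMap.range (dm B A Q h)) Q 1 :=
    (ft_ev hG0 hG1 hc hhc hδ hex 0 (fun s => by simpa using hQ s)).2.2 h2
  have hR0 : Refl B A Q G0 := hB.refl.add hG0
  have hR1 : Refl B A Q G1 := hB.refl.add hG1
  constructor
  · rw [← LinearMap.ker_eq_bot, LinearMap.ker_eq_bot']
    intro t ht
    obtain ⟨y, rfl⟩ := hc t
    -- factor `ev y` through the range
    have hk : LinearMap.ker (dm B A Q h).rangeRestrict ≤ LinearMap.ker (evm B A Q G1 y) := by
      intro x hx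
      obtain ⟨f, rfl⟩ := (ft_ses1 hc hhc x).1 hx
      exact LinearMap.congr_fun ht f
    let w : LinearMap.range (dm B A Q h) →ₗ[A] Q :=
      (LinearMap.ker (dm B A Q h).rangeRestrict).liftQ (evm B A Q G1 y) hk ∘ₗ
        ((dm B A Q h).rangeRestrict.quotKerEquivOfSurjective
          (LinearMap.surjective_rangeRestrict _)).symm.toLinearMap
    have hw : ∀ x, w ((dm B A Q h).rangeRestrict x) = x y := by
      intro x
      have : ((dm B A Q h).rangeRestrict.quotKerEquivOfSurjective
          (LinearMap.surjective_rangeRestrict _)).symm ((dm B A Q h).rangeRestrict x)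
          = Submodule.Quotient.mk x := by
        rw [LinearEquiv.symm_apply_eq]; rfl
      show (LinearMap.ker (dm B A Q h).rangeRestrict).liftQ (evm B A Q G1 y) hk
        (((dm B A Q h).rangeRestrict.quotKerEquivOfSurjective
          (LinearMap.surjective_rangeRestrict _)).symm ((dm B A Q h).rangeRestrict x)) = _
      rw [this]; rfl
    obtain ⟨v, hv⟩ := EV.extend (Submodule.subtype_injective _) hδ (ft_ses2 hex) h1 w
    obtain ⟨z, rfl⟩ := hR0.2 v
    have : y = h z := hR1.1 (by
      ext x
      have e1 := LinearMap.congr_fun hv ((dm B A Q h).rangeRestrict x)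
      have e2 := hw x
      rw [← e1] at e2
      exact e2.symm)
    rw [this]
    exact hhc.apply_apply_eq_zero z
  · intro Ψ
    obtain ⟨w, hw⟩ := EV.extend (dm_inj hc) (LinearMap.surjective_rangeRestrict _) (ft_ses1 hc hhc) hI Ψ
    obtain ⟨y, rfl⟩ := hR1.2 w
    exact ⟨c y, by rw [← hw]; ext f; rfl⟩

lemma ft_1 (hA : DC A B Q) {l : ℕ} (hQ : pdLE A (ModuleCat.of A Q) l)
    (hT : CoresLE B (ModuleCat.of B Q) (InAdd B (ModuleCat.of B Q)) (ModuleCat.of B T) l)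
    (Y : Type) [AddCommGroup Y] [Module A Y] (s : ℕ) : EV A V Y (l + s + 3) := by
  obtain ⟨h1, -, -⟩ := CLa hA hT
  refine (ft_ev' hG0 hG1 hc hhc hδ hex (l+s) (fun t => ?_)).1 (pd_EV h1 Y s)
  have := pd_EV hQ Y (s+t)
  rwa [← add_assoc] at this

lemma ft_2 [IsNoetherianRing A] (hA : DC A B Q) (hB : DC B A Q) {l : ℕ} (hQ : pdLE A (ModuleCat.of A Q) l)
    (hQQ : ∀ s, EV A Q Q (s+1)) (hV : ∀ s, EV A V Q (s+1))
    (hf : Module.Finite A (T →ₗ[B] Q))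
    (hVY : ∀ (Y : Type) [AddCommGroup Y] [Module A Y], EV A V Y (l + 3)) :
    CoresLE B (ModuleCat.of B Q) (InAdd B (ModuleCat.of B Q)) (ModuleCat.of B T) l := by
  have hR := ft_refl hG0 hG1 hc hhc hδ hex hB hQQ (hV 0) (hV 1)
  have h1 : pdF A (ModuleCat.of A (T →ₗ[B] Q)) l := pdF_of_EV (hX := hf) fun Y _ =>
    (ft_ev' hG0 hG1 hc hhc hδ hex l (fun t => pd_EV hQ Y t)).2 (hVY Y)
  have h2 := CLb hA h1 (fun i => (ft_ev' hG0 hG1 hc hhc hδ hex i (fun t => hQQ _)).2 (hV _)) hR.dual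
  exact coresLE_equiv (X := ModuleCat.of B ((T →ₗ[B] Q) →ₗ[A] Q)) (Y := ModuleCat.of B T)
    (LinearEquiv.ofBijective _ hR).symm h2

end FT
end QP
end

set_option linter.unusedSectionVars false
set_option linter.style.haveILetI false
noncomputable section
namespace QP
open CategoryTheory Abelian Paper

/-- not necessarily minimal syzygies -/
def Om (B : Type) [Ring B] : ℕ → ModuleCat.{0} B → ModuleCat.{0} B → Prop
  | 0, X, Z => Nonempty (Z ≃ₗ[B] X)
  | (t+1), X, Z => ∃ (Y P : ModuleCat.{0} B) (f : Y →ₗ[B] P) (p : P →ₗ[B] X), Add B B P ∧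
      Function.Injective f ∧ Function.Surjective p ∧ Function.Exact f p ∧ Om B t Y Z

section HB
variable (k : Type) [Field k] (B1 : Type) {B2 : Type} [Ring B1] [Ring B2] [Algebra k B1] [Algebra k B2]
  [IsOp k B1 B2]

/-- `Hom(P, B)` -/
def HB (B2 P : Type) [Ring B2] [AddCommGroup P] [Module B2 P] : Type := P →ₗ[B2] B2

variable (P : Type) [AddCommGroup P] [Module B2 P]

instance : AddCommGroup (HB B2 P) := inferInstanceAs (AddCommGroup (P →ₗ[B2] B2))
instance : FunLike (HB B2 P) P B2 := inferInstanceAs (FunLike (P →ₗ[B2] B2) P B2)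
instance : LinearMapClass (HB B2 P) B2 P B2 := inferInstanceAs (LinearMapClass (P →ₗ[B2] B2) B2 P B2)

variable {P}
@[ext] lemma HB.ext {f g : HB B2 P} (h : ∀ x, f x = g x) : f = g := LinearMap.ext h
@[simp] lemma HB.add_apply (f g : HB B2 P) (x : P) : (f + g) x = f x + g x := rfl
lemma HB.sum_apply {n : ℕ} (f : Fin n → HB B2 P) (x : P) : (∑ i, f i) x = ∑ i, f i x :=
  LinearMap.sum_apply (R := B2) (M := P) (M₂ := B2) Finset.univ f x

variable (P) in
/-- the module structure on `HB` -/
@[reducible] def HBmod : Module B1 (HB B2 P) :=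
  @Module.compHom B2ᵐᵒᵖ B1 (P →ₗ[B2] B2) _ _ _ _
    ((IsOp.o (k := k) (A' := B1) (A := B2)).toRingEquiv.toRingHom)

lemma HBsmul (b : B1) (f : HB B2 P) (p : P) :
    letI := HBmod k B1 P
    (b • f) p = f p * ou k b := rfl

end HB

section HB2
variable (k : Type) [Field k] {B1 : Type} {B2 : Type} [Ring B1] [Ring B2] [Algebra k B1] [Algebra k B2]
  [IsOp k B1 B2] {P P' : Type} [AddCommGroup P] [Module B2 P] [AddCommGroup P'] [Module B2 P']

variable (B1) in
/-- functoriality of `HB` -/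
def HBm (g : P →ₗ[B2] P') :
    letI := HBmod k B1 P; letI := HBmod k B1 P'
    HB B2 P' →ₗ[B1] HB B2 P :=
  letI := HBmod k B1 P; letI := HBmod k B1 P'
  { toFun := fun f => (f : P' →ₗ[B2] B2) ∘ₗ g
    map_add' := fun _ _ => rfl
    map_smul' := fun _ _ => rfl }

lemma HB_add (h : Add B2 B2 P) :
    letI := HBmod k B1 P
    Add B1 B1 (HB B2 P) := by
  letI := HBmod k B1 P
  obtain ⟨n, s, r, hsr⟩ := h
  let o := (IsOp.o (k := k) (A' := B1) (A := B2))
  let S : HB B2 P →ₗ[B1] (Fin n → B1) :=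
    { toFun := fun f i => o.symm (op (f (r (Pi.single i 1))))
      map_add' := fun f g => by ext i; simp
      map_smul' := fun b f => by
        ext i
        apply o.injective
        simp only [HBsmul, Pi.smul_apply, smul_eq_mul, map_mul, AlgEquiv.apply_symm_apply,
          RingHom.id_apply]
        rfl }
  let R : (Fin n → B1) →ₗ[B1] HB B2 P :=
    { toFun := fun v => ({ toFun := fun p => ∑ i, s p i * ou k (v i)
                           map_add' := fun x y => by
                            simp [add_mul, Finset.sum_add_distrib]
                           map_smul' := fun b x => by
                            simp [Finset.mul_sum, mul_assoc] } : P →ₗ[B2] B2)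
      map_add' := fun v w => by
        ext p
        show ∑ i, s p i * ou k (v i + w i) = ∑ i, s p i * ou k (v i) + ∑ i, s p i * ou k (w i)
        simp [ou_add, mul_add, Finset.sum_add_distrib]
      map_smul' := fun b v => by
        ext p
        show ∑ i, s p i * ou k (b * v i) = (∑ i, s p i * ou k (v i)) * ou k b
        simp [ou_mul, Finset.sum_mul, mul_assoc] }
  refine ⟨n, S, R, ?_⟩
  ext f p
  show ∑ i, s p i * ou k (o.symm (op (f (r (Pi.single i 1))))) = f p
  have h1 : ∀ i, ou k (o.symm (op (f (r (Pi.single i 1))))) = f (r (Pi.single i 1)) := fun i => by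
    simp [ou, o]
  have h2 : r (s p) = p := LinearMap.congr_fun hsr p
  conv_rhs => rw [← h2, pi_eq_sum_univ' (s p)]
  simp only [h1, map_sum]
  refine Finset.sum_congr rfl fun i _ => ?_
  rw [map_smul r]
  exact (map_smul f (s p i) _).symm

end HB2

section main
variable {k A1 A2 B1 B2 Q : Type} [Field k] [Ring A1] [Ring A2] [Ring B1] [Ring B2]
  [Algebra k A1] [Algebra k A2] [Algebra k B1] [Algebra k B2]
  [IsOp k A1 A2] [IsOp k A2 A1] [OpCompat k A1 A2] [IsOp k B1 B2] [IsOp k B2 B1] [OpCompat k B1 B2]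
  [AddCommGroup Q] [Module k Q] [Module A2 Q] [Module B2 Q] [IsScalarTower k A2 Q] [IsScalarTower k B2 Q]
  [SMulCommClass A2 B2 Q] [SMulCommClass B2 A2 Q] [FiniteDimensional k Q]

lemma shift (t : ℕ) (X Z : ModuleCat.{0} B2) (hX : ∀ s < t, EV B2 X Q (s+1)) (hZ : Om B2 t X Z)
    (i : ℕ) (Y : Type) [AddCommGroup Y] [Module A1 Y] (hY : ∀ s, EV A1 (DD k Q) Y (i+s+1)) :
    EV A1 (DD k (Z →ₗ[B2] Q)) Y (i+1) ↔ EV A1 (DD k (X →ₗ[B2] Q)) Y (i+t+1) := by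
  induction t generalizing X with
  | zero =>
    obtain ⟨e⟩ := hZ
    let e1 : DD k (Z →ₗ[B2] Q) ≃ₗ[A1] DD k (X →ₗ[B2] Q) := (Dme k A1 (dme B2 A2 Q e.symm)).symm
    exact ⟨fun h => EV.equiv e1.symm h, fun h => EV.equiv e1 h⟩
  | succ t ih =>
    obtain ⟨K, P, f, p, hP, hf, hp, hfp, hZ⟩ := hZ
    have hpr : Module.Projective B2 P := hP.proj
    have h1 := ih K (fun s hs => EV.down hf hp hfp (EV.of_proj _) (hX (s+1) (by omega))) hZ
    rw [h1]
    have hs : Function.Surjective (dm B2 A2 Q f) := fun u => EV.extend hf hp hfp (hX 0 (by omega)) u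
    have d1 := Dm_inj (k := k) (A' := A1) hs
    have d2 := Dm_surj (k := k) (A' := A1) (dm_inj (A := B2) (B := A2) (Q := Q) hp)
    have d3 := Dm_exact (k := k) (A' := A1) (dm_exact (A := B2) (B := A2) (Q := Q) hp hfp)
    have hPa : Add A1 (DD k Q) (DD k (P →ₗ[B2] Q)) := Add.DD (dualProj hP)
    constructor
    · intro h
      refine EV.up d1 d2 d3 ?_ h
      have := hY (t+1)
      exact EV.add this hPa
    · intro h
      refine EV.down d1 d2 d3 ?_ h
      have := hY t
      exact EV.add this hPa

variable {P : Type} [AddCommGroup P] [Module B2 P]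

variable (k A1 B1 P Q) in
/-- the comparison map -/
def eta : letI := HBmod k B1 P
    DD k (P →ₗ[B2] Q) →ₗ[A1] (HB B2 P →ₗ[B1] DD k Q) :=
  letI := HBmod k B1 P
  { toFun := fun φ =>
     { toFun := fun f =>
        ({ toFun := fun q => φ ((LinearMap.toSpanSingleton B2 Q q) ∘ₗ (f : P →ₗ[B2] B2))
           map_add' := fun x y => by
            rw [← map_add]; congr 1; ext p
            exact smul_add (f p) x y
           map_smul' := fun c x => by
            rw [← map_smul φ]; congr 1; ext p
            show f p • c • x = c • f p • x
            rw [smul_algebra_smul_comm] } : Q →ₗ[k] k)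
       map_add' := fun f g => by
        ext q
        show φ _ = φ _ + φ _
        rw [← map_add]; congr 1; ext p
        show (f p + g p) • q = f p • q + g p • q
        rw [add_smul]
       map_smul' := fun b f => by
        ext q
        show φ _ = φ _
        congr 1; ext p
        show (f p * ou k b) • q = f p • ou k b • q
        rw [mul_smul] }
    map_add' := fun φ ψ => rfl
    map_smul' := fun a φ => by
      ext f q
      show φ _ = φ _
      congr 1; ext p
      show ou k a • f p • q = f p • ou k a • q
      rw [smul_comm] }

lemma eta_bij (h : Add B2 B2 P) : Function.Bijective (eta k A1 B1 Q P) := by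
  letI := HBmod k B1 P
  obtain ⟨n, s, r, hsr⟩ := h
  have h2 : ∀ p, r (s p) = p := LinearMap.congr_fun hsr
  let c : Fin n → HB B2 P := fun i => (LinearMap.proj i ∘ₗ s : P →ₗ[B2] B2)
  let x : Fin n → P := fun i => r (Pi.single i 1)
  have hcx : ∀ p, ∑ i, c i p • x i = p := fun p => by
    conv_rhs => rw [← h2 p, pi_eq_sum_univ' (s p)]
    simp only [map_sum, map_smul r]
    rfl
  constructor
  · rw [← LinearMap.ker_eq_bot, LinearMap.ker_eq_bot']
    intro φ hφ
    ext u
    have hu : u = ∑ i, (LinearMap.toSpanSingleton B2 Q (u (x i))) ∘ₗ (c i : P →ₗ[B2] B2) := by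
      ext p
      conv_lhs => rw [← hcx p]
      simp only [map_sum, map_smul u, LinearMap.sum_apply]
      rfl
    rw [hu, map_sum]
    refine Finset.sum_eq_zero fun i _ => ?_
    exact DFunLike.congr_fun (LinearMap.congr_fun hφ (c i)) (u (x i))
  · intro F
    refine ⟨({ toFun := fun u => ∑ i, F (c i) (u (x i))
               map_add' := fun u v => by simp [Finset.sum_add_distrib]
               map_smul' := fun a u => by
                simp only [LinearMap.smul_apply, RingHom.id_apply, Finset.smul_sum]
                exact Finset.sum_congr rfl fun i _ => map_smul (F (c i)) a _ } : (P →ₗ[B2] Q) →ₗ[k] k), ?_⟩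
    ext f q
    show ∑ i, F (c i) (f (x i) • q) = F f q
    choose b hb using fun i => ou_surj (k := k) (A' := B1) (f (x i))
    have hf : f = ∑ i, b i • c i := by
      ext p
      rw [HB.sum_apply]
      conv_lhs => rw [← hcx p]
      rw [map_sum]
      refine Finset.sum_congr rfl fun i _ => ?_
      rw [HBsmul, hb]
      exact map_smul f _ _
    conv_rhs => rw [hf]
    rw [map_sum]
    have key : ∀ (F : Fin n → DD k Q) (x : Q), (∑ i, F i) x = ∑ i, F i x := fun F x =>
      LinearMap.sum_apply (R := k) (M := Q) (M₂ := k) Finset.univ F x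
    rw [key]
    refine Finset.sum_congr rfl fun i _ => ?_
    rw [map_smul F, DD.smul_apply, hb]

variable {P1 P0 Z : ModuleCat.{0} B2} {g : P1 →ₗ[B2] P0} {p : P0 →ₗ[B2] Z}

/-- the data for `ft` -/
lemma exists_delta (h0 : Add B2 B2 P0) (h1 : Add B2 B2 P1) (hp : Function.Surjective p)
    (hgp : Function.Exact g p) :
    letI := HBmod k B1 P0
    letI := HBmod k B1 P1
    ∃ δ : (HB B2 P0 →ₗ[B1] DD k Q) →ₗ[A1] DD k (Z →ₗ[B2] Q), Function.Surjective δ ∧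
      Function.Exact (dm B1 A1 (DD k Q) (HBm k B1 g)) δ := by
  letI := HBmod k B1 P0
  letI := HBmod k B1 P1
  let e0 := LinearEquiv.ofBijective (eta k A1 B1 Q P0) (eta_bij h0)
  have d2 : Function.Surjective (Dm k A1 (dm B2 A2 Q p)) := fun φ => by
    obtain ⟨ψ, hψ⟩ := Dm_surj (k := k) (A' := A1) (dm_inj (A := B2) (B := A2) (Q := Q) hp) φ
    exact ⟨ψ, hψ⟩
  have d3 := Dm_exact (k := k) (A' := A1) (dm_exact (A := B2) (B := A2) (Q := Q) hp hgp)
  refine ⟨Dm k A1 (dm B2 A2 Q p) ∘ₗ e0.symm.toLinearMap, ?_, ?_⟩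
  · intro y
    obtain ⟨x, rfl⟩ := d2 y
    exact ⟨e0 x, by simp⟩
  · intro x
    obtain ⟨x, rfl⟩ := e0.surjective x
    have h3 : (Dm k A1 (dm B2 A2 Q p) ∘ₗ e0.symm.toLinearMap) (e0 x) = Dm k A1 (dm B2 A2 Q p) x := by
      simp
    rw [h3, d3 x]
    constructor
    · rintro ⟨y, rfl⟩
      exact ⟨eta k A1 B1 Q P1 y, rfl⟩
    · rintro ⟨y, hy⟩
      obtain ⟨y, rfl⟩ := (eta_bij (k := k) (A1 := A1) (A2 := A2) (B1 := B1) (Q := Q) h1).2 y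
      exact ⟨y, e0.injective hy⟩

section fin
variable (h0 : Add B2 B2 P0) (h1 : Add B2 B2 P1) (hp : Function.Surjective p)
    (hgp : Function.Exact g p) (T : ModuleCat.{0} B1)
    (hT : letI := HBmod k B1 P0
      letI := HBmod k B1 P1
      Nonempty (T ≃ₗ[B1] HB B2 P1 ⧸ LinearMap.range (HBm k B1 g)))
    {n l : ℕ} (hl : l + 2 ≤ n) (hQQ : ∀ s, s + 2 < n → EV B2 Q Q (s+1))
    (hZ : Om B2 (n - l - 2) (ModuleCat.of B2 Q) Z)
    (hpd : pdLE A1 (ModuleCat.of A1 (DD k Q)) l)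
    (hA : DC A1 B1 (DD k Q))

include h0 h1 hp hgp hT hl hQQ hZ hpd hA

lemma main_1 (hTc : CoresLE B1 (ModuleCat.of B1 (DD k Q)) (InAdd B1 (ModuleCat.of B1 (DD k Q))) T l)
    (Y : Type) [AddCommGroup Y] [Module A1 Y] (s : ℕ) : EV A1 (DD k (Q →ₗ[B2] Q)) Y (n + s + 1) := by
  letI := HBmod k B1 P0
  letI := HBmod k B1 P1
  obtain ⟨e⟩ := hT
  obtain ⟨δ, hδ, hex⟩ := exists_delta (k := k) (A1 := A1) (A2 := A2) (B1 := B1) (Q := Q) h0 h1 hp hgp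
  have hE : Function.Exact (HBm k B1 g) (LinearMap.range (HBm k B1 g)).mkQ := fun x => by simp
  have hs := Submodule.mkQ_surjective (LinearMap.range (HBm k B1 g))
  have hTc' := coresLE_equiv (X := T) (Y := ModuleCat.of B1 (HB B2 P1 ⧸ LinearMap.range (HBm k B1 g))) e hTc
  have h3 := ft_1 (HB_add k h0) (HB_add k h1) hs hE hδ hex hA hpd hTc' Y s
  have h4 := (shift (n-l-2) (ModuleCat.of B2 Q) Z (fun s hs => hQQ s (by omega)) hZ (l+s+2) Y
    (fun t => by
      have := pd_EV hpd Y (s+2+t)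
      rwa [show l + (s+2+t) + 1 = l + s + 2 + t + 1 by omega] at this)).1 h3
  rwa [show l + s + 2 + (n-l-2) + 1 = n + s + 1 by omega] at h4

lemma main_2 [FiniteDimensional k A1] (hB : DC B1 A1 (DD k Q)) {m : ℕ} (hm : m + l + 2 ≤ n)
    (hid : idLE A1 (ModuleCat.of A1 (DD k Q)) m)
    (hself : ∀ s, EV A1 (DD k Q) (DD k Q) (s+1))
    (hW : ∀ (Y : Type) [AddCommGroup Y] [Module A1 Y], EV A1 (DD k (Q →ₗ[B2] Q)) Y (n + 1)) :
    CoresLE B1 (ModuleCat.of B1 (DD k Q)) (InAdd B1 (ModuleCat.of B1 (DD k Q))) T l := by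
  letI := HBmod k B1 P0
  letI := HBmod k B1 P1
  obtain ⟨e⟩ := hT
  obtain ⟨δ, hδ, hex⟩ := exists_delta (k := k) (A1 := A1) (A2 := A2) (B1 := B1) (Q := Q) h0 h1 hp hgp
  have hE : Function.Exact (HBm k B1 g) (LinearMap.range (HBm k B1 g)).mkQ := fun x => by simp
  have hs := Submodule.mkQ_surjective (LinearMap.range (HBm k B1 g))
  refine coresLE_equiv (Y := T) (X := ModuleCat.of B1 (HB B2 P1 ⧸ LinearMap.range (HBm k B1 g))) e.symm ?_
  have := noeth k A1
  have hfQ : Module.Finite A1 (DD k Q) := fg_of_fd k (DD k Q)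
  refine ft_2 (HB_add k h0) (HB_add k h1) hs hE hδ hex hA hB hpd hself ?_ ?_ ?_
  · intro s
    refine (shift (n-l-2) (ModuleCat.of B2 Q) Z (fun s hs => hQQ s (by omega)) hZ s (DD k Q)
      (fun t => hself _)).2 ?_
    have := id_EV hid (DD k (Q →ₗ[B2] Q)) (n-l-2-m+s)
    rwa [show m + (n-l-2-m+s) + 1 = s + (n-l-2) + 1 by omega] at this
  · have hf : Module.Finite A1 (HB B2 P1 →ₗ[B1] DD k Q) := (dualProj (HB_add k h1)).finite
    have : IsNoetherian A1 (HB B2 P1 →ₗ[B1] DD k Q) := isNoetherian_of_isNoetherianRing_of_finite _ _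
    exact Module.Finite.of_injective _ (dm_inj (A := B1) (B := A1) (Q := DD k Q) hs)
  · intro Y _ _
    refine (shift (n-l-2) (ModuleCat.of B2 Q) Z (fun s hs => hQQ s (by omega)) hZ (l+2) Y
      (fun t => by
        have := pd_EV hpd Y (2+t)
        rwa [show l + (2+t) + 1 = l + 2 + t + 1 by omega] at this)).2 ?_
    have := hW Y
    rwa [show n + 1 = l + 2 + (n-l-2) + 1 by omega] at this

end fin
end main
end QP
end

set_option linter.unusedSectionVars false
set_option linter.style.haveILetI false
noncomputable section
namespace QP
open CategoryTheory Abelian Paper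

/-- `T` is a (not necessarily minimal) transpose of `Z`. -/
def TrData (k : Type) [Field k] {B1 B2 : Type} [Ring B1] [Ring B2] [Algebra k B1] [Algebra k B2]
    [IsOp k B1 B2] (Z : ModuleCat.{0} B2) (T : ModuleCat.{0} B1) : Prop :=
  ∃ (P1 P0 : ModuleCat.{0} B2) (g : P1 →ₗ[B2] P0) (p : P0 →ₗ[B2] Z), Add B2 B2 P0 ∧ Add B2 B2 P1 ∧
    Function.Surjective p ∧ Function.Exact g p ∧
    letI := HBmod k B1 P0
    letI := HBmod k B1 P1
    Nonempty (T ≃ₗ[B1] HB B2 P1 ⧸ LinearMap.range (HBm k B1 g))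

section main
variable {k A1 A2 B1 B2 Q : Type} [Field k] [Ring A1] [Ring A2] [Ring B1] [Ring B2]
  [Algebra k A1] [Algebra k A2] [Algebra k B1] [Algebra k B2]
  [IsOp k A1 A2] [IsOp k A2 A1] [OpCompat k A1 A2] [IsOp k B1 B2] [IsOp k B2 B1] [OpCompat k B1 B2]
  [AddCommGroup Q] [Module k Q] [Module A2 Q] [Module B2 Q] [IsScalarTower k A2 Q] [IsScalarTower k B2 Q]
  [SMulCommClass A2 B2 Q] [SMulCommClass B2 A2 Q] [FiniteDimensional k Q]
  [FiniteDimensional k A1] [FiniteDimensional k A2]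
  {Z : ModuleCat.{0} B2} {T : ModuleCat.{0} B1} (hT : TrData k Z T)
  {n l : ℕ} (hQQ : ∀ s, s + 2 < n → EV B2 Q Q (s+1))
  (hZ : Om B2 (n - l - 2) (ModuleCat.of B2 Q) Z)
  (hpd : pdLE A1 (ModuleCat.of A1 (DD k Q)) l)
  (hA : DC A2 B2 Q)

include hT hQQ hZ hpd hA

lemma main_id1 (hl : l + 2 ≤ n)
    (hTc : CoresLE B1 (ModuleCat.of B1 (DD k Q)) (InAdd B1 (ModuleCat.of B1 (DD k Q))) T l) :
    idLE A2 (ModuleCat.of A2 A2) n := by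
  obtain ⟨P1, P0, g, p, h0, h1, hp, hgp, hT⟩ := hT
  rw [id_pd (A' := A1) (k := k)]
  have := noeth k A1
  have hf : Module.Finite A1 (DD k A2) := fg_of_fd k (DD k A2)
  refine (pdF_of_EV (X := ModuleCat.of A1 (DD k A2)) (hX := hf) fun Y hY => ?_).pdLE
  have h := main_1 (k := k) (A1 := A1) (A2 := A2) h0 h1 hp hgp T hT hl hQQ hZ hpd (DC_dual hA) hTc Y 0
  exact EV.equiv (Dme k A1 hA.eqv).symm h

lemma main_id2 (hB : DC B2 A2 Q) [FiniteDimensional k B1] [FiniteDimensional k B2] {m : ℕ}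
    (hm : m + l + 2 ≤ n)
    (hid : idLE A1 (ModuleCat.of A1 (DD k Q)) m)
    (hself : ∀ s, EV A1 (DD k Q) (DD k Q) (s+1))
    (hn : idLE A2 (ModuleCat.of A2 A2) n) :
    CoresLE B1 (ModuleCat.of B1 (DD k Q)) (InAdd B1 (ModuleCat.of B1 (DD k Q))) T l := by
  obtain ⟨P1, P0, g, p, h0, h1, hp, hgp, hT⟩ := hT
  rw [id_pd (A' := A1) (k := k)] at hn
  refine main_2 (k := k) (A1 := A1) (A2 := A2) h0 h1 hp hgp T hT (by omega) hQQ hZ hpd (DC_dual hA)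
    (DC_dual hB) hm hid hself fun Y _ _ => ?_
  exact EV.equiv (Dme k A1 hA.eqv) (pd_EV hn Y 0)
end main
end QP
end

set_option linter.unusedSectionVars false
set_option linter.style.haveILetI false
noncomputable section
namespace QP
open CategoryTheory Abelian Paper

section covers
variable (k : Type) {B : Type} [Field k] [Ring B] [Algebra k B] [FiniteDimensional k B]

lemma inj_retract {I S : Type} [AddCommGroup I] [Module B I] [AddCommGroup S] [Module B S]
    (i : S →ₗ[B] I) (r : I →ₗ[B] S) (h : r ∘ₗ i = LinearMap.id) [hI : Module.Injective B I] :
    Module.Injective B S := by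
  constructor
  intro X Y _ _ _ _ u hu g
  obtain ⟨w, hw⟩ := hI.out u hu (i ∘ₗ g)
  exact ⟨r ∘ₗ w, fun x => by simpa [hw] using LinearMap.congr_fun h (g x)⟩

/-- Fitting splitting -/
lemma fitting {P : Type} [AddCommGroup P] [Module k P] [Module B P] [IsScalarTower k B P]
    [FiniteDimensional k P] (e : P →ₗ[B] P) : ∃ N : ℕ, 0 < N ∧
      IsCompl (LinearMap.ker (e ^ N)) (LinearMap.range (e ^ N)) := by
  have : Module.Finite B P := fg_of_fd k P
  have := noeth k B
  have : IsNoetherian B P := isNoetherian_of_isNoetherianRing_of_finite _ _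
  have : IsArtinianRing B := IsArtinianRing.of_finite k B
  have : IsArtinian B P := isArtinian_of_fg_of_artinian' 
  obtain ⟨N, hN⟩ := Filter.eventually_atTop.1 e.eventually_isCompl_ker_pow_range_pow
  exact ⟨N + 1, by omega, hN _ (by omega)⟩

lemma pow_fix {P X : Type} [AddCommGroup P] [Module B P] [AddCommGroup X] [Module B X]
    (e : P →ₗ[B] P) (p : P →ₗ[B] X) (h : p ∘ₗ e = p) (N : ℕ) (x : P) : p ((e ^ N) x) = p x := by
  induction N with
  | zero => simp
  | succ N ih =>
    rw [pow_succ', Module.End.mul_apply]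
    exact (LinearMap.congr_fun h _).trans ih

lemma pow_fix' {P X : Type} [AddCommGroup P] [Module B P] [AddCommGroup X] [Module B X]
    (e : P →ₗ[B] P) (p : X →ₗ[B] P) (h : e ∘ₗ p = p) (N : ℕ) (x : X) : (e ^ N) (p x) = p x := by
  induction N with
  | zero => simp
  | succ N ih =>
    rw [pow_succ', Module.End.mul_apply, ih]
    exact LinearMap.congr_fun h _

lemma fd_mc (X : ModuleCat.{0} B) (hX : Module.Finite B X) : FiniteDimensional k X :=
  fd_of_fg k (A := B) X

lemma finrank_sub {P : ModuleCat.{0} B} (S : Submodule B P) :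
    Module.finrank k (ModuleCat.of B S) = Module.finrank k (S.restrictScalars k) :=
  LinearEquiv.finrank_eq
    ({ toFun := fun x => x
       map_add' := fun _ _ => rfl
       map_smul' := fun _ _ => rfl
       invFun := fun x => x
       left_inv := fun _ => rfl
       right_inv := fun _ => rfl } : ModuleCat.of B S ≃ₗ[k] (S.restrictScalars k))

lemma cover_aux (d : ℕ) (X : ModuleCat.{0} B) (P : ModuleCat.{0} B) (p : P →ₗ[B] X)
    (hP : Module.Projective B P) (hf : FiniteDimensional k P) (hp : Function.Surjective p)
    (hd : Module.finrank k P ≤ d) :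
    ∃ (P : ModuleCat.{0} B) (p : P →ₗ[B] X), IsProjCover B p ∧ Module.Finite B P := by
  induction d generalizing P with
  | zero =>
    have h0 : Module.finrank k P = 0 := by omega
    have : Subsingleton P := Module.finrank_zero_iff.1 h0
    exact ⟨P, p, ⟨hP, hp, fun K _ => Subsingleton.elim _ _⟩, fg_of_fd k P⟩
  | succ d ih =>
    by_cases hs : Superfluous B (LinearMap.ker p)
    · exact ⟨P, p, ⟨hP, hp, hs⟩, fg_of_fd k P⟩
    unfold Superfluous at hs
    push Not at hs
    obtain ⟨K, hK, hKt⟩ := hs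
    have hKs : Function.Surjective (p ∘ₗ K.subtype) := by
      intro x
      obtain ⟨y, rfl⟩ := hp x
      have : y ∈ K ⊔ LinearMap.ker p := by rw [hK]; trivial
      obtain ⟨a, ha, b, hb, rfl⟩ := Submodule.mem_sup.1 this
      exact ⟨⟨a, ha⟩, by simpa using (LinearMap.mem_ker.1 hb)⟩
    obtain ⟨u, hu⟩ := Module.projective_lifting_property (p ∘ₗ K.subtype) p hKs
    let e : P →ₗ[B] P := K.subtype ∘ₗ u
    have he : p ∘ₗ e = p := hu
    obtain ⟨N, hN0, hN⟩ := fitting k e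
    let S := LinearMap.range (e ^ N)
    have hSK : S ≤ K := by
      rintro _ ⟨y, rfl⟩
      obtain ⟨N, rfl⟩ : ∃ M, N = M + 1 := ⟨N - 1, by omega⟩
      rw [pow_succ', Module.End.mul_apply]
      exact (u ((e ^ N) y)).2
    let r := Submodule.projectionOnto S (LinearMap.ker (e ^ N)) hN.symm
    have hr : r ∘ₗ S.subtype = LinearMap.id := by
      ext x
      exact congrArg Subtype.val (Submodule.projectionOnto_apply_left hN.symm x)
    have hSp : Module.Projective B S := Module.Projective.of_split S.subtype r hr
    refine ih (ModuleCat.of B S) (p ∘ₗ S.subtype) hSp ?_ ?_ ?_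
    · exact Module.Finite.of_injective (S.subtype.restrictScalars k) S.subtype_injective
    · intro x
      obtain ⟨y, rfl⟩ := hp x
      exact ⟨⟨(e ^ N) y, y, rfl⟩, pow_fix e p he N y⟩
    · have h1 : S.restrictScalars k < ⊤ := by
        refine lt_of_le_of_ne le_top fun h => hKt (eq_top_iff.2 fun x _ => hSK ?_)
        have : x ∈ S.restrictScalars k := by rw [h]; trivial
        exact this
      have h2 := Submodule.finrank_lt h1.ne
      have h3 : Module.finrank k (ModuleCat.of B S) = Module.finrank k (S.restrictScalars k) := by
        exact finrank_sub k S
      omega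

include k in
lemma exists_projCover (X : ModuleCat.{0} B) [h : Module.Finite B X] :
    ∃ (P : ModuleCat.{0} B) (p : P →ₗ[B] X), IsProjCover B p ∧ Module.Finite B P := by
  obtain ⟨r, p, hp⟩ := Module.Finite.exists_fin' B X
  exact cover_aux k _ X (ModuleCat.of B (Fin r → B)) p (inferInstanceAs (Module.Projective B (Fin r → B)))
    (fd_mc k (ModuleCat.of B (Fin r → B)) (inferInstanceAs (Module.Finite B (Fin r → B)))) hp le_rfl

lemma env_aux (d : ℕ) (X : ModuleCat.{0} B) (P : ModuleCat.{0} B) (p : X →ₗ[B] P)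
    (hP : Module.Injective B P) (hf : FiniteDimensional k P) (hp : Function.Injective p)
    (hd : Module.finrank k P ≤ d) :
    ∃ (P : ModuleCat.{0} B) (p : X →ₗ[B] P), IsInjEnvelope B p ∧ FiniteDimensional k P := by
  induction d generalizing P with
  | zero =>
    have h0 : Module.finrank k P = 0 := by omega
    have : Subsingleton P := Module.finrank_zero_iff.1 h0
    exact ⟨P, p, ⟨hP, hp, fun K _ => Subsingleton.elim _ _⟩, hf⟩
  | succ d ih =>
    by_cases hs : Essential B (LinearMap.range p)
    · exact ⟨P, p, ⟨hP, hp, hs⟩, hf⟩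
    unfold Essential at hs
    push Not at hs
    obtain ⟨K, hK, hKt⟩ := hs
    have hKs : Function.Injective (K.mkQ ∘ₗ p) := by
      rw [← LinearMap.ker_eq_bot, LinearMap.ker_eq_bot']
      intro x hx
      have h1 : p x ∈ K := by simpa using hx
      have h2 : p x ∈ K ⊓ LinearMap.range p := ⟨h1, x, rfl⟩
      rw [hK] at h2
      exact hp (by simpa using h2)
    obtain ⟨u, hu⟩ := hP.out (K.mkQ ∘ₗ p) hKs p
    let e : P →ₗ[B] P := u ∘ₗ K.mkQ
    have he : e ∘ₗ p = p := LinearMap.ext hu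
    obtain ⟨N, hN0, hN⟩ := fitting k e
    let S := LinearMap.range (e ^ N)
    have hSK : K ≤ LinearMap.ker (e ^ N) := by
      intro y hy
      obtain ⟨N, rfl⟩ : ∃ M, N = M + 1 := ⟨N - 1, by omega⟩
      rw [LinearMap.mem_ker, pow_succ, Module.End.mul_apply]
      have : e y = 0 := by
        show u (K.mkQ y) = 0
        rw [Submodule.mkQ_apply, (Submodule.Quotient.mk_eq_zero K).2 hy, map_zero]
      rw [this, map_zero]
    let r := Submodule.projectionOnto S (LinearMap.ker (e ^ N)) hN.symm
    have hr : r ∘ₗ S.subtype = LinearMap.id := by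
      ext x
      exact congrArg Subtype.val (Submodule.projectionOnto_apply_left hN.symm x)
    have hSp : Module.Injective B S := inj_retract S.subtype r hr
    refine ih (ModuleCat.of B S) (p.codRestrict S (fun x => ⟨p x, pow_fix' e p he N x⟩)) hSp ?_ ?_ ?_
    · exact Module.Finite.of_injective (S.subtype.restrictScalars k) S.subtype_injective
    · intro x y h
      exact hp (congrArg Subtype.val h)
    · have h1 : S.restrictScalars k < ⊤ := by
        refine lt_of_le_of_ne le_top fun h => hKt ?_
        have hS : S = ⊤ := eq_top_iff.2 fun x _ => by
          have : x ∈ S.restrictScalars k := by rw [h]; trivial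
          exact this
        have h4 := hN.inf_eq_bot
        have h5 : LinearMap.ker (e ^ N) = ⊥ := by
          rw [← h4]
          show _ = LinearMap.ker (e ^ N) ⊓ S
          rw [hS, inf_top_eq]
        exact eq_bot_iff.2 (h5 ▸ hSK)
      have h2 := Submodule.finrank_lt h1.ne
      have h3 : Module.finrank k (ModuleCat.of B S) = Module.finrank k (S.restrictScalars k) := by
        exact finrank_sub k S
      omega

lemma fg_of_superfluous {P Y : ModuleCat.{0} B} (g : P →ₗ[B] Y) (hs : Superfluous B (LinearMap.ker g))
    (hf : Module.Finite B (LinearMap.range g)) : Module.Finite B P := by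
  obtain ⟨r, p, hp⟩ := Module.Finite.exists_fin' B (LinearMap.range g)
  obtain ⟨u, hu⟩ := Module.projective_lifting_property g.rangeRestrict p g.surjective_rangeRestrict
  have h1 : LinearMap.range u = ⊤ := by
    apply hs
    rw [eq_top_iff]
    intro x _
    obtain ⟨v, hv⟩ := hp (g.rangeRestrict x)
    refine Submodule.mem_sup.2 ⟨u v, ⟨v, rfl⟩, x - u v, ?_, by abel⟩
    have h2 : g (u v) = (p v : Y) := congrArg Subtype.val (LinearMap.congr_fun hu v)
    rw [LinearMap.mem_ker, map_sub, h2, hv]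
    exact sub_self _
  exact Module.Finite.of_surjective u (LinearMap.range_eq_top.1 h1)

lemma projCover_fg {P X : ModuleCat.{0} B} {p : P →ₗ[B] X} (h : IsProjCover B p) [hX : Module.Finite B X] :
    Module.Finite B P :=
  fg_of_superfluous p h.2.2 (by rw [LinearMap.range_eq_top.2 h.2.1]; exact Module.Finite.equiv Submodule.topEquiv.symm)

include k in
lemma syz_fg {P X : ModuleCat.{0} B} (p : P →ₗ[B] X) [hX : Module.Finite B P] :
    Module.Finite B (LinearMap.ker p) := by
  have := noeth k B
  have : IsNoetherian B P := isNoetherian_of_isNoetherianRing_of_finite _ _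
  infer_instance

include k in
lemma omega_Om (t : ℕ) (X Z : ModuleCat.{0} B) (hX : Module.Finite B X) (h : IsOmegaOf B t X Z) :
    Om B t X Z ∧ Module.Finite B Z := by
  induction t generalizing X with
  | zero => 
    obtain ⟨e⟩ := h
    exact ⟨⟨e⟩, Module.Finite.equiv e.symm⟩
  | succ t ih =>
    obtain ⟨Y, ⟨P, p, hp, ⟨e⟩⟩, h⟩ := h
    have hP := projCover_fg hp
    have := syz_fg k p
    have hY : Module.Finite B Y := Module.Finite.equiv e.symm
    obtain ⟨h1, h2⟩ := ih Y hY h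
    have := hp.1
    refine ⟨⟨Y, P, (LinearMap.ker p).subtype ∘ₗ e.toLinearMap, p, fgproj_add, ?_, hp.2.1, ?_, h1⟩, h2⟩
    · exact Subtype.val_injective.comp e.injective
    · intro x
      constructor
      · intro hx
        exact ⟨e.symm ⟨x, hx⟩, by simp⟩
      · rintro ⟨y, rfl⟩
        exact (e y).2

include k in
lemma exists_omega (t : ℕ) (X : ModuleCat.{0} B) (hX : Module.Finite B X) :
    ∃ Z, IsOmegaOf B t X Z := by
  induction t generalizing X with
  | zero => exact ⟨X, ⟨LinearEquiv.refl _ _⟩⟩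
  | succ t ih =>
    obtain ⟨P, p, hp, hP⟩ := exists_projCover k X
    obtain ⟨Z, hZ⟩ := ih (ModuleCat.of B (LinearMap.ker p)) (syz_fg k p)
    exact ⟨Z, _, ⟨P, p, hp, ⟨LinearEquiv.refl _ _⟩⟩, hZ⟩

include k in
lemma exists_transpose (X : ModuleCat.{0} B) (hX : Module.Finite B X) : ∃ T, IsTransposeOf B X T := by
  obtain ⟨P0, p, hp, hP0⟩ := exists_projCover k X
  have h1 := syz_fg k p
  obtain ⟨P1, q, hq, hP1⟩ := exists_projCover (B := B) k (ModuleCat.of B (LinearMap.ker p)) (h := h1)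
  refine ⟨ModuleCat.of Bᵐᵒᵖ ((P1 →ₗ[B] B) ⧸ LinearMap.range (lprecomp B ((LinearMap.ker p).subtype ∘ₗ q))),
    P1, P0, (LinearMap.ker p).subtype ∘ₗ q, p, hp, hq.1, ?_, ?_, ⟨LinearEquiv.refl _ _⟩⟩
  · intro x
    constructor
    · intro hx
      obtain ⟨y, hy⟩ := hq.2.1 ⟨x, hx⟩
      exact ⟨y, congrArg Subtype.val hy⟩
    · rintro ⟨y, rfl⟩
      exact (q y).2
  · have : LinearMap.ker ((LinearMap.ker p).subtype ∘ₗ q) = LinearMap.ker q := by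
      ext x
      simp
    rw [this]
    exact hq.2.2

variable {B' : Type} [Ring B'] [Algebra k B'] [FiniteDimensional k B'] [IsOp k B B'] [IsOp k B' B] [OpCompat k B B']

include B' in
lemma exists_injEnv (X : ModuleCat.{0} B) [FiniteDimensional k X] :
    ∃ (P : ModuleCat.{0} B) (p : X →ₗ[B] P), IsInjEnvelope B p ∧ FiniteDimensional k P := by
  obtain ⟨r, f, hf⟩ := exists_inj (k := k) (A := B) (A' := B') X
  have hi := DD_injective (k := k) (A := B) (Fin r → B')
  have hfin : Module.Finite B (DD k (Fin r → B')) := fg_of_fd k _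
  exact env_aux k _ X (ModuleCat.of B (DD k (Fin r → B'))) f hi
    (fd_mc k (ModuleCat.of B (DD k (Fin r → B'))) hfin) hf le_rfl

include B' in
lemma injEnv_fd {X I : ModuleCat.{0} B} {f : X →ₗ[B] I} (h : IsInjEnvelope B f) [FiniteDimensional k X] :
    FiniteDimensional k I := by
  obtain ⟨r, j, hj⟩ := exists_inj (k := k) (A := B) (A' := B') X
  have hi := DD_injective (k := k) (A := B) (Fin r → B')
  obtain ⟨w, hw⟩ := hi.out f h.2.1 j
  refine fd_inj (k := k) (A := B) (Y := DD k (Fin r → B')) w ?_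
  rw [← LinearMap.ker_eq_bot]
  apply h.2.2
  rw [eq_bot_iff]
  rintro _ ⟨hx, x, rfl⟩
  have h1 : j x = 0 := by rw [← hw x]; exact hx
  have : x = 0 := hj (by rw [h1, map_zero])
  rw [this, map_zero]; exact Submodule.zero_mem _

lemma cosyz_fd {X I : ModuleCat.{0} B} (f : X →ₗ[B] I) [FiniteDimensional k I] :
    FiniteDimensional k (ModuleCat.of B (I ⧸ LinearMap.range f)) :=
  fd_surj (k := k) (A := B) (X := ModuleCat.of B (I ⧸ LinearMap.range f)) (LinearMap.range f).mkQ (Submodule.mkQ_surjective _)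

lemma omegaInv_Om (t : ℕ) (X Z : ModuleCat.{0} B) (hX : FiniteDimensional k X) (h : IsOmegaInvOf B t X Z) :
    Om B' t (ModuleCat.of B' (DD k X)) (ModuleCat.of B' (DD k Z)) ∧ FiniteDimensional k Z := by
  induction t generalizing X with
  | zero =>
    obtain ⟨e⟩ := h
    exact ⟨⟨(Dme k B' e).symm⟩, fd_inj (k := k) (A := B) e.toLinearMap e.injective⟩
  | succ t ih =>
    obtain ⟨Y, ⟨I, f, hf, ⟨e⟩⟩, h⟩ := h
    have hI := injEnv_fd (B' := B') k hf
    have hC := cosyz_fd k f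
    have hY : FiniteDimensional k Y := fd_inj (k := k) (A := B) (Y := ModuleCat.of B (I ⧸ LinearMap.range f)) e.toLinearMap e.injective
    obtain ⟨h1, h2⟩ := ih Y hY h
    have := hf.1
    let π : I →ₗ[B] Y := e.symm.toLinearMap ∘ₗ (LinearMap.range f).mkQ
    have hπ : Function.Surjective π := e.symm.surjective.comp (Submodule.mkQ_surjective _)
    have hE : Function.Exact f π := fun x => by
      show e.symm _ = 0 ↔ _
      rw [LinearEquiv.map_eq_zero_iff, Submodule.mkQ_apply, Submodule.Quotient.mk_eq_zero]
      rfl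
    have hpr : Module.Projective B' (DD k I) := DD_projective (k := k) (A' := B') (A := B) I
    have hfg : Module.Finite B' (DD k I) := fg_of_fd k _
    exact ⟨⟨_, ModuleCat.of B' (DD k I), Dm k B' π, Dm k B' f, fgproj_add, Dm_inj hπ, Dm_surj hf.2.1,
      Dm_exact hE, h1⟩, h2⟩

include B' in
lemma exists_omegaInv (t : ℕ) (X : ModuleCat.{0} B) (hX : FiniteDimensional k X) :
    ∃ Z, IsOmegaInvOf B t X Z := by
  induction t generalizing X with
  | zero => exact ⟨X, ⟨LinearEquiv.refl _ _⟩⟩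
  | succ t ih =>
    obtain ⟨P, p, hp, hP⟩ := exists_injEnv (B' := B') k X
    obtain ⟨Z, hZ⟩ := ih (ModuleCat.of B (P ⧸ LinearMap.range p)) (cosyz_fd k p)
    exact ⟨Z, _, ⟨P, p, hp, ⟨LinearEquiv.refl _ _⟩⟩, hZ⟩
end covers
end QP
end

set_option linter.unusedSectionVars false
set_option linter.style.haveILetI false
noncomputable section
namespace QP
open CategoryTheory Abelian Paper

section assembly
variable {k A A' B B' Q : Type} [Field k] [Ring A] [Ring A'] [Ring B] [Ring B']
  [Algebra k A] [Algebra k A'] [Algebra k B] [Algebra k B']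
  [IsOp k A A'] [IsOp k A' A] [OpCompat k A A'] [IsOp k B B'] [IsOp k B' B] [OpCompat k B B']
  [FiniteDimensional k A] [FiniteDimensional k A'] [FiniteDimensional k B] [FiniteDimensional k B']
  [AddCommGroup Q] [Module k Q] [Module A Q] [Module B Q] [IsScalarTower k A Q] [IsScalarTower k B Q]
  [SMulCommClass A B Q] [SMulCommClass B A Q] [FiniteDimensional k Q]

lemma gen_iff (k : Type) [Field k] [Algebra k A] [FiniteDimensional k A] [Module k Q]
    [IsScalarTower k A Q] [FiniteDimensional k Q] (hA : DC A B Q) (hB : DC B A Q)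
    (hs : ∀ i, EV A Q Q (i+1)) (j : ℕ) :
    QuasiGenLE B (ModuleCat.of B Q) j ↔ pdLE A (ModuleCat.of A Q) j := by
  have := noeth k A
  have : Module.Finite A Q := fg_of_fd k Q
  exact ⟨fun h => (qg1 hA h).1, fun h => qg2 hA hB h hs⟩

lemma self_dual (hs : ∀ i, EV A Q Q (i+1)) (i : ℕ) : EV A' (DD k Q) (DD k Q) (i+1) :=
  EV_dual i Q Q (hs i)

include A' in
lemma cogen_iff (hA : DC A B Q) (hB : DC B A Q)
    (hs : ∀ i, EV A Q Q (i+1)) (j : ℕ) :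
    QuasiGenLE B' (ModuleCat.of B' (DD k Q)) j ↔ idLE A (ModuleCat.of A Q) j := by
  rw [id_pd (A' := A') (k := k)]
  exact gen_iff k (DC_dual hA) (DC_dual hB) (self_dual hs) j

variable {n m l : ℕ} (hm : m + l + 2 ≤ n) (hA : DC A B Q)
  (hQQ : ∀ s, s + 2 < n → EV B Q Q (s+1))

include hm hA hQQ in
lemma fwd (hg : QuasiGenLE B (ModuleCat.of B Q) l)
    (hc : QuasiGenLE B' (ModuleCat.of B' (DD k Q)) m)
    (h4 : ∃ (Z : ModuleCat.{0} B) (T : ModuleCat.{0} B'), Om B (n - m - 2) (ModuleCat.of B Q) Z ∧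
      TrData k Z T ∧ CoresLE B' (ModuleCat.of B' (DD k Q)) (InAdd B' (ModuleCat.of B' (DD k Q))) T m)
    (h5 : ∃ (Z : ModuleCat.{0} B') (T : ModuleCat.{0} B),
      Om B' (n - l - 2) (ModuleCat.of B' (DD k Q)) Z ∧
      TrData k Z T ∧ CoresLE B (ModuleCat.of B Q) (InAdd B (ModuleCat.of B Q)) T l) :
    DC B A Q ∧ (∀ i, EV A Q Q (i+1)) ∧ idLE A (ModuleCat.of A A) n ∧
      idLE A' (ModuleCat.of A' A') n ∧ domdimGE A (ModuleCat.of A Q) (ModuleCat.of A A) n := by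
  obtain ⟨hpd, hs, hB⟩ := qg1 hA hg
  have hA' : DC A' B' (DD k Q) := DC_dual hA
  obtain ⟨hpd', hs', hB'⟩ := qg1 hA' hc
  refine ⟨hB, hs, ?_, ?_, ?_⟩
  · obtain ⟨Z, T, hZ, hT, hTc⟩ := h4
    exact main_id1 (k := k) (A1 := A') (A2 := A) (B1 := B') (B2 := B) hT hQQ hZ hpd' hA (by omega) hTc
  · obtain ⟨Z, T, hZ, hT, hTc⟩ := h5
    refine main_id1 (k := k) (A1 := A) (A2 := A') (B1 := B) (B2 := B') (l := l) hT
      (fun s hs => EV_dual s Q Q (hQQ s hs)) hZ ?_ hA' (by omega) ?_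
    · exact resLE_equiv (X := ModuleCat.of A Q) (Y := ModuleCat.of A (DD k (DD k Q))) (DDe k Q A A') hpd
    · exact coresLE_test (DDe k Q B B') hTc
  · have := noeth k B
    have : Module.Finite B Q := fg_of_fd k Q
    have := domdim2 (N := n - 2) hA hB (fun i hi => hQQ i (by omega))
    rwa [show n - 2 + 2 = n by omega] at this

variable (hB : DC B A Q) (hs : ∀ i, EV A Q Q (i+1)) (hpd : pdLE A (ModuleCat.of A Q) l)
  (hid : idLE A (ModuleCat.of A Q) m)

include A' hm hA hQQ hB hs hpd hid in
lemma bwd4 (hn : idLE A (ModuleCat.of A A) n)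
    (Z : ModuleCat.{0} B) (T : ModuleCat.{0} B') (hZ : Om B (n - m - 2) (ModuleCat.of B Q) Z)
    (hT : TrData k Z T) :
    CoresLE B' (ModuleCat.of B' (DD k Q)) (InAdd B' (ModuleCat.of B' (DD k Q))) T m := by
  refine main_id2 (k := k) (A1 := A') (A2 := A) (B1 := B') (B2 := B) hT hQQ hZ
    ((id_pd (A' := A') (k := k) m).1 hid) hA hB (m := l) (by omega) ?_ (self_dual hs) hn
  rw [id_pd (A' := A) (k := k)]
  exact resLE_equiv (X := ModuleCat.of A Q) (Y := ModuleCat.of A (DD k (DD k Q))) (DDe k Q A A') hpd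

include A' hm hA hQQ hB hs hpd hid in
lemma bwd5 (hn : idLE A' (ModuleCat.of A' A') n)
    (Z : ModuleCat.{0} B') (T : ModuleCat.{0} B)
    (hZ : Om B' (n - l - 2) (ModuleCat.of B' (DD k Q)) Z)
    (hT : TrData k Z T) :
    CoresLE B (ModuleCat.of B Q) (InAdd B (ModuleCat.of B Q)) T l := by
  refine coresLE_test (DDe k Q B B').symm ?_
  refine main_id2 (k := k) (A1 := A) (A2 := A') (B1 := B) (B2 := B') (l := l) hT
      (fun s hs => EV_dual s Q Q (hQQ s hs)) hZ ?_ (DC_dual hA) (DC_dual hB) (m := m) (by omega) ?_ ?_ hn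
  · exact resLE_equiv (X := ModuleCat.of A Q) (Y := ModuleCat.of A (DD k (DD k Q))) (DDe k Q A A') hpd
  · exact coresLE_equiv (X := ModuleCat.of A Q) (Y := ModuleCat.of A (DD k (DD k Q))) (DDe k Q A A') hid
  · exact self_dual (self_dual hs)

end assembly
end QP
end

set_option linter.unusedSectionVars false
set_option linter.style.haveILetI false
noncomputable section
namespace QP
open CategoryTheory Abelian Paper

section conc
variable (k B : Type) [Field k] [Ring B] [Algebra k B]

/-- the opposite -/
@[reducible] def op1 : IsOp k Bᵐᵒᵖ B := ⟨AlgEquiv.refl⟩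
/-- the opposite of the opposite -/
@[reducible] def op2 : IsOp k B Bᵐᵒᵖ := ⟨AlgEquiv.opOp k B⟩

lemma op12 : letI := op1 k B; letI := op2 k B; OpCompat k B Bᵐᵒᵖ :=
  letI := op1 k B; letI := op2 k B
  ⟨fun _ => rfl, fun _ => rfl⟩

end conc

section tr
variable {k : Type} [Field k] {B1 B2 : Type} [Ring B1] [Ring B2] [Algebra k B1] [Algebra k B2]
    [IsOp k B1 B2]

lemma TrData.of_c {Z : ModuleCat.{0} B2} {T : ModuleCat.{0} B1}
  {P1 P0 : ModuleCat.{0} B2} (g : P1 →ₗ[B2] P0) (p : P0 →ₗ[B2] Z) (h0 : Add B2 B2 P0) (h1 : Add B2 B2 P1)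
    (hp : Function.Surjective p) (hgp : Function.Exact g p)
    (h : letI := HBmod k B1 P0
      letI := HBmod k B1 P1
      ∃ c : HB B2 P1 →ₗ[B1] T, Function.Surjective c ∧ Function.Exact (HBm k B1 g) c) : TrData k Z T := by
  letI := HBmod k B1 P0
  letI := HBmod k B1 P1
  obtain ⟨c, hc, hgc⟩ := h
  refine ⟨P1, P0, g, p, h0, h1, hp, hgp, ⟨?_⟩⟩
  exact ((Submodule.quotEquivOfEq _ _ (LinearMap.exact_iff.1 hgc).symm).trans (c.quotKerEquivOfSurjective hc)).symm

lemma TrData.finite {Z : ModuleCat.{0} B2} {T : ModuleCat.{0} B1} (h : TrData k Z T) : Module.Finite B1 T := by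
  obtain ⟨P1, P0, g, p, h0, h1, hp, hgp, ⟨e⟩⟩ := h
  letI := HBmod k B1 P0
  letI := HBmod k B1 P1
  have : Module.Finite B1 (HB B2 P1) := (HB_add (k := k) (B1 := B1) h1).finite
  exact Module.Finite.equiv e.symm
end tr

section tr2
variable (k : Type) {B : Type} [Field k] [Ring B] [Algebra k B] [FiniteDimensional k B]

lemma tr1 (X : ModuleCat.{0} B) (hX : Module.Finite B X) (T : ModuleCat.{0} Bᵐᵒᵖ) (h : IsTransposeOf B X T) :
    letI := op1 k B
    TrData k X T := by
  letI := op1 k B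
  obtain ⟨P1, P0, g, p, hp, hP1, hgp, hs, ⟨e⟩⟩ := h
  have hf0 := projCover_fg hp
  have hP0 := hp.1
  have hf1 : Module.Finite B P1 := by
    refine fg_of_superfluous g hs ?_
    rw [← LinearMap.exact_iff.1 hgp]
    exact syz_fg k p
  refine TrData.of_c g p fgproj_add fgproj_add hp.2.1 hgp ?_
  letI := HBmod k Bᵐᵒᵖ P0
  letI := HBmod k Bᵐᵒᵖ P1
  let N := LinearMap.range (lprecomp B g)
  let F : (P1 →ₗ[B] B) →ₗ[Bᵐᵒᵖ] T := e.symm.toLinearMap ∘ₗ N.mkQ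
  have hF : Function.Surjective F := e.symm.surjective.comp (Submodule.mkQ_surjective N)
  have hF0 : ∀ x : P1 →ₗ[B] B, F x = 0 ↔ x ∈ N := fun x => by
    show e.symm (N.mkQ x) = 0 ↔ _
    rw [LinearEquiv.map_eq_zero_iff, Submodule.mkQ_apply, Submodule.Quotient.mk_eq_zero]
  exact ⟨{ toFun := fun f => F f
           map_add' := fun x y => F.map_add x y
           map_smul' := fun b x => F.map_smul b x }, hF, fun x => hF0 x⟩

lemma tr2 (X : ModuleCat.{0} Bᵐᵒᵖ) (hX : Module.Finite Bᵐᵒᵖ X) (T' : ModuleCat.{0} Bᵐᵒᵖᵐᵒᵖ)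
    (h : IsTransposeOf Bᵐᵒᵖ X T') (T : ModuleCat.{0} B)
    (e' : T ≃ₗ[B] ((ModuleCat.restrictScalars (opOpHom B)).obj T')) :
    letI := op2 k B
    TrData k X T := by
  letI := op2 k B
  obtain ⟨P1, P0, g, p, hp, hP1, hgp, hs, ⟨e⟩⟩ := h
  have hf0 := projCover_fg hp
  have hP0 := hp.1
  have hf1 : Module.Finite Bᵐᵒᵖ P1 := by
    refine fg_of_superfluous g hs ?_
    rw [← LinearMap.exact_iff.1 hgp]
    exact syz_fg k p
  refine TrData.of_c g p fgproj_add fgproj_add hp.2.1 hgp ?_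
  letI := HBmod k B P0
  letI := HBmod k B P1
  let N := LinearMap.range (lprecomp Bᵐᵒᵖ g)
  let F : (P1 →ₗ[Bᵐᵒᵖ] Bᵐᵒᵖ) →ₗ[Bᵐᵒᵖᵐᵒᵖ] T' := e.symm.toLinearMap ∘ₗ N.mkQ
  have hF : Function.Surjective F := e.symm.surjective.comp (Submodule.mkQ_surjective N)
  have hF0 : ∀ x : P1 →ₗ[Bᵐᵒᵖ] Bᵐᵒᵖ, F x = 0 ↔ x ∈ N := fun x => by
    show e.symm (N.mkQ x) = 0 ↔ _
    rw [LinearEquiv.map_eq_zero_iff, Submodule.mkQ_apply, Submodule.Quotient.mk_eq_zero]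
  let c0 : HB Bᵐᵒᵖ P1 →ₗ[B] ((ModuleCat.restrictScalars (opOpHom B)).obj T') :=
    { toFun := fun f => F f
      map_add' := fun x y => F.map_add x y
      map_smul' := fun b x => F.map_smul (op (op b)) x }
  refine ⟨e'.symm.toLinearMap ∘ₗ c0, ?_, ?_⟩
  · exact e'.symm.surjective.comp hF
  · intro x
    show e'.symm (c0 x) = 0 ↔ _
    rw [LinearEquiv.map_eq_zero_iff]
    exact hF0 x

/-- the regular right module -/
def opReg : Bᵐᵒᵖ ≃ₗ[Bᵐᵒᵖ] (ModuleCat.of Bᵐᵒᵖ B) where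
  toFun x := (unop x : B)
  map_add' _ _ := rfl
  map_smul' _ _ := rfl
  invFun x := op (x : B)
  left_inv _ := rfl
  right_inv _ := rfl

lemma dcog : letI := op2 k B
    Nonempty (Dcogen k B ≃ₗ[B] DD k Bᵐᵒᵖ) :=
  letI := op2 k B
  have key : ∀ (Y : ModuleCat.{0} Bᵐᵒᵖ) (_ : Bᵐᵒᵖ ≃ₗ[Bᵐᵒᵖ] Y), Nonempty (Dunop k B Y ≃ₗ[B] DD k Bᵐᵒᵖ) :=
    fun Y e => ⟨(LinearEquiv.refl B (DD k Y)).trans (Dme k B e)⟩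
  key _ opReg

variable (Q : ModuleCat.{0} B) (hQ : FiniteDimensional k Q)
include hQ

lemma cogen_br (j : ℕ) :
    letI := op1 k B
    QuasiCogenLE k B Q j ↔ QuasiGenLE Bᵐᵒᵖ (ModuleCat.of Bᵐᵒᵖ (DD k Q)) j := by
  letI := op1 k B
  letI := op2 k B
  haveI := op12 k B
  obtain ⟨dc⟩ := dcog k (B := B)
  constructor
  · intro h
    have h1 := resLE_equiv (X := Dcogen k B) (Y := ModuleCat.of B (DD k Bᵐᵒᵖ)) dc h
    have h2 := resD (k := k) (A := B) (A' := Bᵐᵒᵖ) (Q := Q) j (DD k Bᵐᵒᵖ) h1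
    exact coresLE_equiv (X := ModuleCat.of Bᵐᵒᵖ (DD k (DD k Bᵐᵒᵖ))) (Y := ModuleCat.of Bᵐᵒᵖ Bᵐᵒᵖ)
      (DDe k Bᵐᵒᵖ Bᵐᵒᵖ B).symm h2
  · intro h
    have h1 := coresD (k := k) (A := Bᵐᵒᵖ) (A' := B) (Q := DD k Q) j Bᵐᵒᵖ h
    have h2 := resLE_equiv (X := ModuleCat.of B (DD k Bᵐᵒᵖ)) (Y := Dcogen k B) dc.symm h1
    exact resLE_test (DDe k Q B Bᵐᵒᵖ).symm h2

lemma tau_br {N m : ℕ} (h : ∃ T, IsTauN k B N Q T ∧ RelAddDimLE B Q T m) :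
    letI := op1 k B
    ∃ (Z : ModuleCat.{0} B) (T : ModuleCat.{0} Bᵐᵒᵖ), Om B (N - 1) Q Z ∧
      TrData k Z T ∧ CoresLE Bᵐᵒᵖ (ModuleCat.of Bᵐᵒᵖ (DD k Q)) (InAdd Bᵐᵒᵖ (ModuleCat.of Bᵐᵒᵖ (DD k Q))) T m := by
  letI := op1 k B
  letI := op2 k B
  haveI := op12 k B
  obtain ⟨T, ⟨Z, hZ, Tr, hTr, ⟨e⟩⟩, hT⟩ := h
  obtain ⟨h1, h2⟩ := omega_Om k (N-1) Q Z (fg_of_fd k Q) hZ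
  have h3 := tr1 k Z h2 Tr hTr
  have h4 : FiniteDimensional k Tr := fd_mc k Tr h3.finite
  refine ⟨Z, Tr, h1, h3, ?_⟩
  have h5 := resLE_equiv (X := T) (Y := ModuleCat.of B (DD k Tr)) e hT
  have h6 := resD (k := k) (A := B) (A' := Bᵐᵒᵖ) (Q := Q) m (DD k Tr) h5
  exact coresLE_equiv (X := ModuleCat.of Bᵐᵒᵖ (DD k (DD k Tr))) (Y := Tr) (DDe k Tr Bᵐᵒᵖ B).symm h6

lemma tau_br' {N m : ℕ} (h : letI := op1 k B
    ∀ (Z : ModuleCat.{0} B) (T : ModuleCat.{0} Bᵐᵒᵖ), Om B (N - 1) Q Z →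
      TrData k Z T → CoresLE Bᵐᵒᵖ (ModuleCat.of Bᵐᵒᵖ (DD k Q)) (InAdd Bᵐᵒᵖ (ModuleCat.of Bᵐᵒᵖ (DD k Q))) T m) :
    ∃ T, IsTauN k B N Q T ∧ RelAddDimLE B Q T m := by
  letI := op1 k B
  letI := op2 k B
  haveI := op12 k B
  have hQ' : Module.Finite B Q := fg_of_fd k Q
  obtain ⟨Z, hZ⟩ := exists_omega k (N-1) Q hQ'
  obtain ⟨h1, h2⟩ := omega_Om k (N-1) Q Z hQ' hZ
  obtain ⟨Tr, hTr⟩ := exists_transpose k Z h2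
  have h3 := tr1 k Z h2 Tr hTr
  refine ⟨Dunop k B Tr, ⟨Z, hZ, Tr, hTr, ⟨LinearEquiv.refl _ _⟩⟩, ?_⟩
  have h4 := coresD (k := k) (A := Bᵐᵒᵖ) (A' := B) (Q := DD k Q) m Tr (h Z Tr h1 h3)
  exact resLE_test (DDe k Q B Bᵐᵒᵖ).symm h4

lemma tauInv_br {N m : ℕ} (h : ∃ T, IsTauInvN k B N Q T ∧ RelAddCodimLE B Q T m) :
    letI := op1 k B
    letI := op2 k B
    ∃ (Z : ModuleCat.{0} Bᵐᵒᵖ) (T : ModuleCat.{0} B), Om Bᵐᵒᵖ (N - 1) (ModuleCat.of Bᵐᵒᵖ (DD k Q)) Z ∧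
      TrData k Z T ∧ CoresLE B Q (InAdd B Q) T m := by
  letI := op1 k B
  letI := op2 k B
  haveI := op12 k B
  obtain ⟨T, ⟨Z, hZ, Tr, hTr, ⟨e⟩⟩, hT⟩ := h
  obtain ⟨h1, h2⟩ := omegaInv_Om (B' := Bᵐᵒᵖ) k (N-1) Q Z hQ hZ
  exact ⟨_, T, h1, tr2 k (ModuleCat.of Bᵐᵒᵖ (DD k Z)) (fg_of_fd k (DD k Z)) Tr hTr T e, hT⟩

lemma tauInv_br' {N m : ℕ} (h :
    letI := op1 k B
    letI := op2 k B
    ∀ (Z : ModuleCat.{0} Bᵐᵒᵖ) (T : ModuleCat.{0} B), Om Bᵐᵒᵖ (N - 1) (ModuleCat.of Bᵐᵒᵖ (DD k Q)) Z →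
      TrData k Z T → CoresLE B Q (InAdd B Q) T m) : ∃ T, IsTauInvN k B N Q T ∧ RelAddCodimLE B Q T m := by
  letI := op1 k B
  letI := op2 k B
  haveI := op12 k B
  obtain ⟨Z, hZ⟩ := exists_omegaInv (B' := Bᵐᵒᵖ) k (N-1) Q hQ
  obtain ⟨h1, h2⟩ := omegaInv_Om (B' := Bᵐᵒᵖ) k (N-1) Q Z hQ hZ
  have hf : Module.Finite Bᵐᵒᵖ (DD k Z) := fg_of_fd k (DD k Z)
  obtain ⟨Tr, hTr⟩ := exists_transpose k (ModuleCat.of Bᵐᵒᵖ (DD k Z)) hf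
  refine ⟨(ModuleCat.restrictScalars (opOpHom B)).obj Tr, ⟨Z, hZ, Tr, hTr, ⟨LinearEquiv.refl _ _⟩⟩, ?_⟩
  exact h _ _ h1 (tr2 k (ModuleCat.of Bᵐᵒᵖ (DD k Z)) hf Tr hTr _ (LinearEquiv.refl _ _))

end tr2
end QP
end

set_option linter.unusedSectionVars false
set_option linter.style.haveILetI false
noncomputable section
namespace QP
open CategoryTheory Abelian Paper

section fin
variable (k : Type) {A B : Type} [Field k] [Ring A] [Ring B] [Algebra k A] [Algebra k B]
  [FiniteDimensional k A] [FiniteDimensional k B]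

lemma fd_op (A : Type) [Ring A] [Algebra k A] [FiniteDimensional k A] : FiniteDimensional k Aᵐᵒᵖ :=
  Module.Finite.equiv (MulOpposite.opLinearEquiv k : A ≃ₗ[k] Aᵐᵒᵖ)

lemma final1 (Q : ModuleCat.{0} B) [Module A Q] [IsScalarTower k A Q]
    [SMulCommClass A B Q] [SMulCommClass B A Q] (hQ : FiniteDimensional k Q)
    {n m l : ℕ} (hm : m + l + 2 ≤ n) (hA : DC A B Q) (h : IsQPCT k B Q n m l) :
    DC B A Q ∧ IsRelAGPair A (ModuleCat.of A Q) n ∧ pdEq A (ModuleCat.of A Q) l ∧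
      idEq A (ModuleCat.of A Q) m := by
  letI := op1 k A
  letI := op2 k A
  letI := op1 k B
  letI := op2 k B
  haveI := op12 k A
  haveI := op12 k B
  haveI := fd_op k A
  haveI := fd_op k B
  obtain ⟨h1, h2, h3, h4, h5⟩ := h
  have h4' := tau_br k Q hQ h4
  have h5' := tauInv_br k Q hQ h5
  rw [show n - m - 1 - 1 = n - m - 2 by omega] at h4'
  rw [show n - l - 1 - 1 = n - l - 2 by omega] at h5'
  have hQQ : ∀ s, s + 2 < n → EV B Q Q (s+1) := fun s hs =>
    (extVanish_iff Q Q s).1 (h1 _ (by omega) (by omega))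
  obtain ⟨hB, hs, hi1, hi2, hd⟩ := fwd (k := k) (A := A) (A' := Aᵐᵒᵖ) (B := B) (B' := Bᵐᵒᵖ) (Q := Q) hm hA hQQ
    h2.1 ((cogen_br k Q hQ m).1 h3.1) h4' h5'
  have hg := gen_iff k hA hB hs
  have hc : ∀ j, QuasiCogenLE k B Q j ↔ idLE A (ModuleCat.of A Q) j := fun j =>
    (cogen_br k Q hQ j).trans
      (cogen_iff (k := k) (A := A) (A' := Aᵐᵒᵖ) (B := B) (B' := Bᵐᵒᵖ) (Q := Q) hA hB hs j)
  refine ⟨hB, ⟨hi1, hi2, (selfOrth_iff (ModuleCat.of A Q)).2 hs, hd⟩, ⟨(hg l).1 h2.1, fun j hj => h2.2 j ((hg j).2 hj)⟩,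
    ⟨(hc m).1 h3.1, fun j hj => h3.2 j ((hc j).2 hj)⟩⟩

lemma final2 (Q : ModuleCat.{0} B) [Module A Q] [IsScalarTower k A Q]
    [SMulCommClass A B Q] [SMulCommClass B A Q] (hQ : FiniteDimensional k Q)
    {n m l : ℕ} (hm : m + l + 2 ≤ n) (hB : DC B A Q)
    (h : IsRelAGPair A (ModuleCat.of A Q) n) (hl : pdEq A (ModuleCat.of A Q) l)
    (hi : idEq A (ModuleCat.of A Q) m) :
    DC A B Q ∧ IsQPCT k B Q n m l := by
  letI := op1 k A
  letI := op2 k A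
  letI := op1 k B
  letI := op2 k B
  haveI := op12 k A
  haveI := op12 k B
  haveI := fd_op k A
  haveI := fd_op k B
  obtain ⟨hi1, hi2, hs, hd⟩ := h
  have hs : ∀ i, EV A Q Q (i+1) := (selfOrth_iff (ModuleCat.of A Q)).1 hs
  obtain ⟨hA, hQQ⟩ := domdim1 (B := B) (Q := Q) (N := n - 2) hB (by rwa [show n - 2 + 2 = n by omega])
  have hQQ : ∀ s, s + 2 < n → EV B Q Q (s+1) := fun s hs => hQQ s (by omega)
  have hg := gen_iff k hA hB hs
  have hc : ∀ j, QuasiCogenLE k B Q j ↔ idLE A (ModuleCat.of A Q) j := fun j =>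
    (cogen_br k Q hQ j).trans
      (cogen_iff (k := k) (A := A) (A' := Aᵐᵒᵖ) (B := B) (B' := Bᵐᵒᵖ) (Q := Q) hA hB hs j)
  refine ⟨hA, ?_, ⟨(hg l).2 hl.1, fun j hj => hl.2 j ((hg j).1 hj)⟩,
    ⟨(hc m).2 hi.1, fun j hj => hi.2 j ((hc j).1 hj)⟩, ?_, ?_⟩
  · intro i h1 h2
    obtain ⟨s, rfl⟩ : ∃ s, i = s + 1 := ⟨i - 1, by omega⟩
    exact (extVanish_iff Q Q s).2 (hQQ s (by omega))
  · refine tau_br' k Q hQ ?_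
    rw [show n - m - 1 - 1 = n - m - 2 by omega]
    exact fun Z T hZ hT => bwd4 (k := k) (A := A) (A' := Aᵐᵒᵖ) (B := B) (B' := Bᵐᵒᵖ) (Q := Q) hm hA hQQ hB hs
      hl.1 hi.1 hi1 Z T hZ hT
  · refine tauInv_br' k Q hQ ?_
    rw [show n - l - 1 - 1 = n - l - 2 by omega]
    exact fun Z T hZ hT => bwd5 (k := k) (A := A) (A' := Aᵐᵒᵖ) (B := B) (B' := Bᵐᵒᵖ) (Q := Q) hm hA hQQ hB hs
      hl.1 hi.1 hi2 Z T hZ hT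

variable (A) in
lemma fd_end (Q : ModuleCat.{0} A) (hQ : FiniteDimensional k Q) : FiniteDimensional k (Module.End A Q) :=
  FiniteDimensional.of_injective
    ({ toFun := fun f => f.restrictScalars k
       map_add' := fun _ _ => rfl
       map_smul' := fun _ _ => rfl } : (Module.End A Q) →ₗ[k] (Q →ₗ[k] Q))
    (fun f g h => by
      ext q
      exact LinearMap.congr_fun h q)

lemma bij_end (Q : ModuleCat.{0} A) (h : DC A (Module.End A Q) Q) : Function.Bijective (toEndE A Q) := by
  constructor
  · rw [injective_iff_map_eq_zero]
    exact fun a ha => h.2 a (fun q => LinearMap.congr_fun ha q)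
  · intro φ
    obtain ⟨a, ha⟩ := h.1 φ
    exact ⟨a, by ext q; exact (ha q).symm⟩

lemma dc_end (Q : ModuleCat.{0} A) : DC (Module.End A Q) A Q :=
  ⟨fun φ => ⟨φ, fun _ => rfl⟩, fun _ h => LinearMap.ext h⟩

lemma part1 {n m l : ℕ} (hm : m + l + 2 ≤ n) (Q : ModuleCat.{0} B) [Module.Finite B Q]
    (h : IsQPCT k B Q n m l) :
    IsRelAGPair (Module.End B Q) (ModuleCat.of (Module.End B Q) Q) n ∧
         pdEq (Module.End B Q) (ModuleCat.of (Module.End B Q) Q) l ∧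
         idEq (Module.End B Q) (ModuleCat.of (Module.End B Q) Q) m ∧
         FiniteDimensional k (Module.End B Q) ∧
         Function.Bijective (toEndE B Q) := by
  have hQ := fd_mc k Q inferInstance
  have hE := fd_end k B Q hQ
  haveI : IsScalarTower k (Module.End B Q) Q := ⟨fun _ _ _ => rfl⟩
  obtain ⟨h1, h2, h3, h4⟩ := final1 k (A := Module.End B Q) Q hQ hm (dc_end Q) h
  exact ⟨h2, h3, h4, hE, bij_end Q h1⟩

lemma part2 {n m l : ℕ} (hm : m + l + 2 ≤ n) (Q : ModuleCat.{0} A) [Module.Finite A Q]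
    (h : IsRelAGPair A Q n) (hl : pdEq A Q l) (hi : idEq A Q m) :
    IsQPCT k (Module.End A Q) (ModuleCat.of (Module.End A Q) Q) n m l ∧
         FiniteDimensional k (Module.End A Q) ∧
         Function.Bijective (toEndE A Q) := by
  have hQ := fd_mc k Q inferInstance
  have hE := fd_end k A Q hQ
  let Q' := ModuleCat.of (Module.End A Q) Q
  letI : Module A Q' := inferInstanceAs (Module A Q)
  haveI : IsScalarTower k A Q' := inferInstanceAs (IsScalarTower k A Q)
  haveI : SMulCommClass A (Module.End A Q) Q' := endSMulComm' A Q
  haveI : SMulCommClass (Module.End A Q) A Q' := endSMulComm A Q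
  have hf : FiniteDimensional k Q' := hQ
  obtain ⟨h1, h2⟩ := final2 k (A := A) Q' hf hm (dc_end Q) h hl hi
  exact ⟨h2, hE, bij_end Q h1⟩

end fin
end QP
end

noncomputable section Statement11
open Paper

/-- Theorem A, the higher Auslander–Iyama–Solberg correspondence:
for `n ≥ m + l + 2` there is a one-to-one correspondence between pairs `(Λ, Q)` with
`Q` an `(n, m, l)`-quasi-precluster tilting right `Λ`-module and relative
`n`-Auslander–Gorenstein pairs `(A, Q)` with `Q` self-orthogonal of projective
dimension `l` and injective dimension `m`.  The correspondence is given by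
`(Λ, Q) ↦ (End_Λ(Q), Q)` and `(A, Q) ↦ (End_A(Q)^op, Q)`; the fact that these
assignments are mutually inverse (up to the canonical isomorphisms) is expressed by
the bijectivity of the canonical double-centralizer maps.  Right `Λ`-modules are
left `Λᵐᵒᵖ`-modules, and right `End_A(Q)^op`-modules are left `End_A(Q)`-modules. -/
theorem stmt11 (k : Type) [Field k] (n m l : ℕ) (h : m + l + 2 ≤ n) :
    (∀ (Λ : Type) [Ring Λ] [Algebra k Λ] [FiniteDimensional k Λ]
       (Q : ModuleCat.{0} Λᵐᵒᵖ) [Module.Finite Λᵐᵒᵖ Q],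
       IsQPCT k Λᵐᵒᵖ Q n m l →
         IsRelAGPair (Module.End Λᵐᵒᵖ Q) (ModuleCat.of (Module.End Λᵐᵒᵖ Q) Q) n ∧
         pdEq (Module.End Λᵐᵒᵖ Q) (ModuleCat.of (Module.End Λᵐᵒᵖ Q) Q) l ∧
         idEq (Module.End Λᵐᵒᵖ Q) (ModuleCat.of (Module.End Λᵐᵒᵖ Q) Q) m ∧
         FiniteDimensional k (Module.End Λᵐᵒᵖ Q) ∧
         Function.Bijective (toEndE Λᵐᵒᵖ Q)) ∧
    (∀ (A : Type) [Ring A] [Algebra k A] [FiniteDimensional k A]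
       (Q : ModuleCat.{0} A) [Module.Finite A Q],
       IsRelAGPair A Q n → pdEq A Q l → idEq A Q m →
         IsQPCT k (Module.End A Q) (ModuleCat.of (Module.End A Q) Q) n m l ∧
         FiniteDimensional k (Module.End A Q) ∧
         Function.Bijective (toEndE A Q)) := by
  constructor
  · intro Λ _ _ _ Q _ hQ
    haveI := QP.fd_op k Λ
    exact QP.part1 k h Q hQ
  · intro A _ _ _ Q _ h1 h2 h3
    exact QP.part2 k h Q h1 h2 h3

end Statement11
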